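/- arXiv:2309.12549 — 3 statements merged into one kernel-verified Lean document; each statement's English description precedes it below -/
import Mathlib

section
/- Let ℓ = 2^a for a positive integer a, and for each i = 1, …, ℓ let a_i and s_i be positive integers with s_i even. If a_i·s_i = a_j·s_j for all i and j, then OP*(s_1^⟨a_1⟩, …, s_ℓ^⟨a_ℓ⟩) has a solution (the list consisting of a_i copies of s_i for each i = 1, …, ℓ). -/
/-- A solution to the directed Oberwolfach problem OP*(m₁, …, m_k). -/
def HasOPSolution (m : List ℕ) : Prop :=
  ∃ σ : Fin (m.sum - 1) → Equiv.Perm (Fin m.sum),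
    (∀ i, (σ i).cycleType = (m : Multiset ℕ)) ∧
    ∀ x y : Fin m.sum, x ≠ y → ∃! i, σ i x = y

/-- `F` is a permutation whose disjoint cycles, indexed by `J`, have lengths `s j`. -/
def HasCycleLengths {V J : Type} (F : V → V) (s : J → ℕ) : Prop :=
  ∃ f : V → Σ j, ZMod (s j), f.Bijective ∧ ∀ v, f (F v) = ⟨(f v).1, (f v).2 + 1⟩

namespace HasCycleLengths

variable {V W J J' : Type} {F : V → V} {s : J → ℕ}

theorem bijective (h : HasCycleLengths F s) : F.Bijective := by
  obtain ⟨f, hf, hF⟩ := h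
  constructor
  · intro v w hvw
    have h1 : f (F v) = f (F w) := by rw [hvw]
    rw [hF, hF] at h1
    apply hf.1
    obtain ⟨h2, h3⟩ := Sigma.mk.inj h1
    generalize f v = a at *
    generalize f w = b at *
    obtain ⟨i, a⟩ := a
    obtain ⟨j, b⟩ := b
    cases h2
    simpa using h3
  · intro w
    obtain ⟨v, hv⟩ := hf.2 ⟨(f w).1, (f w).2 - 1⟩
    refine ⟨v, hf.1 ?_⟩
    rw [hF, hv]
    simp

theorem apply_ne (h : HasCycleLengths F s) (hs : ∀ j, 2 ≤ s j) (v : V) : F v ≠ v := by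
  obtain ⟨f, hf, hF⟩ := h
  intro hv
  have h1 := hF v
  rw [hv] at h1
  generalize f v = a at *
  obtain ⟨i, a⟩ := a
  have h2 := eq_of_heq (Sigma.mk.inj h1).2
  have : Fact (1 < s i) := ⟨hs i⟩
  exact one_ne_zero (α := ZMod (s i)) (by simpa using h2.symm)

theorem card [Fintype V] [Fintype J] (h : HasCycleLengths F s) (hs : ∀ j, 0 < s j) :
    Fintype.card V = ∑ j, s j := by
  obtain ⟨f, hf, -⟩ := h
  have : ∀ j, NeZero (s j) := fun j => ⟨(hs j).ne'⟩
  rw [Fintype.card_of_bijective hf, Fintype.card_sigma]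
  simp [ZMod.card]

theorem conj (h : HasCycleLengths F s) (e : V ≃ W) :
    HasCycleLengths (fun w => e (F (e.symm w))) s := by
  obtain ⟨f, hf, hF⟩ := h
  exact ⟨f ∘ e.symm, hf.comp e.symm.bijective, fun w => by simp [hF]⟩

theorem reindex (h : HasCycleLengths F s) (e : J ≃ J') {s' : J' → ℕ} (hs : ∀ j, s' (e j) = s j) :
    HasCycleLengths F s' := by
  obtain rfl : s = s' ∘ e := funext fun j => (hs j).symm
  obtain ⟨f, hf, hF⟩ := h
  refine ⟨fun v => ⟨e (f v).1, (f v).2⟩, ?_,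
    fun v => congrArg (fun z => (⟨e z.1, z.2⟩ : Σ j, ZMod (s' j))) (hF v)⟩
  exact (Equiv.sigmaCongrLeft (β := fun j => ZMod (s' j)) e).bijective.comp hf

/-- A function advancing a phase along labelled orbits has the expected cycle lengths as soon as
every label occurs and the total length is the number of points. -/
theorem of_labels [Fintype V] [Fintype J] (hs : ∀ j, 0 < s j)
    (hcard : Fintype.card V = ∑ j, s j) (lab : V → J) (ph : ∀ v, ZMod (s (lab v)))
    (hstep : ∀ v, (⟨lab (F v), ph (F v)⟩ : Σ j, ZMod (s j)) = ⟨lab v, ph v + 1⟩)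
    (hlab : ∀ j, ∃ v, lab v = j) : HasCycleLengths F s := by
  have : ∀ j, NeZero (s j) := fun j => ⟨(hs j).ne'⟩
  let f : V → Σ j, ZMod (s j) := fun v => ⟨lab v, ph v⟩
  have hiter : ∀ n v, f (F^[n] v) = ⟨lab v, ph v + n⟩ := by
    intro n
    induction n with
    | zero => intro v; simp [f]
    | succ n ih =>
      intro v
      have h1 : f (F v) = ⟨lab v, ph v + 1⟩ := hstep v
      have h2 : f (F^[n + 1] v) = ⟨(f (F v)).1, (f (F v)).2 + n⟩ := ih (F v)
      rw [h2, h1]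
      push_cast
      congr 1
      ring
  refine ⟨f, ?_, fun v => hstep v⟩
  rw [Fintype.bijective_iff_surjective_and_card]
  constructor
  · rintro ⟨j, z⟩
    obtain ⟨v, rfl⟩ := hlab j
    refine ⟨F^[(z - ph v).val] v, ?_⟩
    rw [hiter]
    simp
  · rw [hcard, Fintype.card_sigma]
    simp [ZMod.card]

/-- The case of `HasCycleLengths.of_labels` with phases given by natural numbers. -/
theorem of_phase [Fintype V] [Fintype J] (hs : ∀ j, 0 < s j)
    (hcard : Fintype.card V = ∑ j, s j) (lab : V → J) (ph : V → ℕ)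
    (hlabF : ∀ v, lab (F v) = lab v) (hph : ∀ v, (ph (F v) : ZMod (s (lab v))) = ph v + 1)
    (hlab : ∀ j, ∃ v, lab v = j) : HasCycleLengths F s := by
  refine of_labels hs hcard lab (fun v => (ph v : ZMod (s (lab v)))) (fun v => ?_) hlab
  rw [← hph v]
  have : ∀ j, j = lab v → (⟨j, (ph (F v) : ZMod (s j))⟩ : Σ j, ZMod (s j)) =
      ⟨lab v, (ph (F v) : ZMod (s (lab v)))⟩ := by
    rintro _ rfl; rfl
  exact this _ (hlabF v)

theorem of_single [Fintype V] {n : ℕ} (hn : 0 < n) (hcard : Fintype.card V = n)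
    (ph : V → ZMod n) (hph : ∀ v, ph (F v) = ph v + 1) :
    HasCycleLengths F (fun _ : Unit => n) := by
  have : Nonempty V := Fintype.card_pos_iff.1 (by omega)
  refine of_labels (fun _ => hn) (by simpa using hcard) (fun _ => ()) ph (fun v => ?_)
    (fun _ => ⟨Classical.arbitrary V, rfl⟩)
  rw [hph]

theorem exists_phase {n : ℕ} (h : HasCycleLengths F (fun _ : Unit => n)) :
    ∃ ph : V → ZMod n, ph.Bijective ∧ ∀ v, ph (F v) = ph v + 1 := by
  obtain ⟨f, hf, hF⟩ := h
  refine ⟨fun v => (f v).2, ?_, fun v => by simp [hF]⟩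
  exact (Equiv.uniqueSigma (fun _ : Unit => ZMod n)).bijective.comp hf

theorem inverse {G : V → V} {n : ℕ} (h : HasCycleLengths F (fun _ : Unit => n))
    (hG : ∀ v, G (F v) = v) : HasCycleLengths G (fun _ : Unit => n) := by
  have hb := h.bijective
  obtain ⟨f, hf, hF⟩ := h
  refine ⟨fun v => ⟨(), -(f v).2⟩, ?_, fun v => ?_⟩
  · exact ((Equiv.sigmaCongrRight fun _ : Unit => Equiv.neg (ZMod n)).bijective.comp hf)
  · obtain ⟨w, rfl⟩ := hb.2 v
    simp only [hG, hF]
    simp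

theorem prod_sigma {T : Type} {J : T → Type} {F : T → V → V} {s : ∀ t, J t → ℕ}
    (h : ∀ t, HasCycleLengths (F t) (s t)) :
    HasCycleLengths (fun v : T × V => (v.1, F v.1 v.2)) (fun j : Σ t, J t => s j.1 j.2) := by
  choose f hf hF using h
  refine ⟨fun v => ⟨⟨v.1, (f v.1 v.2).1⟩, (f v.1 v.2).2⟩, ⟨?_, ?_⟩, ?_⟩
  · rintro ⟨t, v⟩ ⟨t', v'⟩ h
    have h1 : t = t' := congrArg (fun z => z.1.1) h
    subst h1
    have h2 : f t v = f t v' := by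
      simp only at h
      generalize f t v = a at *
      generalize f t v' = b at *
      obtain ⟨a, a'⟩ := a
      obtain ⟨b, b'⟩ := b
      simp only [Sigma.mk.injEq, heq_eq_eq, true_and] at h
      obtain ⟨rfl, h⟩ := h
      rw [eq_of_heq h]
    rw [(hf t).1 h2]
  · rintro ⟨⟨t, j⟩, z⟩
    obtain ⟨v, hv⟩ := (hf t).2 ⟨j, z⟩
    refine ⟨(t, v), ?_⟩
    simp only
    rw [hv]
  · rintro ⟨t, v⟩
    simp only
    rw [hF]

end HasCycleLengths

section CycleType

open Equiv Equiv.Perm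

variable {V J : Type}

/-- The permutation agreeing with `σ` on the points whose label lies in `S`, and fixing the rest. -/
private noncomputable def restrictLabel (σ : Perm V) (lab : V → J) (h : ∀ v, lab (σ v) = lab v)
    (S : Set J) : Perm V := by
  classical exact ofSubtype (σ.subtypePerm (p := fun v => lab v ∈ S) (fun v => by rw [h]))

private theorem restrictLabel_of_mem {σ : Perm V} {lab : V → J} {h : ∀ v, lab (σ v) = lab v}
    {S : Set J} {v : V} (hv : lab v ∈ S) : restrictLabel σ lab h S v = σ v := by
  classical
  unfold restrictLabel
  exact ofSubtype_apply_of_mem (p := fun v => lab v ∈ S) _ hv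

private theorem restrictLabel_of_notMem {σ : Perm V} {lab : V → J} {h : ∀ v, lab (σ v) = lab v}
    {S : Set J} {v : V} (hv : lab v ∉ S) : restrictLabel σ lab h S v = v := by
  classical
  unfold restrictLabel
  exact ofSubtype_apply_of_not_mem (p := fun v => lab v ∈ S) _ hv

theorem HasCycleLengths.cycleType [Fintype V] [DecidableEq V] [Fintype J] {s : J → ℕ} {σ : Perm V}
    (h : HasCycleLengths σ s) (hs : ∀ j, 2 ≤ s j) :
    σ.cycleType = Finset.univ.val.map s := by
  classical
  have hne := h.apply_ne hs
  obtain ⟨f, hf, hF⟩ := h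
  have hz : ∀ j, NeZero (s j) := fun j => ⟨by have := hs j; omega⟩
  have hl : ∀ v, (f (σ v)).1 = (f v).1 := fun v => by rw [hF]
  set lab : V → J := fun v => (f v).1 with hlab
  have key : ∀ S : Finset J, (restrictLabel σ lab hl S).cycleType = S.val.map s := by
    intro S
    induction S using Finset.induction_on with
    | empty =>
      rw [Finset.empty_val, Multiset.map_zero, cycleType_eq_zero]
      ext v
      exact restrictLabel_of_notMem (by simp)
    | insert j S hj ih =>
      have hmul : restrictLabel σ lab hl (insert j S : Finset J) =
          restrictLabel σ lab hl {j} * restrictLabel σ lab hl S := by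
        ext v
        rw [Perm.mul_apply]
        by_cases h1 : lab v ∈ S
        · have h2 : lab v ≠ j := fun h2 => hj (h2 ▸ h1)
          rw [restrictLabel_of_mem (S := (S : Set J)) (by simpa using h1),
            restrictLabel_of_mem (by simp [h1]),
            restrictLabel_of_notMem (fun h3 => h2 ((hl v).symm.trans h3))]
        · rw [restrictLabel_of_notMem (S := (S : Set J)) (by simpa using h1)]
          by_cases h2 : lab v = j
          · rw [restrictLabel_of_mem (by simp [h2]), restrictLabel_of_mem (by simp [h2])]
          · rw [restrictLabel_of_notMem (by simp [h1, h2]), restrictLabel_of_notMem (by simp [h2])]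
      have hdis : Disjoint (restrictLabel σ lab hl {j}) (restrictLabel σ lab hl S) := by
        intro v
        by_cases h2 : lab v = j
        · exact Or.inr (restrictLabel_of_notMem (by simpa [h2] using hj))
        · exact Or.inl (restrictLabel_of_notMem (by simpa using h2))
      rw [hmul, hdis.cycleType_mul, ih, Finset.insert_val_of_notMem hj, Multiset.map_cons,
        ← Multiset.singleton_add]
      congr 1
      obtain ⟨x, hx⟩ := hf.2 ⟨j, 0⟩
      have hpow : ∀ n : ℕ, f ((restrictLabel σ lab hl {j} ^ n) x) = ⟨j, n⟩ := by
        intro n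
        induction n with
        | zero => simp [hx]
        | succ n ihn =>
          rw [pow_succ', Perm.mul_apply, restrictLabel_of_mem (show (f _).1 = j by rw [ihn]), hF,
            ihn]
          simp
      have hcyc : (restrictLabel σ lab hl {j}).IsCycle := by
        refine ⟨x, ?_, fun y hy => ?_⟩
        · rw [restrictLabel_of_mem (by simp [hlab, hx])]
          exact hne x
        · have hy' : lab y = j := by
            by_contra h2
            exact hy (restrictLabel_of_notMem (by simpa using h2))
          refine ⟨((f y).2.val : ℤ), hf.1 ?_⟩
          rw [zpow_natCast, hpow]
          subst hy'
          rw [ZMod.natCast_zmod_val]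
      rw [hcyc.cycleType]
      congr 1
      have : (restrictLabel σ lab hl {j}).support = Finset.univ.filter fun v => lab v = j := by
        ext v
        rw [mem_support, Finset.mem_filter]
        by_cases h2 : lab v = j
        · rw [restrictLabel_of_mem (by simp [h2])]
          simp [h2, hne]
        · rw [restrictLabel_of_notMem (by simpa using h2)]
          simp [h2]
      rw [this, ← ZMod.card (s j), ← Finset.card_univ]
      symm
      refine Finset.card_bij (fun z _ => (Equiv.ofBijective f hf).symm ⟨j, z⟩) ?_ ?_ ?_
      · intro z _
        simp only [Finset.mem_filter, Finset.mem_univ, true_and, hlab]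
        have := (Equiv.ofBijective f hf).apply_symm_apply ⟨j, z⟩
        rw [Equiv.ofBijective_apply] at this
        rw [this]
      · intro z _ z' _ hzz
        simpa using hzz
      · intro v hv
        simp only [Finset.mem_filter, Finset.mem_univ, true_and, hlab] at hv
        subst hv
        exact ⟨(f v).2, Finset.mem_univ _, by
          rw [Equiv.symm_apply_eq]; rfl⟩
  have := key Finset.univ
  rw [← this]
  congr 1
  ext v
  rw [restrictLabel_of_mem (by simp)]

end CycleType

/-- Solvability of the directed Oberwolfach problem with cycle lengths `s j`, up to relabelling
points and factors: every ordered pair is covered, and the number of factors leaves no room for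
repetition. -/
def OPSolvable {J : Type} (s : J → ℕ) : Prop :=
  ∃ (V K : Type) (_ : Fintype V) (_ : Fintype K) (_ : Nonempty K) (σ : K → V → V),
    Fintype.card K + 1 = Fintype.card V ∧ (∀ k, HasCycleLengths (σ k) s) ∧
      ∀ x y, x ≠ y → ∃ k, σ k x = y

namespace OPSolvable

variable {J J' : Type} {s : J → ℕ}

theorem reindex (h : OPSolvable s) (e : J ≃ J') {s' : J' → ℕ} (hs : ∀ j, s' (e j) = s j) :
    OPSolvable s' := by
  obtain ⟨V, K, _, _, _, σ, hc, hσ, hcov⟩ := h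
  exact ⟨V, K, _, _, ‹_›, σ, hc, fun k => (hσ k).reindex e hs, hcov⟩

/-- A solution can be carried to any point set and any set of factors of the right sizes. -/
theorem transport [Fintype J] (h : OPSolvable s) (hs : ∀ j, 0 < s j) (V K : Type) [Fintype V]
    [Fintype K] (hV : Fintype.card V = ∑ j, s j) (hK : Fintype.card K + 1 = Fintype.card V) :
    ∃ σ : K → V → V, (∀ k, HasCycleLengths (σ k) s) ∧ ∀ x y, x ≠ y → ∃ k, σ k x = y := by
  obtain ⟨V', K', _, _, ⟨k⟩, σ, hc, hσ, hcov⟩ := h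
  have hV' : Fintype.card V' = Fintype.card V := by rw [hV, (hσ k).card hs]
  let e : V' ≃ V := Fintype.equivOfCardEq hV'
  let g : K ≃ K' := Fintype.equivOfCardEq (by omega)
  refine ⟨fun k v => e (σ (g k) (e.symm v)), fun k => (hσ _).conj e, fun x y hxy => ?_⟩
  obtain ⟨k, hk⟩ := hcov (e.symm x) (e.symm y) (by simpa using hxy)
  exact ⟨g.symm k, by simp [hk]⟩

theorem hasOPSolution [Fintype J] (h : OPSolvable s) (hs : ∀ j, 2 ≤ s j) (m : List ℕ)
    (hm : (m : Multiset ℕ) = Finset.univ.val.map s) (hJ : 0 < m.sum) : HasOPSolution m := by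
  have hsum : m.sum = ∑ j, s j := by
    rw [← Multiset.sum_coe, hm]; rfl
  obtain ⟨σ, hσ, hcov⟩ := h.transport (fun j => (by have := hs j; omega)) (Fin m.sum)
    (Fin (m.sum - 1)) (by simpa using hsum) (by simp; omega)
  refine ⟨fun k => Equiv.ofBijective _ (hσ k).bijective, fun k => ?_, fun x y hxy => ?_⟩
  · rw [hm, HasCycleLengths.cycleType (s := s) (by simpa using hσ k) hs]
  · have hsurj : Function.Surjective
        (fun k => (⟨σ k x, (hσ k).apply_ne hs x⟩ : {z // z ≠ x})) := fun ⟨z, hz⟩ => by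
      obtain ⟨k, hk⟩ := hcov x z hz.symm
      exact ⟨k, Subtype.ext hk⟩
    have hbij := (Fintype.bijective_iff_surjective_and_card _).2 ⟨hsurj, by
      simp [Fintype.card_subtype_compl]⟩
    obtain ⟨k, hk⟩ := hcov x y hxy
    refine ⟨k, hk, fun k' hk' => hbij.1 (Subtype.ext ?_)⟩
    exact Eq.trans hk' hk.symm

end OPSolvable

section Factorization

variable {T C X Q : Type}

/-- Every two distinct points of `Q` are the two ends of an edge of the perfect matching `E c` for
some `c`; the edges of each matching are indexed by `T`. -/
def IsOneFactorization (E : C → T × Bool ≃ Q) : Prop :=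
  ∀ p q, p ≠ q → ∃ c t b, E c (t, b) = p ∧ E c (t, !b) = q

/-- The factor of `T × Bool` blown up by `X` that crosses each edge by the translation by `u`,
and comes back so as to induce `φ t` on one side. -/
def doubledFactor [AddGroup X] (φ : T → X → X) (u : X) : (T × Bool) × X → (T × Bool) × X
  | ((t, false), x) => ((t, true), x + u)
  | ((t, true), y) => ((t, false), φ t (y - u))

theorem hasCycleLengths_doubledFactor [Fintype T] [Fintype X] [AddGroup X] {J : T → Type}
    [∀ t, Fintype (J t)] {φ : T → X → X} {h : ∀ t, J t → ℕ} (hφ : ∀ t, HasCycleLengths (φ t) (h t))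
    (hpos : ∀ t j, 0 < h t j) (u : X) :
    HasCycleLengths (doubledFactor φ u) (fun j : Σ t, J t => 2 * h j.1 j.2) := by
  have hcard := fun t => (hφ t).card (hpos t)
  choose f hf hF using hφ
  have hz : ∀ t j, NeZero (h t j) := fun t j => ⟨(hpos t j).ne'⟩
  have hval : ∀ t j (z : ZMod (h t j)),
      ((2 * (z + 1).val : ℕ) : ZMod (2 * h t j)) =
        ((2 * z.val + 1 : ℕ) : ZMod (2 * h t j)) + 1 := by
    intro t j z
    have h1 : (z + 1).val ≡ z.val + 1 [MOD h t j] := by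
      rw [← ZMod.natCast_eq_natCast_iff]
      simp
    have h2 := (ZMod.natCast_eq_natCast_iff _ _ _).2 (h1.mul_left' 2)
    rw [h2]
    push_cast
    ring
  refine HasCycleLengths.of_phase (fun j => by have := hpos j.1 j.2; positivity) ?_
    (fun v => match v with
      | ((t, false), x) => ⟨t, (f t x).1⟩
      | ((t, true), y) => ⟨t, (f t (y - u)).1⟩)
    (fun v => match v with
      | ((t, false), x) => 2 * (f t x).2.val
      | ((t, true), y) => 2 * (f t (y - u)).2.val + 1) ?_ ?_ ?_
  · rw [Fintype.sum_sigma]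
    simp only [Fintype.card_prod, Fintype.card_bool, ← Finset.mul_sum, ← hcard]
    simp
    ring
  · rintro ⟨⟨t, _ | _⟩, x⟩
    · simp [doubledFactor]
    · simp [doubledFactor, hF]
  · rintro ⟨⟨t, _ | _⟩, x⟩
    · simp only [doubledFactor]
      rw [add_sub_cancel_right]
      push_cast
      rfl
    · simp only [doubledFactor]
      rw [hF]
      exact hval t _ _
  · rintro ⟨t, j⟩
    obtain ⟨x, hx⟩ := (hf t).2 ⟨j, 0⟩
    exact ⟨((t, false), x), by simp [hx]⟩

/-- Solvability from a one-factorization: the edges of the matchings outside `S` are covered by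
doubled factors, so only the pairs inside a fibre or along a matching in `S` remain. -/
theorem OPSolvable.of_oneFactorization [Fintype T] [Fintype C] [Nonempty C] [Fintype X]
    [Fintype Q] [AddGroup X] {J : T → Type} [∀ t, Fintype (J t)] {E : C → T × Bool ≃ Q}
    (hE : IsOneFactorization E) (S : Finset C) {φ : T → X → X} {h : ∀ t, J t → ℕ}
    (hφ : ∀ t, HasCycleLengths (φ t) (h t)) (hpos : ∀ t j, 0 < h t j) {K : Type} [Fintype K]
    [Nonempty K] (σ : K → Q × X → Q × X)
    (hσ : ∀ k, HasCycleLengths (σ k) (fun j : Σ t, J t => 2 * h j.1 j.2))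
    (hcov : ∀ p x q y, (p, x) ≠ (q, y) →
      (p = q ∨ ∃ c ∈ S, ∃ t b, E c (t, b) = p ∧ E c (t, !b) = q) → ∃ k, σ k (p, x) = (q, y))
    (hcard : Fintype.card K + (Fintype.card C - S.card) * Fintype.card X + 1 =
      2 * Fintype.card T * Fintype.card X) :
    OPSolvable (fun j : Σ t, J t => 2 * h j.1 j.2) := by
  classical
  refine ⟨Q × X, K ⊕ {c // c ∉ S} × X, inferInstance, inferInstance, inferInstance,
    Sum.elim σ fun cu v => (E cu.1).prodCongr (Equiv.refl X)
      (doubledFactor φ cu.2 (((E cu.1).prodCongr (Equiv.refl X)).symm v)), ?_, ?_, ?_⟩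
  · have hQ := Fintype.card_congr (E (Classical.arbitrary C))
    have : Fintype.card {c // c ∉ S} = Fintype.card C - S.card := by
      rw [Fintype.card_subtype_compl]; simp
    rw [Fintype.card_sum, Fintype.card_prod, Fintype.card_prod, ← hQ, this, hcard]
    simp
    ring
  · rintro (k | ⟨⟨c, hc⟩, u⟩)
    · exact hσ k
    · exact (hasCycleLengths_doubledFactor hφ hpos u).conj _
  · rintro ⟨p, x⟩ ⟨q, y⟩ hne
    by_cases hsp : p = q ∨ ∃ c ∈ S, ∃ t b, E c (t, b) = p ∧ E c (t, !b) = q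
    · obtain ⟨k, hk⟩ := hcov p x q y hne hsp
      exact ⟨Sum.inl k, hk⟩
    · push Not at hsp
      obtain ⟨hpq, hS⟩ := hsp
      obtain ⟨c, t, b, rfl, rfl⟩ := hE p q hpq
      have hc : c ∉ S := fun hc => hS c hc t b rfl rfl
      cases b with
      | false =>
        refine ⟨Sum.inr ⟨⟨c, hc⟩, -x + y⟩, ?_⟩
        simp [doubledFactor]
      | true =>
        obtain ⟨z, hz⟩ := (hφ t).bijective.2 y
        refine ⟨Sum.inr ⟨⟨c, hc⟩, -z + x⟩, ?_⟩
        simp [doubledFactor, hz]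

/-- The standard one-factorization on `ℤ/(2 * m + 1)` and a point at infinity: in the matching of
index `c` the finite edges are the pairs with sum `c`. -/
def cyclicMatchingFun (m : ℕ) (c : ZMod (2 * m + 1)) :
    Fin (m + 1) × Bool → Option (ZMod (2 * m + 1))
  | (k, b) =>
    if k = 0 then (if b then some (c * (m + 1 : ℕ)) else none)
    else some (c * (m + 1 : ℕ) + if b then ((k : ℕ) : ZMod (2 * m + 1)) else -((k : ℕ) : ZMod _))

theorem half_add_half (m : ℕ) (c : ZMod (2 * m + 1)) :
    c * (m + 1 : ℕ) + c * (m + 1 : ℕ) = c := by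
  have : ((2 * m + 1 : ℕ) : ZMod (2 * m + 1)) = 0 := ZMod.natCast_self _
  push_cast at this ⊢
  linear_combination c * this

theorem exists_natCast_eq_or_neg (m : ℕ) (d : ZMod (2 * m + 1)) :
    ∃ k : ℕ, k ≤ m ∧ (d = k ∨ d = -(k : ZMod (2 * m + 1))) := by
  rcases le_or_gt d.val m with h | h
  · exact ⟨d.val, h, Or.inl (by simp)⟩
  · have := d.val_lt
    refine ⟨2 * m + 1 - d.val, by omega, Or.inr ?_⟩
    rw [Nat.cast_sub this.le]
    simp

theorem cyclicMatchingFun_bijective (m : ℕ) (c : ZMod (2 * m + 1)) :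
    (cyclicMatchingFun m c).Bijective := by
  rw [Fintype.bijective_iff_surjective_and_card]
  refine ⟨?_, by simp [ZMod.card]; ring⟩
  rintro (_ | y)
  · exact ⟨(0, false), rfl⟩
  · obtain ⟨k, hk, h⟩ := exists_natCast_eq_or_neg m (y - c * (m + 1 : ℕ))
    rcases Nat.eq_zero_or_pos k with rfl | hk0
    · refine ⟨(0, true), ?_⟩
      have : y = c * (m + 1 : ℕ) := by simpa [sub_eq_zero] using h
      simp [cyclicMatchingFun, this]
    · have h0 : (⟨k, by omega⟩ : Fin (m + 1)) ≠ 0 := by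
        intro h0
        exact hk0.ne' (by simpa using congrArg Fin.val h0)
      rcases h with h | h
      · exact ⟨(⟨k, by omega⟩, true), by simp [cyclicMatchingFun, h0, ← h]⟩
      · exact ⟨(⟨k, by omega⟩, false), by simp [cyclicMatchingFun, h0, ← h]⟩

noncomputable def cyclicMatching (m : ℕ) (c : ZMod (2 * m + 1)) :
    Fin (m + 1) × Bool ≃ Option (ZMod (2 * m + 1)) :=
  Equiv.ofBijective _ (cyclicMatchingFun_bijective m c)

theorem cyclicMatching_partner {m : ℕ} {c : ZMod (2 * m + 1)} {t : Fin (m + 1)} {b : Bool}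
    {p q : Option (ZMod (2 * m + 1))} (hp : cyclicMatching m c (t, b) = p)
    (hq : cyclicMatching m c (t, !b) = q) :
    (p = none ∧ q = some (c * (m + 1 : ℕ))) ∨ (q = none ∧ p = some (c * (m + 1 : ℕ))) ∨
      ∃ x y, p = some x ∧ q = some y ∧ x + y = c := by
  subst hp hq
  have h := half_add_half m c
  simp only [cyclicMatching, Equiv.ofBijective_apply, cyclicMatchingFun]
  by_cases ht : t = 0
  · cases b <;> simp [ht]
  · refine Or.inr (Or.inr ?_)
    push_cast at h
    cases b
    · exact ⟨_, _, if_neg ht, if_neg ht, by simp; linear_combination h⟩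
    · exact ⟨_, _, if_neg ht, if_neg ht, by simp; linear_combination h⟩

theorem isOneFactorization_cyclicMatching (m : ℕ) : IsOneFactorization (cyclicMatching m) := by
  have key : ∀ p c, ∃ t b, cyclicMatching m c (t, b) = p := fun p c => by
    obtain ⟨⟨t, b⟩, h⟩ := (cyclicMatching m c).surjective p
    exact ⟨t, b, h⟩
  have hm : ∀ y : ZMod (2 * m + 1), (y + y) * (m + 1 : ℕ) = y := fun y => by
    rw [add_mul]; exact half_add_half m y
  rintro (_ | x) (_ | y) hne
  · exact absurd rfl hne
  · obtain ⟨t, b, h⟩ := key none (y + y)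
    refine ⟨y + y, t, b, h, ?_⟩
    rcases cyclicMatching_partner h rfl with ⟨-, h⟩ | ⟨h', -⟩ | ⟨_, _, h, -⟩
    · rw [h, hm]
    · rw [← h] at h'
      simp at h'
    · cases h
  · obtain ⟨t, b, h⟩ := key none (x + x)
    refine ⟨x + x, t, !b, ?_, by simpa using h⟩
    rcases cyclicMatching_partner h rfl with ⟨-, h⟩ | ⟨h', -⟩ | ⟨_, _, h, -⟩
    · rw [h, hm]
    · rw [← h] at h'
      simp at h'
    · cases h
  · obtain ⟨t, b, h⟩ := key (some x) (x + y)
    refine ⟨x + y, t, b, h, ?_⟩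
    rcases cyclicMatching_partner h rfl with ⟨h, -⟩ | ⟨-, h⟩ | ⟨x', y', h, h', h''⟩
    · cases h
    · exfalso
      apply hne
      have h1 : x = (x + y) * (m + 1 : ℕ) := Option.some.inj h
      have h2 := half_add_half m (x + y)
      rw [← h1] at h2
      rw [add_left_cancel h2]
    · cases h
      rw [h', add_left_cancel h'']

theorem exists_hasCycleLengths {J : Type} [Fintype J] [Fintype X] {s : J → ℕ}
    (hs : ∀ j, 0 < s j) (hX : Fintype.card X = ∑ j, s j) : ∃ φ : X → X, HasCycleLengths φ s := by
  have : ∀ j, NeZero (s j) := fun j => ⟨(hs j).ne'⟩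
  have e : X ≃ Σ j, ZMod (s j) := Fintype.equivOfCardEq (by rw [hX, Fintype.card_sigma]; simp)
  exact ⟨fun x => e.symm ⟨(e x).1, (e x).2 + 1⟩, e, e.bijective, fun x => by simp⟩

/-- Solutions on blocks of equal even size combine to a solution on their union. -/
theorem OPSolvable.sigma {m L : ℕ} (hL : 0 < L) {J : Fin (m + 1) → Type} [∀ t, Fintype (J t)]
    {h : ∀ t, J t → ℕ} (hpos : ∀ t j, 0 < h t j) (hsum : ∀ t, ∑ j, h t j = L)
    (hop : ∀ t, OPSolvable (fun j => 2 * h t j)) :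
    OPSolvable (fun j : Σ t, J t => 2 * h j.1 j.2) := by
  classical
  have : NeZero L := ⟨hL.ne'⟩
  choose φ hφ using fun t => exists_hasCycleLengths (X := ZMod L) (hpos t)
    (by rw [hsum, ZMod.card])
  have hK : Nonempty (Fin (2 * L - 1)) := ⟨⟨0, by omega⟩⟩
  choose σ hσ hcov using fun t => (hop t).transport (fun j => by have := hpos t j; omega)
    (Bool × ZMod L) (Fin (2 * L - 1)) (by simp [ZMod.card, ← Finset.mul_sum, hsum])
    (by simp [ZMod.card]; omega)
  let e : Fin (m + 1) × (Bool × ZMod L) ≃ Option (ZMod (2 * m + 1)) × ZMod L :=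
    (Equiv.prodAssoc _ _ _).symm.trans ((cyclicMatching m 0).prodCongr (Equiv.refl _))
  refine OPSolvable.of_oneFactorization (isOneFactorization_cyclicMatching m) {0} hφ hpos
    (fun k v => e ((e.symm v).1, σ (e.symm v).1 k (e.symm v).2)) (fun k => ?_) ?_ ?_
  · exact (HasCycleLengths.prod_sigma (fun t => hσ t k)).conj e
  · intro p x q y hne hpq
    have key : ∃ t b b', cyclicMatching m 0 (t, b) = p ∧ cyclicMatching m 0 (t, b') = q := by
      rcases hpq with rfl | ⟨c, hc, t, b, h1, h2⟩
      · obtain ⟨⟨t, b⟩, h⟩ := (cyclicMatching m 0).surjective p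
        exact ⟨t, b, b, h, h⟩
      · rw [Finset.mem_singleton] at hc
        subst hc
        exact ⟨t, b, _, h1, h2⟩
    obtain ⟨t, b, b', rfl, rfl⟩ := key
    obtain ⟨k, hk⟩ := hcov t (b, x) (b', y) (by
      rintro h
      apply hne
      rw [(Prod.mk.inj h).1, (Prod.mk.inj h).2])
    refine ⟨k, ?_⟩
    simp [e, hk]
  · simp only [Fintype.card_fin, ZMod.card, Finset.card_singleton]
    have h1 : 2 * L - 1 + 1 = 2 * L := by omega
    have h2 : 2 * m + 1 - 1 = 2 * m := by omega
    rw [h2]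
    nlinarith

end Factorization

/-! Tables describing maps on a cyclic strip of `b + p * j` columns: `b` initial columns followed by
`j` blocks of `p` columns, the entries of the table being the same in each block. -/

/-- The image of a point in a strip (column shift and new letter), together with the coefficients
of its index as an affine function of the block number and the number of blocks, and a phase. -/
structure StripEntry (L : ℕ) where
  shift : ℤ
  letter : Fin L
  const : ℤ
  blockCoeff : ℤ
  lengthCoeff : ℤ
  phase : ℕ

namespace Strip

/-- The type of a column: its own number for an initial column, its place in the block otherwise. -/
def colType (b p x : ℕ) : ℕ := if x < b then x else b + (x - b) % p

def colBlock (b p x : ℕ) : ℕ := if x < b then 0 else (x - b) / p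

/-- `x` is the column of type `t` in block `i`. -/
def IsAt (b p j : ℕ) (x : ZMod (b + p * j)) (t i : ℤ) : Prop :=
  (0 ≤ t ∧ t < b ∧ i = 0 ∧ x = t) ∨
    ((b : ℤ) ≤ t ∧ t < b + p ∧ 0 ≤ i ∧ i < j ∧ x = (t + p * i : ℤ))

variable {b p j : ℕ}

theorem isAt_colType [NeZero (b + p * j)] (hp : 0 < p) (x : ZMod (b + p * j)) :
    IsAt b p j x (colType b p x.val) (colBlock b p x.val) := by
  have hx := x.val_lt
  unfold IsAt colType colBlock
  split_ifs with h
  · exact Or.inl ⟨by positivity, by exact_mod_cast h, rfl, by simp⟩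
  · refine Or.inr ⟨by exact_mod_cast Nat.le_add_right _ _, ?_, by positivity, ?_, ?_⟩
    · have := Nat.mod_lt (x.val - b) hp
      push_cast
      omega
    · have : (x.val - b) / p < j := Nat.div_lt_of_lt_mul (by omega)
      exact_mod_cast this
    · have h1 := Nat.mod_add_div (x.val - b) p
      have h2 : x.val = b + (x.val - b) % p + p * ((x.val - b) / p) := by omega
      conv_lhs => rw [← ZMod.natCast_zmod_val x, h2]
      norm_cast

theorem IsAt.eq [NeZero (b + p * j)] (hp : 0 < p) {x : ZMod (b + p * j)} {t i : ℤ}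
    (h : IsAt b p j x t i) : t = colType b p x.val ∧ i = colBlock b p x.val := by
  rcases h with ⟨h0, h1, rfl, rfl⟩ | ⟨h0, h1, h2, h3, rfl⟩
  · lift t to ℕ using h0
    have h4 : t < b := by exact_mod_cast h1
    have h5 : ((t : ℤ) : ZMod (b + p * j)).val = t := by
      rw [Int.cast_natCast, ZMod.val_natCast_of_lt]
      have := Nat.zero_le (p * j)
      omega
    rw [h5]
    simp [colType, colBlock, h4]
  · lift t to ℕ using by omega
    lift i to ℕ using h2
    have h4 : b ≤ t := by exact_mod_cast h0
    have h5 : t < b + p := by exact_mod_cast h1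
    have h6 : i + 1 ≤ j := by exact_mod_cast h3
    obtain ⟨c, rfl⟩ := Nat.exists_eq_add_of_le h4
    have h7 : (((b + c : ℕ) + p * i : ℤ) : ZMod (b + p * j)).val = b + (c + p * i) := by
      have : (((b + c : ℕ) + p * i : ℤ) : ZMod (b + p * j)) = ((b + (c + p * i) : ℕ) : ZMod _) := by
        push_cast
        ring
      rw [this, ZMod.val_natCast_of_lt]
      have := Nat.mul_le_mul_left p h6
      rw [Nat.mul_succ] at this
      omega
    have h8 : c < p := by omega
    rw [h7]
    simp [colType, colBlock, Nat.add_mul_mod_self_left, Nat.mod_eq_of_lt h8,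
      Nat.add_mul_div_left _ _ hp, Nat.div_eq_of_lt h8]

/-- `(u, v, w)` stands for the affine function `u + v * i + w * j`. -/
def affine (c : ℤ × ℤ × ℤ) (i j : ℤ) : ℤ := c.1 + c.2.1 * i + c.2.2 * j

/-- The possible types of the column `d` steps after a column of type `t`, each with the block
numbers of the two columns. -/
def moves (b p t d : ℤ) : List (ℤ × (ℤ × ℤ × ℤ) × (ℤ × ℤ × ℤ)) :=
  if t < b then
    if t + d < 0 then [(b + p + t + d, (0, 0, 0), (-1, 0, 1))] else [(t + d, (0, 0, 0), (0, 0, 0))]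
  else if t + d < b then [(t + d + p, (0, 1, 0), (-1, 1, 0)), (t + d, (0, 0, 0), (0, 0, 0))]
  else if t + d < b + p then [(t + d, (0, 1, 0), (0, 1, 0))]
  else [(t + d - p, (0, 1, 0), (1, 1, 0)), (t + d - p - b, (-1, 0, 1), (0, 0, 0))]

theorem IsAt.exists_move {x : ZMod (b + p * j)} {t i : ℤ} (h : IsAt b p j x t i) (hj : 1 ≤ j)
    (hpb : p ≤ b) {d : ℤ} (hd : -p ≤ d) (hd' : d ≤ p) :
    ∃ m ∈ moves b p t d, ∃ k : ℤ, i = affine m.2.1 k j ∧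
      IsAt b p j (x + d) m.1 (affine m.2.2 k j) := by
  have hN : ((b : ZMod (b + p * j)) + p * j : ZMod (b + p * j)) = 0 := by
    exact_mod_cast ZMod.natCast_self (b + p * j)
  zify at hj hpb
  unfold moves IsAt affine
  rcases h with ⟨h0, h1, rfl, rfl⟩ | ⟨h0, h1, h2, h3, rfl⟩
  · rw [if_pos h1]
    split_ifs with h4
    · refine ⟨_, List.mem_singleton_self _, 0, by simp, Or.inr ⟨?_, ?_, ?_, ?_, ?_⟩⟩ <;>
        simp only <;> try omega
      push_cast
      linear_combination -hN
    · refine ⟨_, List.mem_singleton_self _, 0, by simp, ?_⟩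
      rcases lt_or_ge (t + d) b with h5 | h5
      · exact Or.inl ⟨by simpa using h4, h5, by simp, by push_cast; ring⟩
      · exact Or.inr ⟨h5, by simp only; omega, by simp, by simp only; omega, by push_cast; ring⟩
  · rw [if_neg (by omega)]
    split_ifs with h4 h5
    · rcases eq_or_lt_of_le h2 with rfl | h6
      · exact ⟨(t + d, (0, 0, 0), (0, 0, 0)), by simp, 0, by simp,
          Or.inl ⟨by simp only; omega, h4, by simp, by push_cast; ring⟩⟩
      · refine ⟨(t + d + p, (0, 1, 0), (-1, 1, 0)), by simp, i, by simp,
          Or.inr ⟨?_, ?_, ?_, ?_, ?_⟩⟩ <;> simp only <;> try omega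
        push_cast
        ring
    · exact ⟨_, List.mem_singleton_self _, i, by simp,
        Or.inr ⟨by simp only; omega, h5, by simp only; omega, by simp only; omega,
          by push_cast; ring⟩⟩
    · rcases eq_or_lt_of_le (show i ≤ j - 1 by omega) with rfl | h6
      · refine ⟨(t + d - p - b, (-1, 0, 1), (0, 0, 0)), by simp, 0, by simp only; ring,
          Or.inl ⟨by simp only; omega, by simp only; omega, by simp, ?_⟩⟩
        push_cast
        linear_combination hN
      · refine ⟨(t + d - p, (0, 1, 0), (1, 1, 0)), by simp, i, by simp,
          Or.inr ⟨?_, ?_, ?_, ?_, ?_⟩⟩ <;> simp only <;> try omega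
        push_cast
        ring

variable {L : ℕ}

/-- The map of the strip described by a table. -/
def map (b p j : ℕ) (tab : ℕ → Fin L → StripEntry L) (v : ZMod (b + p * j) × Fin L) :
    ZMod (b + p * j) × Fin L :=
  let a := tab (colType b p v.1.val) v.2
  (v.1 + a.shift, a.letter)

/-- The index of a point of the strip according to a table. -/
def index (b p j : ℕ) (tab : ℕ → Fin L → StripEntry L) (v : ZMod (b + p * j) × Fin L) : ℤ :=
  let a := tab (colType b p v.1.val) v.2
  affine (a.const, a.blockCoeff, a.lengthCoeff) (colBlock b p v.1.val) j

def phase (b p j : ℕ) (tab : ℕ → Fin L → StripEntry L) (v : ZMod (b + p * j) × Fin L) : ℕ :=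
  (tab (colType b p v.1.val) v.2).phase

/-- The local condition for a table to raise indices by `δ` modulo `M.1 + M.2 * j` and phases by
one modulo `s`. -/
def Consistent (b p : ℕ) (M : ℤ × ℤ) (δ : ℤ) (s : ℕ) (tab : ℕ → Fin L → StripEntry L) : Prop :=
  ∀ t < b + p, ∀ e, -(p : ℤ) ≤ (tab t e).shift ∧ (tab t e).shift ≤ p ∧
    ∀ m ∈ moves b p t (tab t e).shift,
      (∃ k ∈ ([-2, -1, 0, 1, 2] : List ℤ),
        (tab m.1.toNat (tab t e).letter).const +
            (tab m.1.toNat (tab t e).letter).blockCoeff * m.2.2.1 -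
          ((tab t e).const + (tab t e).blockCoeff * m.2.1.1) - δ = k * M.1 ∧
        (tab m.1.toNat (tab t e).letter).blockCoeff * m.2.2.2.1 =
          (tab t e).blockCoeff * m.2.1.2.1 ∧
        (tab m.1.toNat (tab t e).letter).lengthCoeff +
            (tab m.1.toNat (tab t e).letter).blockCoeff * m.2.2.2.2 -
          ((tab t e).lengthCoeff + (tab t e).blockCoeff * m.2.1.2.2) = k * M.2) ∧
      (tab m.1.toNat (tab t e).letter).phase % s = ((tab t e).phase + 1) % s

instance (b p : ℕ) (M : ℤ × ℤ) (δ : ℤ) (s : ℕ) (tab : ℕ → Fin L → StripEntry L) :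
    Decidable (Consistent b p M δ s tab) := by
  unfold Consistent
  infer_instance

theorem Consistent.map_spec {M : ℤ × ℤ} {δ : ℤ} {s : ℕ} {tab : ℕ → Fin L → StripEntry L}
    (h : Consistent b p M δ s tab) (hp : 0 < p) (hpb : p ≤ b) (hj : 1 ≤ j) {n : ℕ}
    (hn : (n : ℤ) = M.1 + M.2 * j) (v : ZMod (b + p * j) × Fin L) :
    (index b p j tab (map b p j tab v) : ZMod n) = index b p j tab v + δ ∧
      (phase b p j tab (map b p j tab v) : ZMod s) = phase b p j tab v + 1 := by
  have : NeZero (b + p * j) := ⟨by positivity⟩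
  obtain ⟨x, e⟩ := v
  have hat := isAt_colType (j := j) hp x
  have ht : colType b p x.val < b + p := by
    unfold colType
    split_ifs
    · omega
    · have := Nat.mod_lt (x.val - b) hp
      omega
  obtain ⟨h1, h2, h3⟩ := h _ ht e
  obtain ⟨m, hm, k, hk, hat'⟩ := hat.exists_move hj hpb h1 h2
  obtain ⟨⟨q, -, hq1, hq2, hq3⟩, hph⟩ := h3 m hm
  obtain ⟨h4, h5⟩ := hat'.eq hp
  have h6 : colType b p (x + ((tab (colType b p x.val) e).shift : ZMod (b + p * j))).val =
      m.1.toNat := by rw [h4]; simp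
  unfold index phase map
  simp only
  rw [h6, ← h5, hk]
  constructor
  · have hn0 : ((M.1 + M.2 * j : ℤ) : ZMod n) = 0 := by
      rw [← hn]; simp
    rw [← sub_eq_zero]
    have : ∀ z w : ℤ, z - w - δ = q * (M.1 + M.2 * j) → (z : ZMod n) - (w + δ) = 0 := by
      intro z w hzw
      have := congrArg (Int.cast : ℤ → ZMod n) hzw
      push_cast at this hn0
      rw [hn0] at this
      linear_combination this
    apply this
    simp only [affine]
    linear_combination hq1 + k * hq2 + j * hq3
  · exact_mod_cast (ZMod.natCast_eq_natCast_iff _ _ _).2 hph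

theorem Consistent.hasCycleLengths {tab : ℕ → Fin 2 → StripEntry 2}
    (h : Consistent b p (2 * b, 2 * p) 1 1 tab) (hp : 0 < p) (hpb : p ≤ b) (hj : 1 ≤ j) :
    HasCycleLengths (map b p j tab) (fun _ : Unit => 2 * (b + p * j)) := by
  have : NeZero (b + p * j) := ⟨by positivity⟩
  refine HasCycleLengths.of_single (by positivity) (by simp [ZMod.card]; ring)
    (fun v => (index b p j tab v : ZMod _)) fun v => ?_
  have := (h.map_spec hp hpb hj (n := 2 * (b + p * j)) (by push_cast; ring) v).1
  simpa using this

/-- Read a table from nested lists. -/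
def ofList (l : List (List (StripEntry (L + 1)))) (t : ℕ) (e : Fin (L + 1)) : StripEntry (L + 1) :=
  (l.getD t []).getD e ⟨0, 0, 0, 0, 0, 0⟩

theorem colType_lt (hp : 0 < p) (x : ℕ) : colType b p x < b + p := by
  unfold colType
  split_ifs
  · omega
  · have := Nat.mod_lt (x - b) hp
    omega

/-- A family of tables leads from any point of a column of type `t` to all other points of the
columns at the distances in `D t`. -/
def Covers {K : Type} (b p : ℕ) (D : ℕ → List ℤ) (tab : K → ℕ → Fin L → StripEntry L) : Prop :=
  ∀ t < b + p, ∀ d ∈ D t, ∀ e f, (d = 0 → e ≠ f) →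
    ∃ k, (tab k t e).shift = d ∧ (tab k t e).letter = f

instance {K : Type} [Fintype K] (b p : ℕ) (D : ℕ → List ℤ) (tab : K → ℕ → Fin L → StripEntry L) :
    Decidable (Covers b p D tab) := by
  unfold Covers
  infer_instance

theorem Covers.exists_map {K : Type} {D : ℕ → List ℤ} {tab : K → ℕ → Fin L → StripEntry L}
    (h : Covers b p D tab) (hp : 0 < p) {x : ZMod (b + p * j)} {d : ℤ}
    (hd : d ∈ D (colType b p x.val)) {e f : Fin L} (hef : d = 0 → e ≠ f) :
    ∃ k, map b p j (tab k) (x, e) = (x + d, f) := by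
  obtain ⟨k, h1, h2⟩ := h _ (colType_lt hp _) d hd e f hef
  exact ⟨k, by simp only [map, h1, h2]⟩

theorem exists_map_or {K : Type} {tab : K → ℕ → Fin L → StripEntry L}
    (h : ∀ t < b + p, ∀ e f, ∀ m ∈ moves b p t 1, ∃ k,
      ((tab k t e).shift = 1 ∧ (tab k t e).letter = f) ∨
        ((tab k m.1.toNat f).shift = -1 ∧ (tab k m.1.toNat f).letter = e))
    (hp : 0 < p) (hpb : p ≤ b) (hj : 1 ≤ j) (x : ZMod (b + p * j)) (e f : Fin L) :
    ∃ k, map b p j (tab k) (x, e) = (x + 1, f) ∨ map b p j (tab k) (x + 1, f) = (x, e) := by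
  have : NeZero (b + p * j) := ⟨by positivity⟩
  obtain ⟨m, hm, i, -, hat⟩ := (isAt_colType (j := j) hp x).exists_move hj hpb (d := 1)
    (by omega) (by exact_mod_cast hp)
  have h6 : colType b p (x + 1).val = m.1.toNat := by
    have := (hat.eq hp).1
    simp only [Int.cast_one] at this
    rw [this, Int.toNat_natCast]
  obtain ⟨k, ⟨h1, h2⟩ | ⟨h1, h2⟩⟩ := h _ (colType_lt hp _) e f m hm
  · exact ⟨k, Or.inl (by simp only [map, h1, h2, Int.cast_one])⟩
  · exact ⟨k, Or.inr (by simp only [map, h6, h1, h2]; simp)⟩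

/-- Five hamiltonian cycles on a cyclic strip of odd length, using all arcs within columns and
between neighbouring columns. -/
def fiveOdd (k : Fin 5) : ℕ → Fin 2 → StripEntry 2 := ofList <| List.get
  [[[⟨-1, 0, 0, 0, 0, 0⟩, ⟨0, 0, 9, 0, 4, 0⟩], [⟨-1, 1, 8, 0, 4, 0⟩, ⟨0, 0, 7, 0, 4, 0⟩],
     [⟨-1, 1, 6, 0, 4, 0⟩, ⟨1, 0, 4, 0, 4, 0⟩], [⟨-1, 0, 5, 0, 4, 0⟩, ⟨-1, 1, 3, 0, 4, 0⟩],
     [⟨0, 1, 1, 0, 4, 0⟩, ⟨-1, 1, 2, 0, 4, 0⟩],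
     [⟨-1, 0, 0, -4, 4, 0⟩, ⟨1, 1, -2, -4, 4, 0⟩],
     [⟨-1, 1, -3, -4, 4, 0⟩, ⟨-1, 0, -1, -4, 4, 0⟩]],
    [[⟨-1, 1, 0, 0, 0, 0⟩, ⟨-1, 0, 2, 0, 0, 0⟩], [⟨1, 1, 7, 0, 4, 0⟩, ⟨-1, 0, 9, 0, 4, 0⟩],
     [⟨-1, 0, 6, 0, 4, 0⟩, ⟨-1, 1, 8, 0, 4, 0⟩], [⟨0, 1, 4, 0, 4, 0⟩, ⟨-1, 0, 5, 0, 4, 0⟩],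
     [⟨-1, 0, 3, 0, 4, 0⟩, ⟨1, 1, 1, 0, 4, 0⟩],
     [⟨-1, 1, 0, -4, 4, 0⟩, ⟨-1, 0, 2, -4, 4, 0⟩],
     [⟨-1, 0, -1, -4, 4, 0⟩, ⟨1, 1, -3, -4, 4, 0⟩]],
    [[⟨0, 1, 0, 0, 0, 0⟩, ⟨1, 1, 1, 0, 0, 0⟩], [⟨1, 0, 4, 0, 0, 0⟩, ⟨1, 1, 2, 0, 0, 0⟩],
     [⟨1, 0, 5, 0, 0, 0⟩, ⟨-1, 0, 3, 0, 0, 0⟩], [⟨1, 0, 6, 0, 0, 0⟩, ⟨1, 1, 8, 0, 0, 0⟩],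
     [⟨-1, 1, 7, 0, 0, 0⟩, ⟨1, 0, 9, 0, 0, 0⟩], [⟨0, 1, 10, 4, 0, 0⟩, ⟨1, 0, 11, 4, 0, 0⟩],
     [⟨0, 1, 12, 4, 0, 0⟩, ⟨1, 0, 13, 4, 0, 0⟩]],
    [[⟨1, 0, 0, 0, 0, 0⟩, ⟨-1, 1, 3, 0, 0, 0⟩], [⟨0, 1, 1, 0, 0, 0⟩, ⟨-1, 1, 2, 0, 0, 0⟩],
     [⟨1, 1, 7, 0, 2, 0⟩, ⟨0, 0, 6, 0, 2, 0⟩], [⟨-1, 1, 5, 0, 2, 0⟩, ⟨1, 0, 8, 0, 2, 0⟩],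
     [⟨1, 0, 9, 0, 2, 0⟩, ⟨-1, 0, 4, 0, 2, 0⟩],
     [⟨1, 0, 10, 2, 2, 0⟩, ⟨-1, 1, 3, -2, 2, 0⟩],
     [⟨1, 0, 11, 2, 2, 0⟩, ⟨-1, 1, 2, -2, 2, 0⟩]],
    [[⟨1, 1, 0, 0, 0, 0⟩, ⟨1, 0, 8, 0, 4, 0⟩], [⟨-1, 0, 9, 0, 4, 0⟩, ⟨1, 0, 1, 0, 0, 0⟩],
     [⟨0, 1, 2, 0, 0, 0⟩, ⟨1, 1, 3, 0, 0, 0⟩], [⟨1, 1, 5, 0, 0, 0⟩, ⟨0, 0, 4, 0, 0, 0⟩],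
     [⟨1, 1, 7, 0, 0, 0⟩, ⟨0, 0, 6, 0, 0, 0⟩], [⟨1, 1, 9, 4, 0, 0⟩, ⟨0, 0, 8, 4, 0, 0⟩],
     [⟨1, 1, 11, 4, 0, 0⟩, ⟨0, 0, 10, 4, 0, 0⟩]]] k

/-- The analogue of `Strip.fiveOdd` for even length. -/
def fiveEven (k : Fin 5) : ℕ → Fin 2 → StripEntry 2 := ofList <| List.get
  [[[⟨-1, 0, 0, 0, 0, 0⟩, ⟨-1, 1, 6, 0, 2, 0⟩],
     [⟨-1, 0, 11, 0, 4, 0⟩, ⟨-1, 1, 5, 0, 2, 0⟩],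
     [⟨-1, 1, 4, 0, 2, 0⟩, ⟨-1, 0, 10, 0, 4, 0⟩],
     [⟨-1, 0, 3, 0, 2, 0⟩, ⟨-1, 1, 9, 0, 4, 0⟩],
     [⟨-1, 0, 2, 0, 2, 0⟩, ⟨-1, 1, 8, 0, 4, 0⟩],
     [⟨-1, 0, 1, 0, 2, 0⟩, ⟨-1, 1, 7, 0, 4, 0⟩],
     [⟨-1, 0, 0, -2, 2, 0⟩, ⟨-1, 1, 6, -2, 4, 0⟩],
     [⟨-1, 0, -1, -2, 2, 0⟩, ⟨-1, 1, 5, -2, 4, 0⟩]],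
    [[⟨-1, 1, 0, 0, 0, 0⟩, ⟨1, 1, 10, 0, 4, 0⟩],
     [⟨-1, 1, 9, 0, 4, 0⟩, ⟨-1, 0, 11, 0, 4, 0⟩],
     [⟨-1, 0, 8, 0, 4, 0⟩, ⟨1, 1, 6, 0, 4, 0⟩], [⟨-1, 1, 5, 0, 4, 0⟩, ⟨-1, 0, 7, 0, 4, 0⟩],
     [⟨1, 0, 2, 0, 4, 0⟩, ⟨-1, 0, 4, 0, 4, 0⟩], [⟨-1, 1, 3, 0, 4, 0⟩, ⟨-1, 0, 1, 0, 4, 0⟩],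
     [⟨-1, 1, 0, -4, 4, 0⟩, ⟨0, 0, -1, -4, 4, 0⟩],
     [⟨-1, 1, -2, -4, 4, 0⟩, ⟨0, 0, -3, -4, 4, 0⟩]],
    [[⟨0, 1, 0, 0, 0, 0⟩, ⟨1, 0, 1, 0, 0, 0⟩], [⟨0, 1, 2, 0, 0, 0⟩, ⟨1, 1, 3, 0, 0, 0⟩],
     [⟨1, 0, 5, 0, 0, 0⟩, ⟨0, 0, 4, 0, 0, 0⟩], [⟨0, 1, 6, 0, 0, 0⟩, ⟨1, 0, 7, 0, 0, 0⟩],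
     [⟨0, 1, 8, 0, 0, 0⟩, ⟨1, 0, 9, 0, 0, 0⟩], [⟨0, 1, 10, 0, 0, 0⟩, ⟨1, 0, 11, 0, 0, 0⟩],
     [⟨0, 1, 12, 4, 0, 0⟩, ⟨1, 0, 13, 4, 0, 0⟩],
     [⟨0, 1, 14, 4, 0, 0⟩, ⟨1, 0, 15, 4, 0, 0⟩]],
    [[⟨1, 0, 0, 0, 0, 0⟩, ⟨-1, 0, 10, 0, 4, 0⟩], [⟨1, 1, 1, 0, 0, 0⟩, ⟨1, 0, 3, 0, 0, 0⟩],
     [⟨1, 1, 4, 0, 0, 0⟩, ⟨-1, 1, 2, 0, 0, 0⟩], [⟨1, 1, 6, 0, 0, 0⟩, ⟨0, 0, 5, 0, 0, 0⟩],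
     [⟨1, 1, 8, 0, 0, 0⟩, ⟨0, 0, 7, 0, 0, 0⟩], [⟨1, 0, 11, 0, 0, 0⟩, ⟨1, 1, 9, 0, 0, 0⟩],
     [⟨1, 1, 12, 4, 0, 0⟩, ⟨-1, 0, 10, 4, 0, 0⟩],
     [⟨1, 0, 15, 4, 0, 0⟩, ⟨1, 1, 13, 4, 0, 0⟩]],
    [[⟨1, 1, 0, 0, 0, 0⟩, ⟨0, 0, 11, 0, 4, 0⟩], [⟨1, 0, 2, 0, 0, 0⟩, ⟨0, 0, 1, 0, 0, 0⟩],
     [⟨0, 1, 3, 0, 0, 0⟩, ⟨1, 0, 4, 0, 0, 0⟩], [⟨1, 0, 5, 0, 0, 0⟩, ⟨1, 1, 7, 0, 0, 0⟩],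
     [⟨-1, 1, 6, 0, 0, 0⟩, ⟨1, 1, 8, 0, 0, 0⟩], [⟨1, 1, 10, 0, 0, 0⟩, ⟨0, 0, 9, 0, 0, 0⟩],
     [⟨1, 0, 13, 4, 0, 0⟩, ⟨1, 1, 11, 4, 0, 0⟩],
     [⟨1, 1, 14, 4, 0, 0⟩, ⟨-1, 0, 12, 4, 0, 0⟩]]] k

/-- Two hamiltonian cycles on a cyclic strip of odd length, using every edge between neighbouring
columns in one direction. -/
def twoOdd (k : Fin 2) : ℕ → Fin 2 → StripEntry 2 := ofList <| List.get
  [[[⟨1, 1, 0, 0, 0, 0⟩, ⟨-1, 1, 3, 0, 2, 0⟩], [⟨-1, 0, 5, 0, 4, 0⟩, ⟨1, 0, 1, 0, 0, 0⟩],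
     [⟨1, 1, 2, 0, 0, 0⟩, ⟨-1, 0, 4, 0, 4, 0⟩], [⟨-1, 1, 3, -2, 4, 0⟩, ⟨1, 0, 3, 2, 0, 0⟩],
     [⟨1, 1, 4, 2, 0, 0⟩, ⟨-1, 0, 2, -2, 4, 0⟩]],
    [[⟨-1, 1, 0, 0, 0, 0⟩, ⟨1, 0, 3, 0, 2, 0⟩], [⟨1, 0, 4, 0, 2, 0⟩, ⟨-1, 1, 2, 0, 2, 0⟩],
     [⟨1, 0, 5, 0, 2, 0⟩, ⟨-1, 1, 1, 0, 2, 0⟩], [⟨1, 0, 6, 2, 2, 0⟩, ⟨-1, 1, 0, -2, 2, 0⟩],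
     [⟨1, 0, 7, 2, 2, 0⟩, ⟨-1, 1, -1, -2, 2, 0⟩]]] k

theorem consistent_fiveOdd : ∀ k, Consistent 5 2 (10, 4) 1 1 (fiveOdd k) := by
  decide +kernel

theorem covers_fiveOdd : Covers 5 2 (fun _ => [-1, 0, 1]) fiveOdd := by
  decide +kernel

theorem consistent_fiveEven : ∀ k, Consistent 6 2 (12, 4) 1 1 (fiveEven k) := by
  decide +kernel

theorem covers_fiveEven : Covers 6 2 (fun _ => [-1, 0, 1]) fiveEven := by
  decide +kernel

theorem consistent_twoOdd : ∀ k, Consistent 3 2 (6, 4) 1 1 (twoOdd k) := by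
  decide +kernel

theorem exists_five {m : ℕ} (hm : 7 ≤ m) :
    ∃ σ : Fin 5 → ZMod m × Fin 2 → ZMod m × Fin 2,
      (∀ k, HasCycleLengths (σ k) fun _ : Unit => 2 * m) ∧
      ∀ v w, v ≠ w → (w.1 = v.1 ∨ w.1 = v.1 + 1 ∨ v.1 = w.1 + 1) → ∃ k, σ k v = w := by
  have key : ∀ {b p j : ℕ} {tab : Fin 5 → ℕ → Fin 2 → StripEntry 2}, 0 < p →
      Covers b p (fun _ => [-1, 0, 1]) tab → ∀ v w : ZMod (b + p * j) × Fin 2, v ≠ w →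
        (w.1 = v.1 ∨ w.1 = v.1 + 1 ∨ v.1 = w.1 + 1) → ∃ k, map b p j (tab k) v = w := by
    rintro b p j tab hp h ⟨x, e⟩ ⟨y, f⟩ hne (rfl | rfl | rfl)
    · simpa using h.exists_map hp (d := 0) (x := y) (by simp) (e := e) (f := f)
        (fun _ hef => hne (by rw [hef]))
    · simpa using h.exists_map hp (d := 1) (x := x) (by simp) (e := e) (f := f) (by simp)
    · obtain ⟨k, hk⟩ := h.exists_map hp (d := -1) (x := y + 1) (by simp) (e := e) (f := f)
        (by simp)
      exact ⟨k, by rw [hk, Int.cast_neg, Int.cast_one, add_neg_cancel_right]⟩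
  obtain ⟨n, rfl | rfl⟩ := m.even_or_odd'
  · obtain ⟨j, rfl⟩ := Nat.exists_eq_add_of_le (show 4 ≤ n by omega)
    rw [show 2 * (4 + j) = 6 + 2 * (j + 1) by ring]
    exact ⟨fun k => map 6 2 (j + 1) (fiveEven k), fun k =>
      (consistent_fiveEven k).hasCycleLengths (by simp) (by simp) (by simp),
      key (by simp) covers_fiveEven⟩
  · obtain ⟨j, rfl⟩ := Nat.exists_eq_add_of_le (show 3 ≤ n by omega)
    rw [show 2 * (3 + j) + 1 = 5 + 2 * (j + 1) by ring]
    exact ⟨fun k => map 5 2 (j + 1) (fiveOdd k), fun k =>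
      (consistent_fiveOdd k).hasCycleLengths (by simp) (by simp) (by simp),
      key (by simp) covers_fiveOdd⟩

theorem exists_two {m : ℕ} (hm : 5 ≤ m) (hodd : Odd m) :
    ∃ σ : Fin 2 → ZMod m × Fin 2 → ZMod m × Fin 2,
      (∀ k, HasCycleLengths (σ k) fun _ : Unit => 2 * m) ∧
      ∀ x e f, ∃ k, σ k (x, e) = (x + 1, f) ∨ σ k (x + 1, f) = (x, e) := by
  obtain ⟨n, rfl⟩ := hodd
  obtain ⟨j, rfl⟩ := Nat.exists_eq_add_of_le (show 2 ≤ n by omega)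
  rw [show 2 * (2 + j) + 1 = 3 + 2 * (j + 1) by ring]
  exact ⟨fun k => map 3 2 (j + 1) (twoOdd k), fun k =>
    (consistent_twoOdd k).hasCycleLengths (by simp) (by simp) (by simp),
    exists_map_or (by decide +kernel) (by simp) (by simp) (by simp)⟩

end Strip

section Hamiltonian

variable {V : Type} {F : V → V} {n : ℕ}

theorem HasCycleLengths.exists_inverse (h : HasCycleLengths F fun _ : Unit => n) :
    ∃ G : V → V, HasCycleLengths G (fun _ : Unit => n) ∧ ∀ v, G (F v) = v :=
  ⟨(Equiv.ofBijective F h.bijective).symm,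
    h.inverse fun v => Equiv.ofBijective_symm_apply_apply F _ v,
    fun v => Equiv.ofBijective_symm_apply_apply F _ v⟩

/-- A spanning cycle carries any family of maps of a cyclic strip over to the doubled point set. -/
theorem HasCycleLengths.exists_strip {m : ℕ} {K : Type} (h : HasCycleLengths F fun _ : Unit => n)
    {σ : K → ZMod n × Fin 2 → ZMod n × Fin 2} (hσ : ∀ k, HasCycleLengths (σ k) fun _ : Unit => m) :
    ∃ (e : V ≃ ZMod n) (G : K → V × Fin 2 → V × Fin 2), (∀ v, e (F v) = e v + 1) ∧
      (∀ k, HasCycleLengths (G k) fun _ : Unit => m) ∧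
      ∀ k x a y b, G k (x, a) = (y, b) ↔ σ k (e x, a) = (e y, b) := by
  obtain ⟨ph, hb, hph⟩ := h.exists_phase
  let e : V ≃ ZMod n := Equiv.ofBijective ph hb
  refine ⟨e, _, hph, fun k => (hσ k).conj (e.prodCongr (Equiv.refl _)).symm, fun k x a y b => ?_⟩
  rw [Equiv.symm_apply_eq]
  rfl

theorem HasCycleLengths.exists_five (h : HasCycleLengths F fun _ : Unit => n) (hn : 7 ≤ n) :
    ∃ G : Fin 5 → V × Fin 2 → V × Fin 2, (∀ k, HasCycleLengths (G k) fun _ : Unit => 2 * n) ∧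
      ∀ v w, v ≠ w → (w.1 = v.1 ∨ w.1 = F v.1 ∨ v.1 = F w.1) → ∃ k, G k v = w := by
  obtain ⟨σ, hσ, hcov⟩ := Strip.exists_five hn
  obtain ⟨e, G, he, hG, hGσ⟩ := h.exists_strip hσ
  refine ⟨G, hG, ?_⟩
  rintro ⟨x, a⟩ ⟨y, b⟩ hne hxy
  simp only [hGσ]
  apply hcov
  · simpa using hne
  · simp only
    rcases hxy with h | h | h <;> simp only at h <;> simp [h, he]

theorem HasCycleLengths.exists_two (h : HasCycleLengths F fun _ : Unit => n) (hn : 5 ≤ n)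
    (hodd : Odd n) :
    ∃ G : Fin 2 → V × Fin 2 → V × Fin 2, (∀ k, HasCycleLengths (G k) fun _ : Unit => 2 * n) ∧
      ∀ x a b, ∃ k, G k (x, a) = (F x, b) ∨ G k (F x, b) = (x, a) := by
  obtain ⟨σ, hσ, hcov⟩ := Strip.exists_two hn hodd
  obtain ⟨e, G, he, hG, hGσ⟩ := h.exists_strip hσ
  refine ⟨G, hG, fun x a b => ?_⟩
  simp only [hGσ, he]
  exact hcov (e x) a b

/-- The lift of the translation by one to a double cover, changing sheets by `d`, and once more when
passing the origin. -/
def sheetLift (n : ℕ) (d : Fin 2) (v : ZMod n × Fin 2) : ZMod n × Fin 2 :=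
  (v.1 + 1, v.2 + d + if v.1 + 1 = 0 then 1 else 0)

theorem hasCycleLengths_sheetLift (hn : 0 < n) (heven : Even n) (d : Fin 2) :
    HasCycleLengths (sheetLift n d) fun _ : Unit => 2 * n := by
  have : NeZero n := ⟨hn.ne'⟩
  obtain ⟨q, hq⟩ := heven
  refine HasCycleLengths.of_single (by positivity) (by simp [ZMod.card]; ring)
    (fun v => ((v.1.val + n * ((v.2.val + d.val * v.1.val) % 2) : ℕ) : ZMod (2 * n))) ?_
  rintro ⟨u, c⟩
  simp only [sheetLift]
  rw [← Nat.cast_succ, ZMod.natCast_eq_natCast_iff]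
  by_cases hu : u + 1 = 0
  · have h1 : u.val = n - 1 := by
      have h2 : u = ((n - 1 : ℕ) : ZMod n) := by
        rw [Nat.cast_sub (by omega)]
        simp [eq_neg_of_add_eq_zero_left hu]
      rw [h2, ZMod.val_natCast_of_lt (by omega)]
    rw [if_pos hu, hu, h1, ZMod.val_zero]
    obtain rfl | rfl : d = 0 ∨ d = 1 := by omega
    · obtain rfl | rfl : c = 0 ∨ c = 1 := by omega
      · simp [Nat.ModEq, Nat.sub_add_cancel (show 1 ≤ n from hn)]
      · simp [Nat.ModEq]
        rw [show n - 1 + n + 1 = 2 * n by omega]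
        simp
    · have h3 : (n - 1) % 2 = 1 := by omega
      have h4 : (1 + (n - 1)) % 2 = 0 := by omega
      obtain rfl | rfl : c = 0 ∨ c = 1 := by omega
      · simp [Nat.ModEq, h3]
        rw [show n - 1 + n + 1 = 2 * n by omega]
        simp
      · simp [Nat.ModEq, h4, Nat.sub_add_cancel (show 1 ≤ n from hn)]
  · have h1 : (u + 1).val = u.val + 1 := by
      have h2 := u.val_lt
      have h3 : u.val + 1 ≠ n := fun h => hu (by
        have := congrArg (Nat.cast : ℕ → ZMod n) h
        simpa using this)
      have h4 : u + 1 = ((u.val + 1 : ℕ) : ZMod n) := by simp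
      rw [h4, ZMod.val_natCast_of_lt (by omega)]
    rw [if_neg hu, h1]
    have h2 : ((c + d + 0).val + d.val * (u.val + 1)) % 2 = (c.val + d.val * u.val) % 2 := by
      rw [add_zero, Fin.val_add, mul_add]
      omega
    rw [h2]
    exact congrArg (· % (2 * n)) (by omega)

theorem HasCycleLengths.exists_sheetLift (h : HasCycleLengths F fun _ : Unit => n) (hn : 0 < n)
    (heven : Even n) :
    ∃ G : Fin 2 → V × Fin 2 → V × Fin 2, (∀ d, HasCycleLengths (G d) fun _ : Unit => 2 * n) ∧
      ∀ x a b, ∃ d, G d (x, a) = (F x, b) := by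
  obtain ⟨e, G, he, hG, hGσ⟩ := h.exists_strip (hasCycleLengths_sheetLift hn heven)
  refine ⟨G, hG, fun x a b => ⟨b - a - if e x + 1 = 0 then 1 else 0, ?_⟩⟩
  rw [hGσ, he, sheetLift, Prod.mk.injEq]
  exact ⟨rfl, by abel⟩

/-- A decomposition of the complete digraph into directed hamiltonian cycles which contains two
cycles `τ 0`, `τ 1` together with their reversals. -/
def PairedHamiltonian (n : ℕ) : Prop :=
  ∃ (V K : Type) (_ : Fintype V) (_ : Fintype K) (σ : K → V → V) (τ : Fin 2 → V → V),
    Fintype.card V = n ∧ Fintype.card K + 5 = n ∧ (∀ k, HasCycleLengths (σ k) fun _ : Unit => n) ∧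
      (∀ i, HasCycleLengths (τ i) fun _ : Unit => n) ∧
      ∀ x y, x ≠ y → (∃ k, σ k x = y) ∨ ∃ i, τ i x = y ∨ τ i y = x

theorem PairedHamiltonian.opSolvable (h : PairedHamiltonian n) : OPSolvable fun _ : Unit => n := by
  obtain ⟨V, K, _, _, σ, τ, hV, hK, hσ, hτ, hcov⟩ := h
  choose ρ hρ hρτ using fun i => (hτ i).exists_inverse
  refine ⟨V, K ⊕ Fin 2 ⊕ Fin 2, inferInstance, inferInstance, inferInstance,
    Sum.elim σ (Sum.elim τ ρ), ?_, ?_, fun x y hxy => ?_⟩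
  · simp
    omega
  · rintro (k | i | i)
    exacts [hσ k, hτ i, hρ i]
  · rcases hcov x y hxy with ⟨k, hk⟩ | ⟨i, hi | hi⟩
    · exact ⟨Sum.inl k, hk⟩
    · exact ⟨Sum.inr (Sum.inl i), hi⟩
    · exact ⟨Sum.inr (Sum.inr i), by rw [← hi]; exact hρτ i y⟩

theorem PairedHamiltonian.double (h : PairedHamiltonian n) (hn : 7 ≤ n) (heven : Even n) :
    PairedHamiltonian (2 * n) := by
  obtain ⟨V, K, _, _, σ, τ, hV, hK, hσ, hτ, hcov⟩ := h
  choose G hG hGσ using fun k => (hσ k).exists_sheetLift (by omega) heven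
  obtain ⟨H, hH, hHτ⟩ := (hτ 1).exists_sheetLift (by omega) heven
  obtain ⟨R, hR, hRτ⟩ := (hτ 0).exists_five hn
  refine ⟨V × Fin 2, K × Fin 2 ⊕ Fin 5, inferInstance, inferInstance,
    Sum.elim (fun k => G k.1 k.2) R, H, ?_, ?_, ?_, hH, ?_⟩
  · simp [hV, mul_comm]
  · simp
    omega
  · rintro (k | i)
    exacts [hG _ _, hR i]
  · rintro ⟨x, a⟩ ⟨y, b⟩ hne
    by_cases hxy : x = y
    · obtain ⟨k, hk⟩ := hRτ _ _ hne (Or.inl hxy.symm)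
      exact Or.inl ⟨Sum.inr k, hk⟩
    rcases hcov x y hxy with ⟨k, rfl⟩ | ⟨i, hi⟩
    · obtain ⟨d, hd⟩ := hGσ k x a b
      exact Or.inl ⟨Sum.inl (k, d), hd⟩
    · obtain rfl | rfl : i = 0 ∨ i = 1 := by omega
      · obtain ⟨k, hk⟩ := hRτ _ _ hne (Or.inr (hi.imp Eq.symm Eq.symm))
        exact Or.inl ⟨Sum.inr k, hk⟩
      · rcases hi with rfl | rfl
        · obtain ⟨d, hd⟩ := hHτ x a b
          exact Or.inr ⟨d, Or.inl hd⟩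
        · obtain ⟨d, hd⟩ := hHτ y b a
          exact Or.inr ⟨d, Or.inr hd⟩

/-- The zigzag hamiltonian cycle `∞, 0, 1, -1, 2, -2, …, h`. -/
def zigzag (h : ℕ) : Option (ZMod (2 * h)) → Option (ZMod (2 * h))
  | none => some 0
  | some x => if x.val = h then none else
      if 0 < x.val ∧ x.val < h then some (-x) else some (1 - x)

theorem val_neg_eq_sub {h : ℕ} {x : ZMod (2 * h)} (hx : 0 < x.val) (hh : 0 < h) :
    (-x).val = 2 * h - x.val := by
  have : NeZero (2 * h) := ⟨by positivity⟩
  have h1 := x.val_lt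
  have h2 : -x = ((2 * h - x.val : ℕ) : ZMod (2 * h)) := by
    rw [Nat.cast_sub h1.le, ZMod.natCast_self, ZMod.natCast_zmod_val, zero_sub]
  rw [h2, ZMod.val_natCast_of_lt (by omega)]

theorem val_one_sub_eq {h : ℕ} {x : ZMod (2 * h)} (hh : 0 < h) :
    (1 - x).val = if x.val = 0 then 1 else if x.val = 1 then 0 else 2 * h + 1 - x.val := by
  have : NeZero (2 * h) := ⟨by positivity⟩
  have h1 := x.val_lt
  have h2 : 1 - x = ((2 * h + 1 - x.val : ℕ) : ZMod (2 * h)) := by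
    rw [Nat.cast_sub (by omega), Nat.cast_add, ZMod.natCast_self, ZMod.natCast_zmod_val]
    simp
  split_ifs with h3 h4
  · rw [h2, h3, Nat.sub_zero, ZMod.val_natCast, Nat.add_mod_left, Nat.mod_eq_of_lt (by omega)]
  · rw [h2, h4, Nat.add_sub_cancel, ZMod.natCast_self, ZMod.val_zero]
  · rw [h2, ZMod.val_natCast_of_lt (by omega)]

theorem hasCycleLengths_zigzag {h : ℕ} (hh : 0 < h) :
    HasCycleLengths (zigzag h) fun _ : Unit => 2 * h + 1 := by
  have : NeZero (2 * h) := ⟨by positivity⟩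
  refine HasCycleLengths.of_single (by positivity) (by simp [ZMod.card])
    (fun v => match v with
      | none => ((2 * h : ℕ) : ZMod (2 * h + 1))
      | some x => ((if x.val = 0 then 0 else if x.val ≤ h then 2 * x.val - 1
          else 2 * (2 * h - x.val) : ℕ) : ZMod (2 * h + 1))) ?_
  rintro (_ | x)
  · rw [← Nat.cast_succ]
    simp [zigzag]
  · have h1 := x.val_lt
    simp only [zigzag]
    by_cases h2 : x.val = h
    · rw [if_pos h2, if_neg (by omega), if_pos (by omega), ← Nat.cast_succ]
      simp only
      congr 1
      omega
    rw [if_neg h2]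
    by_cases h3 : 0 < x.val ∧ x.val < h
    · rw [if_pos h3]
      simp only
      rw [val_neg_eq_sub h3.1 hh, ← Nat.cast_succ]
      congr 1
      split_ifs <;> omega
    · rw [if_neg h3]
      simp only
      rw [val_one_sub_eq hh, ← Nat.cast_succ]
      congr 1
      split_ifs <;> omega

theorem zigzag_or {h : ℕ} (hh : 0 < h) {x y : ZMod (2 * h)} (hne : x ≠ y)
    (hxy : x + y = 0 ∨ x + y = 1) :
    zigzag h (some x) = some y ∨ zigzag h (some y) = some x := by
  have : NeZero (2 * h) := ⟨by positivity⟩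
  have h1 := x.val_lt
  have hinj := fun h => hne (ZMod.val_injective (2 * _) h)
  simp only [zigzag]
  rcases hxy with h2 | h2
  · obtain rfl := eq_neg_of_add_eq_zero_right h2
    have h0 : 0 < x.val := by
      rw [Nat.pos_iff_ne_zero]
      intro h0
      rw [ZMod.val_eq_zero] at h0
      simp [h0] at hne
    have h4 := val_neg_eq_sub h0 hh
    rcases lt_trichotomy x.val h with h3 | h3 | h3
    · left
      rw [if_neg h3.ne, if_pos ⟨h0, h3⟩]
    · exact (hinj (by omega)).elim
    · right
      rw [if_neg (by omega), if_pos (by omega), neg_neg]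
  · obtain rfl : y = 1 - x := by rw [← h2]; ring
    by_cases h3 : x.val = 0 ∨ h < x.val
    · left
      rw [if_neg (by omega), if_neg (by omega)]
    · right
      rw [val_one_sub_eq hh]
      rw [if_neg (by split_ifs <;> omega), if_neg (by split_ifs <;> omega), sub_sub_cancel]

/-- The rotations of the zigzag cycle decompose the complete graph of odd order. -/
theorem exists_hamiltonian_odd {h : ℕ} (hh : 0 < h) :
    ∃ c : Fin h → Option (ZMod (2 * h)) → Option (ZMod (2 * h)),
      (∀ j, HasCycleLengths (c j) fun _ : Unit => 2 * h + 1) ∧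
      ∀ x y, x ≠ y → ∃ j, c j x = y ∨ c j y = x := by
  have : NeZero (2 * h) := ⟨by positivity⟩
  let e : Fin h → Option (ZMod (2 * h)) ≃ Option (ZMod (2 * h)) := fun j =>
    Equiv.optionCongr (Equiv.addRight ((j : ℕ) : ZMod (2 * h)))
  refine ⟨fun j v => e j (zigzag h ((e j).symm v)), fun j => (hasCycleLengths_zigzag hh).conj _, ?_⟩
  have he : ∀ j z, e j (some z) = some (z + (j : ℕ)) := fun j z => rfl
  have he' : ∀ j z, (e j).symm (some z) = some (z - (j : ℕ)) := fun j z => by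
    rw [Equiv.symm_apply_eq, he, sub_add_cancel]
  have he0 : ∀ j, (e j).symm none = none := fun j => rfl
  have hinf : ∀ x, ∃ j, e j (zigzag h ((e j).symm none)) = some x ∨
      e j (zigzag h ((e j).symm (some x))) = none := by
    intro x
    have h1 := x.val_lt
    rcases lt_or_ge x.val h with h2 | h2
    · exact ⟨⟨x.val, h2⟩, Or.inl (by simp [he, he0, zigzag])⟩
    · refine ⟨⟨x.val - h, by omega⟩, Or.inr ?_⟩
      have h3 : x - ((x.val - h : ℕ) : ZMod (2 * h)) = (h : ℕ) := by
        rw [Nat.cast_sub h2]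
        simp
      have h4 : ((h : ℕ) : ZMod (2 * h)).val = h := ZMod.val_natCast_of_lt (by omega)
      rw [he']
      simp only [zigzag, h3, h4, if_true]
      rfl
  rintro (_ | x) (_ | y) hne
  · exact absurd rfl hne
  · exact hinf y
  · exact (hinf x).imp fun _ => Or.symm
  · have h1 := (x + y).val_lt
    refine ⟨⟨(x + y).val / 2, by omega⟩, ?_⟩
    set q : ℕ := (x + y).val / 2 with hq
    have h2 : (x - q) + (y - q) = 0 ∨ (x - q) + (y - q) = 1 := by
      have h3 : x + y = ((x + y).val : ℕ) := by simp
      have h4 : (x - q) + (y - q) = (x + y : ZMod (2 * h)) - (2 * q : ℕ) := by push_cast; ring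
      rw [h4, h3]
      rcases Nat.mod_two_eq_zero_or_one (x + y).val with h5 | h5
      · left
        rw [sub_eq_zero]
        congr 1
        omega
      · right
        rw [sub_eq_iff_eq_add', ← Nat.cast_succ]
        congr 1
        omega
    have h3 := zigzag_or hh (x := x - q) (y := y - q) (by simpa using hne) h2
    simp only [he']
    exact h3.imp (fun h3 => by rw [h3, he, sub_add_cancel])
      (fun h3 => by rw [h3, he, sub_add_cancel])

theorem pairedHamiltonian_two_mul_odd {n : ℕ} (hn : 7 ≤ n) (hodd : Odd n) :
    PairedHamiltonian (2 * n) := by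
  obtain ⟨h, rfl⟩ := hodd
  obtain ⟨h', rfl⟩ : ∃ h', h = h' + 2 := ⟨h - 2, by omega⟩
  obtain ⟨c, hc, hcov⟩ := exists_hamiltonian_odd (show 0 < h' + 2 by omega)
  choose T hT hTc using fun j => (hc j).exists_two (by omega) ⟨_, rfl⟩
  choose R hR hRT using fun j k => (hT j k).exists_inverse
  obtain ⟨G, hG, hGc⟩ := (hc 0).exists_five hn
  refine ⟨Option (ZMod (2 * (h' + 2))) × Fin 2, Fin 5 ⊕ Fin h' × (Fin 2 ⊕ Fin 2), inferInstance,
    inferInstance, Sum.elim G fun k => Sum.elim (T k.1.succ.succ) (R k.1.succ.succ) k.2, T 1,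
    ?_, ?_, ?_, hT 1, ?_⟩
  · simp [ZMod.card]
    ring
  · simp
    ring
  · rintro (k | ⟨j, k | k⟩)
    exacts [hG k, hT _ k, hR _ k]
  · rintro ⟨x, a⟩ ⟨y, b⟩ hne
    by_cases hxy : x = y
    · obtain ⟨k, hk⟩ := hGc _ _ hne (Or.inl hxy.symm)
      exact Or.inl ⟨Sum.inl k, hk⟩
    obtain ⟨j, hj⟩ := hcov x y hxy
    rcases eq_or_ne j 0 with rfl | hj0
    · obtain ⟨k, hk⟩ := hGc _ _ hne (Or.inr (hj.imp Eq.symm Eq.symm))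
      exact Or.inl ⟨Sum.inl k, hk⟩
    have hT' : ∃ k, T j k (x, a) = (y, b) ∨ T j k (y, b) = (x, a) := by
      rcases hj with rfl | rfl
      · exact hTc j x a b
      · exact (hTc j y b a).imp fun _ => Or.symm
    obtain ⟨k, hk⟩ := hT'
    obtain ⟨i, rfl⟩ := Fin.exists_succ_eq.2 hj0
    rcases eq_or_ne i 0 with rfl | hi0
    · exact Or.inr ⟨k, hk⟩
    · obtain ⟨j, rfl⟩ := Fin.exists_succ_eq.2 hi0
      rcases hk with hk | hk
      · exact Or.inl ⟨Sum.inr (j, Sum.inl k), hk⟩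
      · exact Or.inl ⟨Sum.inr (j, Sum.inr k), by rw [← hk]; exact hRT _ _ _⟩

end Hamiltonian

section Tables

variable {n J : ℕ}

/-- The first cycle of the list through a point. -/
def cycleThrough (cs : List (List (Fin n))) (v : Fin n) : List (Fin n) :=
  cs.getD (cs.findIdx (v ∈ ·)) []

/-- The map advancing every point along its cycle. -/
def cycleMap (cs : List (List (Fin n))) (v : Fin n) : Fin n :=
  (cycleThrough cs v).getD (((cycleThrough cs v).idxOf v + 1) % (cycleThrough cs v).length) v

/-- `cs` is a partition of the points into cycles of lengths `s`. -/
def IsCycleList (s : Fin J → ℕ) (cs : List (List (Fin n))) : Prop :=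
  cs.map List.length = List.ofFn s ∧ (∀ v, cs.findIdx (v ∈ ·) < J) ∧
    (∀ j : Fin J, ∃ v, cs.findIdx (v ∈ ·) = j) ∧
    ∀ v, cs.findIdx (cycleMap cs v ∈ ·) = cs.findIdx (v ∈ ·) ∧
      (cycleThrough cs v).idxOf (cycleMap cs v) =
        ((cycleThrough cs v).idxOf v + 1) % (cycleThrough cs v).length

instance (s : Fin J → ℕ) (cs : List (List (Fin n))) : Decidable (IsCycleList s cs) := by
  unfold IsCycleList
  infer_instance

theorem IsCycleList.hasCycleLengths {s : Fin J → ℕ} {cs : List (List (Fin n))}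
    (h : IsCycleList s cs) (hs : ∀ j, 0 < s j) (hn : n = ∑ j, s j) :
    HasCycleLengths (cycleMap cs) s := by
  obtain ⟨h1, h2, h3, h4⟩ := h
  refine HasCycleLengths.of_phase hs (by simpa using hn) (fun v => ⟨_, h2 v⟩)
    (fun v => (cycleThrough cs v).idxOf v) (fun v => Fin.ext (h4 v).1) (fun v => ?_)
    fun j => (h3 j).imp fun v hv => Fin.ext hv
  have h5 : cycleThrough cs (cycleMap cs v) = cycleThrough cs v := by
    rw [cycleThrough, (h4 v).1, cycleThrough]
  have h6 : (cycleThrough cs v).length = s ⟨_, h2 v⟩ := by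
    have h7 : (cs.map List.length)[cs.findIdx (v ∈ ·)]? = (List.ofFn s)[cs.findIdx (v ∈ ·)]? := by
      rw [h1]
    rw [List.getElem?_map, List.getElem?_ofFn, dif_pos (h2 v)] at h7
    obtain ⟨c, hc, hc'⟩ := Option.map_eq_some_iff.1 h7
    rw [cycleThrough, List.getD_eq_getElem?_getD, hc, ← hc']
    rfl
  rw [h5, (h4 v).2, ← h6, ZMod.natCast_mod, Nat.cast_succ]

theorem opSolvable_of_table (s : Fin J → ℕ) (rows : List (List (List (Fin n))))
    (h : (∀ j, 0 < s j) ∧ n = ∑ j, s j ∧ rows.length + 1 = n ∧ rows ≠ [] ∧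
      (∀ cs ∈ rows, IsCycleList s cs) ∧ ∀ x y, x ≠ y → ∃ cs ∈ rows, cycleMap cs x = y) :
    OPSolvable s := by
  obtain ⟨hs, hn, hr, hr0, hcs, hcov⟩ := h
  refine ⟨Fin n, Fin rows.length, inferInstance, inferInstance,
    ⟨⟨0, List.length_pos_iff.2 hr0⟩⟩, fun k => cycleMap rows[k], by simpa using hr,
    fun k => (hcs _ (List.getElem_mem _)).hasCycleLengths hs hn, fun x y hxy => ?_⟩
  obtain ⟨cs, hmem, h⟩ := hcov x y hxy
  obtain ⟨i, hi, rfl⟩ := List.mem_iff_getElem.1 hmem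
  exact ⟨⟨i, hi⟩, h⟩

theorem pairedHamiltonian_of_table (pairs rows : List (List (List (Fin n))))
    (h : 0 < n ∧ rows.length + 5 = n ∧ pairs.length = 2 ∧
      (∀ cs ∈ pairs ++ rows, IsCycleList (fun _ : Fin 1 => n) cs) ∧
      ∀ x y, x ≠ y → (∃ cs ∈ rows, cycleMap cs x = y) ∨
        ∃ cs ∈ pairs, cycleMap cs x = y ∨ cycleMap cs y = x) :
    PairedHamiltonian n := by
  obtain ⟨hn, hr, hp, hcs, hcov⟩ := h
  have hcyc : ∀ cs ∈ pairs ++ rows, HasCycleLengths (cycleMap cs) (fun _ : Unit => n) :=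
    fun cs hmem => ((hcs _ hmem).hasCycleLengths (fun _ => hn) (by simp)).reindex
      (Equiv.ofUnique (Fin 1) Unit) (fun _ => rfl)
  refine ⟨Fin n, Fin rows.length, inferInstance, inferInstance, fun k => cycleMap rows[k],
    fun i => cycleMap (pairs[i]'(by omega)), by simp, by simpa using hr,
    fun k => hcyc _ (List.mem_append_right _ (List.getElem_mem _)),
    fun i => hcyc _ (List.mem_append_left _ (List.getElem_mem _)), fun x y hxy => ?_⟩
  rcases hcov x y hxy with ⟨cs, hmem, h⟩ | ⟨cs, hmem, h⟩
  · obtain ⟨i, hi, rfl⟩ := List.mem_iff_getElem.1 hmem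
    exact Or.inl ⟨⟨i, hi⟩, h⟩
  · obtain ⟨i, hi, rfl⟩ := List.mem_iff_getElem.1 hmem
    exact Or.inr ⟨⟨i, by omega⟩, h⟩

theorem opSolvable_two : OPSolvable (fun _ => 2 : Fin 1 → ℕ) :=
  opSolvable_of_table (n := 2) _
    [[[0, 1]]]
    (by decide +kernel)

theorem opSolvable_eight : OPSolvable (fun _ => 8 : Fin 1 → ℕ) :=
  opSolvable_of_table (n := 8) _
    [[[0, 1, 4, 5, 6, 3, 2, 7]], [[0, 2, 1, 5, 3, 7, 4, 6]], [[0, 3, 6, 5, 1, 7, 2, 4]],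
     [[0, 4, 2, 3, 5, 7, 6, 1]], [[0, 5, 2, 6, 4, 7, 1, 3]], [[0, 6, 7, 3, 4, 1, 2, 5]],
     [[0, 7, 5, 4, 3, 1, 6, 2]]]
    (by decide +kernel)

theorem opSolvable_four_four : OPSolvable (fun _ => 4 : Fin 2 → ℕ) :=
  opSolvable_of_table (n := 8) _
    [[[0, 1, 2, 3], [4, 5, 7, 6]], [[0, 2, 4, 7], [1, 3, 5, 6]], [[0, 3, 2, 1], [4, 6, 7, 5]],
     [[0, 4, 1, 5], [2, 7, 3, 6]], [[0, 5, 1, 4], [2, 6, 3, 7]], [[0, 6, 5, 2], [1, 7, 4, 3]],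
     [[0, 7, 1, 6], [2, 5, 3, 4]]]
    (by decide +kernel)

theorem opSolvable_four_two_two : OPSolvable (![4, 2, 2] : Fin 3 → ℕ) :=
  opSolvable_of_table (n := 8) _
    [[[2, 7, 6, 5], [0, 1], [3, 4]], [[1, 4, 6, 3], [0, 2], [5, 7]],
     [[1, 5, 6, 2], [0, 3], [4, 7]], [[1, 7, 2, 6], [0, 4], [3, 5]],
     [[1, 3, 6, 7], [0, 5], [2, 4]], [[1, 2, 5, 4], [0, 6], [3, 7]],
     [[1, 6, 4, 5], [0, 7], [2, 3]]]
    (by decide +kernel)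

theorem opSolvable_four_four_four : OPSolvable (fun _ => 4 : Fin 3 → ℕ) :=
  opSolvable_of_table (n := 12) _
    [[[0, 1, 2, 3], [4, 11, 7, 10], [5, 8, 6, 9]], [[0, 2, 1, 6], [3, 11, 10, 8], [4, 5, 9, 7]],
     [[0, 3, 6, 8], [1, 9, 2, 7], [4, 10, 11, 5]], [[0, 4, 7, 2], [1, 5, 3, 8], [6, 10, 9, 11]],
     [[0, 5, 2, 11], [1, 4, 8, 9], [3, 10, 7, 6]], [[0, 6, 5, 7], [1, 11, 9, 4], [2, 8, 10, 3]],
     [[0, 7, 3, 4], [1, 10, 5, 6], [2, 9, 8, 11]], [[0, 8, 5, 10], [1, 3, 7, 11], [2, 4, 9, 6]],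
     [[0, 9, 10, 1], [2, 6, 7, 8], [3, 5, 11, 4]], [[0, 10, 2, 5], [1, 7, 9, 3], [4, 6, 11, 8]],
     [[0, 11, 3, 9], [1, 8, 7, 5], [2, 10, 6, 4]]]
    (by decide +kernel)

theorem opSolvable_six_two_two_two : OPSolvable (![6, 2, 2, 2] : Fin 4 → ℕ) :=
  opSolvable_of_table (n := 12) _
    [[[0, 6, 3, 10, 4, 8], [1, 2], [5, 11], [7, 9]],
     [[0, 5, 9, 1, 7, 4], [2, 3], [6, 11], [8, 10]],
     [[1, 6, 10, 2, 8, 5], [0, 9], [3, 4], [7, 11]],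
     [[0, 3, 9, 6, 2, 7], [1, 10], [4, 5], [8, 11]],
     [[1, 4, 10, 7, 3, 8], [0, 2], [5, 6], [9, 11]],
     [[0, 8, 4, 9, 2, 5], [1, 3], [6, 7], [10, 11]],
     [[1, 9, 5, 10, 3, 6], [0, 11], [2, 4], [7, 8]],
     [[0, 4, 7, 2, 10, 6], [1, 11], [3, 5], [8, 9]],
     [[0, 7, 1, 5, 8, 3], [2, 11], [4, 6], [9, 10]],
     [[1, 8, 2, 6, 9, 4], [0, 10], [3, 11], [5, 7]],
     [[2, 9, 3, 7, 10, 5], [0, 1], [4, 11], [6, 8]]]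
    (by decide +kernel)

theorem pairedHamiltonian_ten : PairedHamiltonian 10 :=
  pairedHamiltonian_of_table (n := 10)
    [[[0, 1, 2, 3, 4, 5, 6, 7, 8, 9]], [[0, 3, 7, 9, 5, 2, 8, 6, 1, 4]]]
    [[[0, 8, 5, 1, 3, 6, 9, 4, 2, 7]], [[0, 2, 9, 1, 8, 3, 5, 7, 4, 6]],
     [[0, 7, 2, 6, 4, 9, 3, 1, 5, 8]], [[0, 6, 3, 9, 2, 4, 8, 1, 7, 5]],
     [[0, 5, 3, 8, 4, 7, 1, 9, 6, 2]]]
    (by decide +kernel)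

theorem pairedHamiltonian_twelve : PairedHamiltonian 12 :=
  pairedHamiltonian_of_table (n := 12)
    [[[0, 1, 2, 3, 4, 5, 6, 7, 8, 9, 10, 11]], [[0, 10, 1, 11, 9, 5, 2, 6, 3, 7, 4, 8]]]
    [[[0, 6, 1, 9, 4, 10, 5, 3, 8, 11, 2, 7]], [[0, 4, 9, 3, 1, 8, 5, 7, 11, 6, 10, 2]],
     [[0, 3, 11, 5, 1, 6, 9, 7, 10, 8, 2, 4]], [[0, 5, 8, 1, 3, 10, 4, 11, 7, 2, 9, 6]],
     [[0, 2, 8, 10, 7, 9, 1, 4, 6, 11, 3, 5]], [[0, 9, 2, 11, 8, 6, 4, 1, 7, 5, 10, 3]],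
     [[0, 7, 1, 5, 11, 4, 2, 10, 6, 8, 3, 9]]]
    (by decide +kernel)

theorem pairedHamiltonian_sixteen : PairedHamiltonian 16 :=
  pairedHamiltonian_of_table (n := 16)
    [[[0, 1, 2, 3, 4, 5, 6, 7, 8, 9, 10, 11, 12, 13, 14, 15]],
     [[0, 12, 7, 5, 10, 3, 13, 15, 9, 14, 1, 4, 8, 11, 2, 6]]]
    [[[0, 7, 11, 4, 9, 13, 6, 3, 15, 10, 14, 8, 12, 1, 5, 2]],
     [[0, 5, 12, 2, 4, 6, 15, 8, 14, 10, 13, 11, 3, 9, 1, 7]],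
     [[0, 4, 7, 9, 2, 10, 12, 15, 1, 3, 5, 14, 11, 6, 8, 13]],
     [[0, 2, 5, 11, 9, 3, 12, 4, 10, 15, 7, 13, 8, 1, 6, 14]],
     [[0, 3, 1, 15, 12, 9, 11, 13, 10, 8, 6, 4, 2, 7, 14, 5]],
     [[0, 8, 2, 12, 10, 6, 13, 5, 15, 11, 14, 3, 7, 1, 9, 4]],
     [[0, 9, 5, 13, 4, 12, 14, 7, 3, 11, 15, 6, 1, 10, 2, 8]],
     [[0, 10, 4, 13, 7, 15, 3, 14, 2, 9, 6, 12, 8, 5, 1, 11]],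
     [[0, 14, 4, 11, 5, 3, 8, 15, 2, 13, 1, 12, 6, 9, 7, 10]],
     [[0, 13, 2, 14, 12, 3, 6, 11, 1, 8, 10, 7, 4, 15, 5, 9]],
     [[0, 11, 7, 2, 15, 4, 14, 6, 10, 1, 13, 9, 12, 5, 8, 3]]]
    (by decide +kernel)

end Tables

namespace Strip

variable {b p j L : ℕ}

/-- Every index modulo `M.1 + M.2 * j` occurs in the strip described by the table. -/
def IndexOnto (b p : ℕ) (M : ℕ × ℕ) (tab : ℕ → Fin L → StripEntry L) : Prop :=
  (∀ l < M.1, ∃ t < b, ∃ e, (tab t e).const = l ∧ (tab t e).blockCoeff = 0 ∧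
      (tab t e).lengthCoeff = 0) ∧
    ∀ l < M.2, ∃ t < p, ∃ e, (tab (b + t) e).const = M.1 + l ∧ (tab (b + t) e).blockCoeff = M.2 ∧
      (tab (b + t) e).lengthCoeff = 0

instance (b p : ℕ) (M : ℕ × ℕ) (tab : ℕ → Fin L → StripEntry L) :
    Decidable (IndexOnto b p M tab) := by
  unfold IndexOnto
  infer_instance

theorem IsAt.index_eq [NeZero (b + p * j)] (hp : 0 < p) {x : ZMod (b + p * j)} {t : ℕ} {i : ℤ}
    (h : IsAt b p j x t i) (tab : ℕ → Fin L → StripEntry L) (e : Fin L) :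
    index b p j tab (x, e) =
      affine ((tab t e).const, (tab t e).blockCoeff, (tab t e).lengthCoeff) i j := by
  obtain ⟨h1, h2⟩ := h.eq hp
  rw [Int.natCast_inj] at h1
  rw [index, h2, h1]

theorem IndexOnto.exists_index {M : ℕ × ℕ} {tab : ℕ → Fin L → StripEntry L}
    (h : IndexOnto b p M tab) (hb : 0 < b) (hp : 0 < p) (l : ZMod (M.1 + M.2 * j))
    (hM : 0 < M.1) :
    ∃ v, (index b p j tab v : ZMod (M.1 + M.2 * j)) = l := by
  have : NeZero (b + p * j) := ⟨by positivity⟩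
  have : NeZero (M.1 + M.2 * j) := ⟨by positivity⟩
  have hl := l.val_lt
  rcases lt_or_ge l.val M.1 with h1 | h1
  · obtain ⟨t, ht, e, h2, h3, h4⟩ := h.1 _ h1
    refine ⟨(((t : ℤ) : ZMod _), e), ?_⟩
    rw [IsAt.index_eq hp (i := 0) (Or.inl ⟨by simp, by exact_mod_cast ht, rfl, rfl⟩)]
    simp [affine, h2, h3, h4]
  · have hM2 : 0 < M.2 := by
      rw [Nat.pos_iff_ne_zero]
      intro h0
      have : M.2 * j = 0 := by rw [h0, zero_mul]
      omega
    have h5 := Nat.mod_add_div (l.val - M.1) M.2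
    obtain ⟨t, ht, e, h2, h3, h4⟩ := h.2 _ (Nat.mod_lt (l.val - M.1) hM2)
    have h6 : (l.val - M.1) / M.2 < j := Nat.div_lt_of_lt_mul (by omega)
    refine ⟨((((b + t : ℕ) : ℤ) + p * ((l.val - M.1) / M.2 : ℕ) : ℤ), e), ?_⟩
    rw [IsAt.index_eq hp (i := ((l.val - M.1) / M.2 : ℕ)) (Or.inr ⟨by simp, by simpa using ht,
      by positivity, by exact_mod_cast h6, rfl⟩)]
    have h7 : M.1 + (l.val - M.1) % M.2 + M.2 * ((l.val - M.1) / M.2) = l.val := by omega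
    have h8 := congrArg (Nat.cast : ℕ → ZMod (M.1 + M.2 * j)) h7
    rw [ZMod.natCast_zmod_val] at h8
    simp only [affine, h2, h3, h4, zero_mul, add_zero]
    exact_mod_cast h8

theorem hasCycleLengths_of_index {M : ℕ × ℕ} {s : ℕ} {tab : ℕ → Fin L → StripEntry L}
    (hspec : ∀ v, (index b p j tab (map b p j tab v) : ZMod (M.1 + M.2 * j)) = index b p j tab v ∧
      (phase b p j tab (map b p j tab v) : ZMod s) = phase b p j tab v + 1)
    (honto : IndexOnto b p M tab) (hb : 0 < b) (hp : 0 < p) (hM : 0 < M.1) (hs : 0 < s)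
    (hcard : (b + p * j) * L = (M.1 + M.2 * j) * s) :
    HasCycleLengths (map b p j tab) fun _ : ZMod (M.1 + M.2 * j) => s := by
  have : NeZero (b + p * j) := ⟨by positivity⟩
  have : NeZero (M.1 + M.2 * j) := ⟨by positivity⟩
  refine HasCycleLengths.of_phase (fun _ => hs) ?_
    (fun v => (index b p j tab v : ZMod (M.1 + M.2 * j))) (phase b p j tab)
    (fun v => (hspec v).1) (fun v => (hspec v).2) (fun l => honto.exists_index hb hp l hM)
  simp [ZMod.card, hcard]

theorem Consistent.hasCycleLengths_of_index {M : ℕ × ℕ} {s : ℕ} {tab : ℕ → Fin L → StripEntry L}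
    (h : Consistent b p (M.1, M.2) 0 s tab) (honto : IndexOnto b p M tab) (hp : 0 < p)
    (hpb : p ≤ b) (hj : 1 ≤ j) (hM : 0 < M.1) (hs : 0 < s)
    (hcard : (b + p * j) * L = (M.1 + M.2 * j) * s) :
    HasCycleLengths (map b p j tab) fun _ : ZMod (M.1 + M.2 * j) => s := by
  refine Strip.hasCycleLengths_of_index (fun v => ?_) honto (by omega) hp hM hs hcard
  simpa using h.map_spec hp hpb hj (n := M.1 + M.2 * j) (by push_cast; ring) v

/-- Nine permutations of a strip with cycles of length four. -/
def nineFour (k : Fin 9) : ℕ → Fin 2 → StripEntry 2 := ofList <| List.get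
  [[[⟨-1, 0, -2, 0, 0, 2⟩, ⟨3, 1, 0, 0, 0, 0⟩], [⟨0, 1, 1, 0, 0, 0⟩, ⟨1, 1, 1, 0, 0, 1⟩],
     [⟨-1, 0, 1, 0, 0, 3⟩, ⟨0, 0, 1, 0, 0, 2⟩], [⟨-3, 1, 0, 0, 0, 3⟩, ⟨1, 0, 0, 0, 0, 1⟩],
     [⟨-1, 0, 0, 0, 0, 2⟩, ⟨1, 1, 2, 0, 0, 0⟩], [⟨-1, 1, 2, 0, 0, 3⟩, ⟨1, 0, 2, 0, 0, 1⟩],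
     [⟨-1, 0, 2, 0, 0, 2⟩, ⟨3, 1, 4, 0, 0, 0⟩], [⟨-1, 1, 4, 0, 0, 3⟩, ⟨3, 0, 3, 0, 0, 1⟩],
     [⟨-1, 0, 4, 0, 0, 2⟩, ⟨-1, 1, 3, 0, 0, 0⟩],
     [⟨-1, 1, 3, 0, 0, 3⟩, ⟨-1, 0, 4, 0, 0, 1⟩], [⟨-1, 0, 3, 2, 0, 2⟩, ⟨1, 0, 6, 2, 0, 0⟩],
     [⟨1, 0, 6, 2, 0, 1⟩, ⟨-1, 1, 6, 2, 0, 3⟩], [⟨-1, 1, 6, 2, 0, 2⟩, ⟨1, 1, 5, 2, 0, 0⟩],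
     [⟨-1, 1, 5, 2, 0, 3⟩, ⟨1, 0, 5, 2, 0, 1⟩]],
    [[⟨3, 1, 0, 0, 0, 0⟩, ⟨-3, 1, -3, 0, 0, 2⟩],
     [⟨3, 0, -1, 0, 0, 1⟩, ⟨-3, 0, -1, 0, 0, 3⟩],
     [⟨1, 0, 0, 0, 0, 2⟩, ⟨-3, 1, -2, 0, 0, 2⟩],
     [⟨-3, 0, 0, 0, 0, 3⟩, ⟨-1, 0, 0, 0, 0, 1⟩],
     [⟨-3, 1, -1, 0, 0, 2⟩, ⟨1, 0, 1, 0, 0, 0⟩], [⟨1, 0, 1, 0, 0, 1⟩, ⟨-1, 1, 1, 0, 0, 3⟩],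
     [⟨-1, 1, 1, 0, 0, 2⟩, ⟨1, 0, 2, 0, 0, 0⟩], [⟨3, 1, 2, 0, 0, 1⟩, ⟨-1, 1, 2, 0, 0, 3⟩],
     [⟨3, 0, 4, 0, 0, 0⟩, ⟨1, 0, 3, 0, 0, 0⟩], [⟨3, 1, 3, 0, 0, 1⟩, ⟨-1, 1, 3, 0, 0, 3⟩],
     [⟨3, 0, 5, 2, 0, 0⟩, ⟨-3, 1, 2, 2, 0, 2⟩], [⟨3, 1, 4, 2, 0, 1⟩, ⟨-3, 0, 4, 2, 0, 3⟩],
     [⟨3, 0, 6, 2, 0, 0⟩, ⟨-3, 1, 3, 2, 0, 2⟩], [⟨3, 1, 5, 2, 0, 1⟩, ⟨-3, 0, 5, 2, 0, 3⟩]],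
    [[⟨1, 0, -2, 0, 0, 2⟩, ⟨-1, 1, -1, 0, 0, 3⟩],
     [⟨-3, 1, -2, 0, 0, 3⟩, ⟨-1, 0, -2, 0, 0, 1⟩],
     [⟨1, 1, -1, 0, 0, 1⟩, ⟨1, 0, 0, 0, 0, 0⟩], [⟨1, 1, 0, 0, 0, 1⟩, ⟨-3, 1, -1, 0, 0, 2⟩],
     [⟨-2, 1, 0, 0, 0, 3⟩, ⟨0, 0, 0, 0, 0, 2⟩], [⟨0, 1, 1, 0, 0, 0⟩, ⟨2, 0, 1, 0, 0, 1⟩],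
     [⟨0, 1, 2, 0, 0, 0⟩, ⟨3, 0, 2, 0, 0, 1⟩], [⟨0, 1, 1, 0, 0, 2⟩, ⟨-2, 0, 1, 0, 0, 3⟩],
     [⟨-2, 0, 2, 0, 0, 3⟩, ⟨3, 1, 3, 0, 0, 0⟩], [⟨-1, 0, 2, 0, 0, 2⟩, ⟨3, 0, 4, 0, 0, 0⟩],
     [⟨1, 0, 3, 2, 0, 2⟩, ⟨-1, 1, 4, 2, 0, 3⟩], [⟨-3, 1, 3, 2, 0, 3⟩, ⟨-1, 0, 3, 2, 0, 1⟩],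
     [⟨1, 0, 4, 2, 0, 1⟩, ⟨3, 1, 5, 2, 0, 0⟩], [⟨-3, 1, 4, 2, 0, 2⟩, ⟨3, 0, 6, 2, 0, 0⟩]],
    [[⟨1, 1, -2, 0, 0, 1⟩, ⟨3, 0, 0, 0, 0, 0⟩], [⟨-1, 1, 0, 0, 0, 3⟩, ⟨1, 0, -2, 0, 0, 2⟩],
     [⟨-3, 0, -2, 0, 0, 3⟩, ⟨-1, 0, 0, 0, 0, 2⟩],
     [⟨-1, 1, 0, 0, 0, 1⟩, ⟨2, 0, 1, 0, 0, 0⟩], [⟨0, 1, 1, 0, 0, 2⟩, ⟨-1, 1, 1, 0, 0, 3⟩],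
     [⟨-1, 0, 1, 0, 0, 1⟩, ⟨2, 1, 2, 0, 0, 0⟩], [⟨1, 0, 4, 0, 0, 0⟩, ⟨-1, 1, 2, 0, 0, 3⟩],
     [⟨1, 1, 4, 0, 0, 1⟩, ⟨1, 0, 2, 0, 0, 1⟩], [⟨-2, 1, 2, 0, 0, 2⟩, ⟨1, 1, 4, 0, 0, 2⟩],
     [⟨1, 0, 3, 0, 0, 0⟩, ⟨-3, 0, 4, 0, 0, 3⟩], [⟨1, 1, 3, 2, 0, 1⟩, ⟨3, 1, 6, 2, 0, 0⟩],
     [⟨-1, 1, 6, 2, 0, 3⟩, ⟨1, 0, 3, 2, 0, 2⟩], [⟨-3, 0, 3, 2, 0, 3⟩, ⟨-1, 0, 6, 2, 0, 2⟩],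
     [⟨1, 0, 5, 2, 0, 0⟩, ⟨-1, 1, 6, 2, 0, 1⟩]],
    [[⟨0, 1, 0, 0, 0, 0⟩, ⟨1, 1, 0, 0, 0, 1⟩], [⟨-1, 0, 0, 0, 0, 3⟩, ⟨0, 0, 0, 0, 0, 2⟩],
     [⟨0, 1, 1, 0, 0, 0⟩, ⟨1, 1, 1, 0, 0, 1⟩], [⟨1, 0, 2, 0, 0, 0⟩, ⟨1, 1, 1, 0, 0, 2⟩],
     [⟨1, 1, 2, 0, 0, 1⟩, ⟨-2, 0, 1, 0, 0, 3⟩], [⟨-2, 0, 2, 0, 0, 3⟩, ⟨0, 0, 2, 0, 0, 2⟩],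
     [⟨1, 1, 3, 0, 0, 0⟩, ⟨2, 0, 4, 0, 0, 0⟩], [⟨-1, 0, 3, 0, 0, 3⟩, ⟨1, 1, 3, 0, 0, 1⟩],
     [⟨1, 0, 4, 0, 0, 1⟩, ⟨-1, 0, 3, 0, 0, 2⟩], [⟨0, 1, 4, 0, 0, 2⟩, ⟨-3, 1, 4, 0, 0, 3⟩],
     [⟨0, 1, 5, 2, 0, 0⟩, ⟨1, 1, 5, 2, 0, 1⟩], [⟨-1, 0, 5, 2, 0, 3⟩, ⟨0, 0, 5, 2, 0, 2⟩],
     [⟨0, 1, 6, 2, 0, 0⟩, ⟨1, 0, 6, 2, 0, 1⟩], [⟨0, 1, 6, 2, 0, 2⟩, ⟨-1, 0, 6, 2, 0, 3⟩]],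
    [[⟨-3, 1, -2, 0, 0, 1⟩, ⟨-3, 0, -2, 0, 0, 3⟩],
     [⟨3, 1, 0, 0, 0, 0⟩, ⟨3, 0, 0, 0, 0, 2⟩],
     [⟨-3, 1, -1, 0, 0, 1⟩, ⟨-3, 0, -1, 0, 0, 3⟩],
     [⟨2, 0, 1, 0, 0, 0⟩, ⟨2, 1, 1, 0, 0, 2⟩], [⟨-3, 0, 0, 0, 0, 3⟩, ⟨-3, 1, 0, 0, 0, 1⟩],
     [⟨-2, 1, 1, 0, 0, 1⟩, ⟨-2, 0, 1, 0, 0, 3⟩], [⟨2, 0, 2, 0, 0, 0⟩, ⟨0, 0, 2, 0, 0, 3⟩],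
     [⟨3, 0, 3, 0, 0, 0⟩, ⟨3, 1, 3, 0, 0, 2⟩], [⟨0, 1, 2, 0, 0, 1⟩, ⟨-2, 1, 2, 0, 0, 2⟩],
     [⟨3, 0, 4, 0, 0, 0⟩, ⟨3, 1, 4, 0, 0, 2⟩], [⟨-3, 1, 3, 2, 0, 1⟩, ⟨-3, 0, 3, 2, 0, 3⟩],
     [⟨3, 0, 5, 2, 0, 0⟩, ⟨3, 1, 5, 2, 0, 2⟩], [⟨-3, 1, 4, 2, 0, 1⟩, ⟨-3, 0, 4, 2, 0, 3⟩],
     [⟨3, 0, 6, 2, 0, 0⟩, ⟨3, 1, 6, 2, 0, 2⟩]],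
    [[⟨-1, 1, -2, 0, 0, 2⟩, ⟨0, 0, -2, 0, 0, 1⟩], [⟨1, 1, 0, 0, 0, 0⟩, ⟨3, 1, 0, 0, 0, 2⟩],
     [⟨2, 0, 1, 0, 0, 0⟩, ⟨-1, 1, 0, 0, 0, 1⟩], [⟨-1, 0, 1, 0, 0, 3⟩, ⟨0, 0, 1, 0, 0, 2⟩],
     [⟨-1, 1, 1, 0, 0, 1⟩, ⟨-3, 0, 0, 0, 0, 3⟩], [⟨2, 0, 2, 0, 0, 0⟩, ⟨1, 1, 2, 0, 0, 2⟩],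
     [⟨2, 1, 4, 0, 0, 0⟩, ⟨-1, 0, 2, 0, 0, 3⟩], [⟨-2, 1, 2, 0, 0, 1⟩, ⟨-1, 0, 4, 0, 0, 3⟩],
     [⟨-1, 1, 4, 0, 0, 2⟩, ⟨0, 0, 4, 0, 0, 1⟩], [⟨1, 1, 3, 0, 0, 0⟩, ⟨0, 0, 3, 0, 0, 3⟩],
     [⟨-1, 1, 3, 2, 0, 2⟩, ⟨0, 0, 3, 2, 0, 1⟩], [⟨0, 1, 6, 2, 0, 0⟩, ⟨1, 1, 6, 2, 0, 1⟩],
     [⟨-1, 0, 6, 2, 0, 3⟩, ⟨0, 0, 6, 2, 0, 2⟩], [⟨1, 1, 5, 2, 0, 0⟩, ⟨0, 0, 5, 2, 0, 3⟩]],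
    [[⟨-3, 0, -2, 0, 0, 3⟩, ⟨1, 0, 0, 0, 0, 0⟩], [⟨1, 0, 0, 0, 0, 1⟩, ⟨-1, 1, 0, 0, 0, 3⟩],
     [⟨-1, 1, 0, 0, 0, 2⟩, ⟨2, 1, 1, 0, 0, 0⟩], [⟨0, 1, 1, 0, 0, 2⟩, ⟨-1, 1, 1, 0, 0, 3⟩],
     [⟨1, 0, 2, 0, 0, 0⟩, ⟨-1, 0, 1, 0, 0, 1⟩], [⟨2, 1, 2, 0, 0, 1⟩, ⟨-1, 0, 2, 0, 0, 3⟩],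
     [⟨3, 0, 4, 0, 0, 0⟩, ⟨2, 1, 4, 0, 0, 2⟩], [⟨1, 0, 3, 0, 0, 0⟩, ⟨-2, 1, 2, 0, 0, 2⟩],
     [⟨1, 1, 3, 0, 0, 1⟩, ⟨-2, 0, 4, 0, 0, 3⟩], [⟨-3, 1, 4, 0, 0, 1⟩, ⟨1, 0, 3, 0, 0, 2⟩],
     [⟨-3, 0, 3, 2, 0, 3⟩, ⟨3, 0, 6, 2, 0, 0⟩], [⟨1, 1, 5, 2, 0, 0⟩, ⟨3, 0, 5, 2, 0, 2⟩],
     [⟨1, 1, 6, 2, 0, 2⟩, ⟨-1, 1, 5, 2, 0, 1⟩], [⟨-1, 0, 6, 2, 0, 1⟩, ⟨-3, 1, 6, 2, 0, 3⟩]],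
    [[⟨3, 0, 0, 0, 0, 0⟩, ⟨-1, 0, -2, 0, 0, 2⟩],
     [⟨-3, 0, -1, 0, 0, 3⟩, ⟨-3, 1, -1, 0, 0, 1⟩],
     [⟨2, 1, 1, 0, 0, 0⟩, ⟨2, 0, 1, 0, 0, 2⟩], [⟨2, 1, 0, 0, 0, 1⟩, ⟨-3, 0, 0, 0, 0, 3⟩],
     [⟨-2, 0, 1, 0, 0, 3⟩, ⟨-2, 1, 1, 0, 0, 1⟩], [⟨1, 1, 2, 0, 0, 0⟩, ⟨-2, 1, 0, 0, 0, 2⟩],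
     [⟨3, 1, 3, 0, 0, 0⟩, ⟨1, 1, 2, 0, 0, 1⟩], [⟨-2, 0, 2, 0, 0, 3⟩, ⟨0, 0, 2, 0, 0, 2⟩],
     [⟨3, 1, 4, 0, 0, 0⟩, ⟨3, 0, 4, 0, 0, 2⟩], [⟨-3, 0, 3, 0, 0, 3⟩, ⟨1, 1, 3, 0, 0, 1⟩],
     [⟨3, 1, 5, 2, 0, 0⟩, ⟨-1, 0, 3, 2, 0, 2⟩], [⟨-3, 0, 4, 2, 0, 3⟩, ⟨-3, 1, 4, 2, 0, 1⟩],
     [⟨3, 1, 6, 2, 0, 0⟩, ⟨3, 0, 6, 2, 0, 2⟩], [⟨-3, 0, 5, 2, 0, 3⟩, ⟨1, 1, 5, 2, 0, 1⟩]]] k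

/-- The distances used by `Strip.nineFour`. -/
def nineFourDist (t : ℕ) : List ℤ :=
  [[-3, -1, 0, 1, 3], [-3, -1, 0, 1, 3], [-3, -1, 0, 1, 2], [-3, -1, 0, 1, 2], [-3, -2, -1, 0, 1],
    [-2, -1, 0, 1, 2], [-1, 0, 1, 2, 3], [-2, -1, 0, 1, 3], [-2, -1, 0, 1, 3]].getD t
    [-3, -1, 0, 1, 3]

/-- Eight permutations of a strip with cycles of length six. -/
def eightSix (k : Fin 8) : ℕ → Fin 3 → StripEntry 3 := ofList <| List.get
  [[[⟨0, 1, -1, 0, 0, 1⟩, ⟨0, 2, -1, 0, 0, 2⟩, ⟨-1, 2, -1, 0, 0, 3⟩],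
     [⟨1, 0, 0, 0, 0, 0⟩, ⟨0, 0, 0, 0, 0, 5⟩, ⟨0, 1, 0, 0, 0, 4⟩],
     [⟨0, 1, 0, 1, 0, 1⟩, ⟨0, 2, 0, 1, 0, 2⟩, ⟨-1, 2, 0, 1, 0, 3⟩],
     [⟨1, 0, 1, 1, 0, 0⟩, ⟨0, 0, 1, 1, 0, 5⟩, ⟨0, 1, 1, 1, 0, 4⟩]],
    [[⟨0, 2, -1, 0, 0, 3⟩, ⟨-1, 0, -1, 0, 0, 5⟩, ⟨0, 1, -1, 0, 0, 4⟩],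
     [⟨0, 1, 0, 0, 0, 0⟩, ⟨0, 2, 0, 0, 0, 1⟩, ⟨1, 0, 0, 0, 0, 2⟩],
     [⟨0, 2, 0, 1, 0, 3⟩, ⟨-1, 0, 0, 1, 0, 5⟩, ⟨0, 1, 0, 1, 0, 4⟩],
     [⟨0, 1, 1, 1, 0, 0⟩, ⟨0, 2, 1, 1, 0, 1⟩, ⟨1, 0, 1, 1, 0, 2⟩]],
    [[⟨-1, 0, -1, 0, 0, 5⟩, ⟨-1, 1, -1, 0, 0, 2⟩, ⟨0, 0, -1, 0, 0, 4⟩],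
     [⟨0, 2, 0, 0, 0, 0⟩, ⟨1, 2, 0, 0, 0, 3⟩, ⟨1, 1, 0, 0, 0, 1⟩],
     [⟨-1, 0, 0, 1, 0, 5⟩, ⟨-1, 1, 0, 1, 0, 2⟩, ⟨0, 0, 0, 1, 0, 4⟩],
     [⟨0, 2, 1, 1, 0, 0⟩, ⟨1, 2, 1, 1, 0, 3⟩, ⟨1, 1, 1, 1, 0, 1⟩]],
    [[⟨-1, 1, -1, 0, 0, 4⟩, ⟨0, 0, -1, 0, 0, 3⟩, ⟨1, 2, 0, 0, 0, 0⟩],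
     [⟨1, 1, 0, 0, 0, 2⟩, ⟨-1, 2, 0, 0, 0, 5⟩, ⟨0, 0, 0, 0, 0, 1⟩],
     [⟨-1, 1, 0, 1, 0, 4⟩, ⟨0, 0, 0, 1, 0, 3⟩, ⟨1, 2, 1, 1, 0, 0⟩],
     [⟨1, 1, 1, 1, 0, 2⟩, ⟨-1, 2, 1, 1, 0, 5⟩, ⟨0, 0, 1, 1, 0, 1⟩]],
    [[⟨-1, 2, -1, 0, 0, 4⟩, ⟨1, 0, 0, 0, 0, 0⟩, ⟨-1, 1, -1, 0, 0, 2⟩],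
     [⟨1, 2, 0, 0, 0, 1⟩, ⟨1, 0, 0, 0, 0, 3⟩, ⟨-1, 1, 0, 0, 0, 5⟩],
     [⟨-1, 2, 0, 1, 0, 4⟩, ⟨1, 0, 1, 1, 0, 0⟩, ⟨-1, 1, 0, 1, 0, 2⟩],
     [⟨1, 2, 1, 1, 0, 1⟩, ⟨1, 0, 1, 1, 0, 3⟩, ⟨-1, 1, 1, 1, 0, 5⟩]],
    [[⟨1, 0, 0, 0, 0, 0⟩, ⟨-1, 2, -1, 0, 0, 4⟩, ⟨1, 1, 0, 0, 0, 2⟩],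
     [⟨-1, 2, 0, 0, 0, 1⟩, ⟨1, 1, 0, 0, 0, 3⟩, ⟨-1, 0, 0, 0, 0, 5⟩],
     [⟨1, 0, 1, 1, 0, 0⟩, ⟨-1, 2, 0, 1, 0, 4⟩, ⟨1, 1, 1, 1, 0, 2⟩],
     [⟨-1, 2, 1, 1, 0, 1⟩, ⟨1, 1, 1, 1, 0, 3⟩, ⟨-1, 0, 1, 1, 0, 5⟩]],
    [[⟨1, 1, 0, 0, 0, 0⟩, ⟨1, 2, 0, 0, 0, 2⟩, ⟨-1, 0, -1, 0, 0, 4⟩],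
     [⟨-1, 0, 0, 0, 0, 5⟩, ⟨-1, 1, 0, 0, 0, 1⟩, ⟨1, 2, 0, 0, 0, 3⟩],
     [⟨1, 1, 1, 1, 0, 0⟩, ⟨1, 2, 1, 1, 0, 2⟩, ⟨-1, 0, 0, 1, 0, 4⟩],
     [⟨-1, 0, 1, 1, 0, 5⟩, ⟨-1, 1, 1, 1, 0, 1⟩, ⟨1, 2, 1, 1, 0, 3⟩]],
    [[⟨1, 2, 0, 0, 0, 0⟩, ⟨1, 1, 0, 0, 0, 4⟩, ⟨1, 0, 0, 0, 0, 2⟩],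
     [⟨-1, 1, 0, 0, 0, 3⟩, ⟨-1, 0, 0, 0, 0, 5⟩, ⟨-1, 2, 0, 0, 0, 1⟩],
     [⟨1, 2, 1, 1, 0, 0⟩, ⟨1, 1, 1, 1, 0, 4⟩, ⟨1, 0, 1, 1, 0, 2⟩],
     [⟨-1, 1, 1, 1, 0, 3⟩, ⟨-1, 0, 1, 1, 0, 5⟩, ⟨-1, 2, 1, 1, 0, 1⟩]]] k

theorem consistent_nineFour : ∀ k, Consistent 10 4 (5, 2) 0 4 (nineFour k) := by
  decide +kernel

theorem indexOnto_nineFour : ∀ k, IndexOnto 10 4 (5, 2) (nineFour k) := by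
  decide +kernel

theorem covers_nineFour : Covers 10 4 nineFourDist nineFour := by
  decide +kernel

theorem map_nineFour_zero : ∀ k (v : ZMod (10 + 4 * 0) × Fin 2),
    index 10 4 0 (nineFour k) (map 10 4 0 (nineFour k) v) % 5 =
        index 10 4 0 (nineFour k) v % 5 ∧
      phase 10 4 0 (nineFour k) (map 10 4 0 (nineFour k) v) % 4 =
        (phase 10 4 0 (nineFour k) v + 1) % 4 := by
  decide +kernel

theorem hasCycleLengths_nineFour (j : ℕ) (k : Fin 9) :
    HasCycleLengths (map 10 4 j (nineFour k)) fun _ : ZMod (5 + 2 * j) => 4 := by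
  rcases Nat.eq_zero_or_pos j with rfl | hj
  · refine hasCycleLengths_of_index (M := (5, 2)) (fun v => ?_) (indexOnto_nineFour k) (by simp)
      (by simp) (by simp) (by simp) (by simp)
    obtain ⟨h1, h2⟩ := map_nineFour_zero k v
    exact ⟨(ZMod.intCast_eq_intCast_iff _ _ 5).2 h1, by
      exact_mod_cast (ZMod.natCast_eq_natCast_iff _ _ 4).2 h2⟩
  · exact (consistent_nineFour k).hasCycleLengths_of_index (M := (5, 2)) (indexOnto_nineFour k)
      (by simp) (by simp) hj (by simp) (by simp) (by simp; ring)

theorem consistent_eightSix : ∀ k, Consistent 2 2 (1, 1) 0 6 (eightSix k) := by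
  decide +kernel

theorem indexOnto_eightSix : ∀ k, IndexOnto 2 2 (1, 1) (eightSix k) := by
  decide +kernel

theorem covers_eightSix : Covers 2 2 (fun _ => [-1, 0, 1]) eightSix := by
  decide +kernel

theorem hasCycleLengths_eightSix {j : ℕ} (hj : 1 ≤ j) (k : Fin 8) :
    HasCycleLengths (map 2 2 j (eightSix k)) fun _ : ZMod (1 + 1 * j) => 6 :=
  (consistent_eightSix k).hasCycleLengths_of_index (M := (1, 1)) (indexOnto_eightSix k)
    (by simp) (by simp) hj (by simp) (by simp) (by simp; ring)

end Strip

/-- The position of the residue `v` on the zigzag path `0, 1, -1, 2, -2, …` through the residues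
modulo `2 * m + 1`. -/
def zigzagPos (m v : ℕ) : ℕ :=
  if v = 0 then 0 else if v ≤ m then 2 * v - 1 else 2 * (2 * m + 1 - v)

/-- The position of a vertex of the standard one-factorization, the point at infinity being
last. -/
def vertexPos (m : ℕ) : Option (ZMod (2 * m + 1)) → ℕ
  | none => 2 * m + 1
  | some y => zigzagPos m y.val

theorem vertexPos_lt (m : ℕ) (q : Option (ZMod (2 * m + 1))) : vertexPos m q < 2 * m + 2 := by
  rcases q with _ | y
  · simp [vertexPos]
  · have := y.val_lt
    simp only [vertexPos, zigzagPos]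
    split_ifs <;> omega

theorem vertexPos_injective (m : ℕ) : (vertexPos m).Injective := by
  rintro (_ | x) (_ | y) h
  · rfl
  · have := y.val_lt
    simp only [vertexPos, zigzagPos] at h
    split_ifs at h <;> omega
  · have := x.val_lt
    simp only [vertexPos, zigzagPos] at h
    split_ifs at h <;> omega
  · have := x.val_lt
    have := y.val_lt
    congr 1
    apply ZMod.val_injective
    simp only [vertexPos, zigzagPos] at h
    split_ifs at h <;> omega

/-- Solvability from permutations of a cyclic strip of width `L` that use all arcs between the
columns placed by `f` at pairs of equal vertices or of vertices with sum in `S`. -/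
theorem OPSolvable.of_columns {m N L : ℕ} [NeZero L] {J K : Type} [Fintype J] [Fintype K]
    [Nonempty K] {f : Option (ZMod (2 * m + 1)) → ZMod N} (hf : f.Bijective)
    (S : Finset (ZMod (2 * m + 1))) {σ : K → ZMod N × Fin L → ZMod N × Fin L}
    (hσ : ∀ k, HasCycleLengths (σ k) fun _ : J => 2 * L) (hJ : Fintype.card J = m + 1)
    (hcov : ∀ p q, (p = q ∨ ∃ c ∈ S, ∃ t b, cyclicMatching m c (t, b) = p ∧
        cyclicMatching m c (t, !b) = q) →
      ∀ x y, (p = q → x ≠ y) → ∃ k, σ k (f p, x) = (f q, y))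
    (hcard : Fintype.card K + (2 * m + 1 - S.card) * L + 1 = 2 * (m + 1) * L) :
    OPSolvable fun _ : Fin (m + 1) => 2 * L := by
  obtain ⟨φ, hφ⟩ := exists_hasCycleLengths (X := Fin L) (s := fun _ : Unit => L)
    (fun _ => NeZero.pos L) (by simp)
  let g := (Equiv.ofBijective f hf).prodCongr (Equiv.refl (Fin L))
  have e : J ≃ Σ _ : Fin (m + 1), Unit :=
    Fintype.equivOfCardEq (by simp [hJ])
  suffices h : OPSolvable fun _ : (Σ _ : Fin (m + 1), Unit) => 2 * L from
    h.reindex (Equiv.sigmaUnique _ _) fun _ => rfl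
  refine OPSolvable.of_oneFactorization (isOneFactorization_cyclicMatching m) S
    (φ := fun _ => φ) (h := fun _ _ => L) (fun _ => hφ) (fun _ _ => NeZero.pos L)
    (fun k v => g.symm (σ k (g v))) (fun k => ?_) ?_ (by simpa [ZMod.card] using hcard)
  · exact ((hσ k).conj g.symm).reindex e fun _ => rfl
  · intro p x q y hne hpq
    obtain ⟨k, hk⟩ := hcov p q hpq x y fun h1 h2 => hne (by rw [h1, h2])
    refine ⟨k, ?_⟩
    rw [Equiv.symm_apply_eq]
    exact hk

theorem bijective_natCast {m N : ℕ} (hN : N = 2 * m + 2)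
    {f : Option (ZMod (2 * m + 1)) → ℕ} (hf : f.Injective) (hlt : ∀ q, f q < N) :
    Function.Bijective fun q => (f q : ZMod N) := by
  have : NeZero N := ⟨by omega⟩
  rw [Fintype.bijective_iff_injective_and_card]
  refine ⟨fun p q h => hf ?_, by simp [ZMod.card, hN]⟩
  simpa [ZMod.val_natCast_of_lt (hlt _)] using congrArg ZMod.val h

theorem ZMod.natCast_eq_add_intCast {N P Q : ℕ} {d : ℤ}
    (h : (Q : ℤ) = P + d ∨ (Q : ℤ) + N = P + d ∨ (Q : ℤ) = P + d + N) :
    (Q : ZMod N) = P + d := by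
  have key : ((Q : ℤ) : ZMod N) = ((P + d : ℤ) : ZMod N) := by
    rw [ZMod.intCast_eq_intCast_iff_dvd_sub]
    rcases h with h | h | h
    · exact ⟨0, by linarith⟩
    · exact ⟨1, by linarith⟩
    · exact ⟨-1, by linarith⟩
  exact_mod_cast key

theorem ZMod.val_add_eq {N c : ℕ} [NeZero N] {x y : ZMod N} (h : x + y = c) (hc : c < N) :
    x.val + y.val = c ∨ x.val + y.val = c + N := by
  have h1 := ZMod.val_add x y
  rw [h, ZMod.val_natCast_of_lt hc] at h1
  have h2 := Nat.mod_add_div (x.val + y.val) N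
  have h3 : (x.val + y.val) / N < 2 :=
    Nat.div_lt_of_lt_mul (by linarith [x.val_lt, y.val_lt])
  interval_cases h4 : (x.val + y.val) / N <;> omega

/-- The positions of two vertices joined in the matching of index `l`, in terms of residues with
sum `l`. -/
theorem vertexPos_partner {m l : ℕ} (hl : l < 2 * m + 1) {p q : Option (ZMod (2 * m + 1))}
    (h : ∃ t b, cyclicMatching m l (t, b) = p ∧ cyclicMatching m l (t, !b) = q) :
    ∃ u v, u < 2 * m + 1 ∧ v < 2 * m + 1 ∧ (u + v = l ∨ u + v = l + (2 * m + 1)) ∧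
      ((u ≠ v ∧ vertexPos m p = zigzagPos m u ∧ vertexPos m q = zigzagPos m v) ∨
        u = v ∧ ((vertexPos m p = 2 * m + 1 ∧ vertexPos m q = zigzagPos m u) ∨
          (vertexPos m q = 2 * m + 1 ∧ vertexPos m p = zigzagPos m u))) := by
  obtain ⟨t, b, h1, h2⟩ := h
  have hh := ZMod.val_add_eq (half_add_half m l) hl
  rcases cyclicMatching_partner h1 h2 with ⟨rfl, rfl⟩ | ⟨rfl, rfl⟩ | ⟨x, y, rfl, rfl, hxy⟩
  · exact ⟨_, _, ZMod.val_lt _, ZMod.val_lt _, hh, Or.inr ⟨rfl, Or.inl ⟨rfl, rfl⟩⟩⟩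
  · exact ⟨_, _, ZMod.val_lt _, ZMod.val_lt _, hh, Or.inr ⟨rfl, Or.inr ⟨rfl, rfl⟩⟩⟩
  · refine ⟨_, _, x.val_lt, y.val_lt, ZMod.val_add_eq hxy hl, Or.inl ⟨fun hv => ?_, rfl, rfl⟩⟩
    rw [ZMod.val_injective _ hv, ← h2] at h1
    simpa using (cyclicMatching m l).injective h1

/-- Vertices joined in the matchings of index `0` and `1` have cyclically adjacent positions. -/
theorem vertexPos_adjacent {m l : ℕ} (hm : 1 ≤ m) (hl : l < 2) {p q : Option (ZMod (2 * m + 1))}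
    (h : ∃ t b, cyclicMatching m l (t, b) = p ∧ cyclicMatching m l (t, !b) = q) :
    (vertexPos m q = vertexPos m p + 1 ∨ vertexPos m p = vertexPos m q + 1) ∨
      (vertexPos m p = 0 ∧ vertexPos m q = 2 * m + 1) ∨
      (vertexPos m q = 0 ∧ vertexPos m p = 2 * m + 1) := by
  obtain ⟨u, v, hu, hv, huv, h1⟩ := vertexPos_partner (by omega) h
  clear h
  simp only [zigzagPos] at h1
  interval_cases l <;> split_ifs at h1 <;> omega

theorem opSolvable_six {j : ℕ} (hj : 1 ≤ j) : OPSolvable fun _ : Fin (j + 1) => 6 := by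
  have h01 : (0 : ZMod (2 * j + 1)) ≠ 1 := by
    have : Fact (1 < 2 * j + 1) := ⟨by omega⟩
    exact zero_ne_one
  refine OPSolvable.of_columns (L := 3) (N := 2 + 2 * j) (f := fun q => vertexPos j q)
    (bijective_natCast (by omega) (vertexPos_injective j)
      fun q => by have := vertexPos_lt j q; omega) {0, 1}
    (Strip.hasCycleLengths_eightSix hj) (by simp [ZMod.card]; omega) ?_
    (by simp [Finset.card_pair h01]; omega)
  intro p q hpq x y hxy
  have hp := vertexPos_lt j p
  have hq := vertexPos_lt j q
  obtain ⟨d, hd, h⟩ : ∃ d : ℤ, d ∈ [-1, 0, 1] ∧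
      ((vertexPos j q : ℤ) = vertexPos j p + d ∨
        (vertexPos j q : ℤ) + (2 + 2 * j : ℕ) = vertexPos j p + d ∨
        (vertexPos j q : ℤ) = vertexPos j p + d + (2 + 2 * j : ℕ)) := by
    rcases hpq with rfl | ⟨c, hc, h⟩
    · exact ⟨0, by simp, Or.inl (by simp)⟩
    · obtain ⟨l, hl, rfl⟩ : ∃ l : ℕ, l < 2 ∧ c = l := by
        rcases Finset.mem_insert.1 hc with rfl | hc
        · exact ⟨0, by simp⟩
        · exact ⟨1, by simpa using hc⟩
      rcases vertexPos_adjacent hj hl h with (h | h) | h | h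
      · exact ⟨1, by simp, by omega⟩
      · exact ⟨-1, by simp, by omega⟩
      · exact ⟨-1, by simp, by omega⟩
      · exact ⟨1, by simp, by omega⟩
  obtain ⟨k, hk⟩ := Strip.covers_eightSix.exists_map (j := j) (by simp)
    (x := (vertexPos j p : ZMod (2 + 2 * j))) hd (e := x) (f := y) fun h0 => hxy (by
      apply vertexPos_injective j
      omega)
  exact ⟨k, by rw [hk, ZMod.natCast_eq_add_intCast h]⟩

/-- The pairs of positions `P < Q` joined in the matchings of index `0`, `1`, `2` and `-1`. -/
def IsNear (m P Q : ℕ) : Prop :=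
  Q = P + 1 ∨ (P = 0 ∧ Q = 2 * m + 1) ∨ (P = 1 ∧ Q = 2 * m + 1) ∨ (P = 0 ∧ Q = 2) ∨
    (P + 4 = 2 * m + 2 ∧ Q = P + 2) ∨ (P + 3 = 2 * m + 2 ∧ Q = P + 2) ∨
    (Q = P + 3 ∧ P + 5 ≤ 2 * m + 2)

theorem isNear_zigzagPos {m l u v : ℕ} (hm : 2 ≤ m) (hl : l < 3 ∨ l = 2 * m)
    (hu : u < 2 * m + 1) (hv : v < 2 * m + 1) (huv : u + v = l ∨ u + v = l + (2 * m + 1))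
    (hne : u ≠ v) (hle : zigzagPos m u ≤ zigzagPos m v) :
    IsNear m (zigzagPos m u) (zigzagPos m v) := by
  unfold zigzagPos at *
  unfold IsNear
  obtain h1 | h1 | h1 | h1 : l = 0 ∨ l = 1 ∨ l = 2 ∨ l = 2 * m := by omega
  all_goals
    subst h1
    clear hl
    rcases huv with huv | huv <;> split_ifs at hle ⊢ <;> first
    | exact absurd hle (by omega)
    | exact absurd huv (by omega)
    | exact Or.inl (by omega)
    | exact Or.inr <| Or.inr <| Or.inr <| Or.inl (by omega)
    | exact Or.inr <| Or.inr <| Or.inr <| Or.inr <| Or.inl (by omega)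
    | exact Or.inr <| Or.inr <| Or.inr <| Or.inr <| Or.inr <| Or.inr (by omega)

theorem isNear_zigzagPos_last {m l u : ℕ} (hl : l < 3 ∨ l = 2 * m) (hu : u < 2 * m + 1)
    (huu : u + u = l ∨ u + u = l + (2 * m + 1)) :
    IsNear m (zigzagPos m u) (2 * m + 1) := by
  unfold zigzagPos IsNear
  split_ifs <;> omega

/-- The differences of the positions of vertices joined in the matchings of index `0`, `1`, `2`
and `-1`. -/
theorem vertexPos_near {m l : ℕ} (hm : 2 ≤ m) (hl : l < 3 ∨ l = 2 * m)
    {p q : Option (ZMod (2 * m + 1))}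
    (h : ∃ t b, cyclicMatching m l (t, b) = p ∧ cyclicMatching m l (t, !b) = q) :
    ∃ P Q, (P = vertexPos m p ∧ Q = vertexPos m q ∨ P = vertexPos m q ∧ Q = vertexPos m p) ∧
      IsNear m P Q := by
  obtain ⟨u, v, hu, hv, huv, h1⟩ := vertexPos_partner (by omega) h
  clear h
  rcases h1 with ⟨hne, h2, h3⟩ | ⟨hne, ⟨h2, h3⟩ | ⟨h2, h3⟩⟩
  · rcases le_total (vertexPos m p) (vertexPos m q) with hle | hle
    · exact ⟨_, _, Or.inl ⟨rfl, rfl⟩, by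
        rw [h2, h3] at hle ⊢; exact isNear_zigzagPos hm hl hu hv huv hne hle⟩
    · exact ⟨_, _, Or.inr ⟨rfl, rfl⟩, by
        rw [h2, h3] at hle ⊢
        exact isNear_zigzagPos hm hl hv hu (by rwa [add_comm]) hne.symm hle⟩
  · exact ⟨_, _, Or.inr ⟨rfl, rfl⟩, by
      rw [h2, h3]; exact isNear_zigzagPos_last hl hu (by rwa [← hne] at huv)⟩
  · exact ⟨_, _, Or.inl ⟨rfl, rfl⟩, by
      rw [h2, h3]; exact isNear_zigzagPos_last hl hu (by rwa [← hne] at huv)⟩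

/-- Shifting positions cyclically by six. -/
def shiftSix (N P : ℕ) : ℕ := if P + 6 < N then P + 6 else P + 6 - N

theorem shiftSix_lt {N P : ℕ} (hN : 6 ≤ N) (hP : P < N) : shiftSix N P < N := by
  unfold shiftSix
  split_ifs <;> omega

/-- The differences to the position `P` that occur in the strip `Strip.nineFour`. -/
def IsNearDiff (N P : ℕ) (d : ℤ) : Prop :=
  d = -1 ∨ d = 0 ∨ d = 1 ∨ (d = -3 ∧ 3 ≤ P ∧ P + 2 ≤ N) ∨ (d = 3 ∧ P + 5 ≤ N) ∨
    (d = 2 ∧ (P = 0 ∨ P + 1 = N ∨ P + 3 = N ∨ P + 4 = N)) ∨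
    (d = -2 ∧ (P = 1 ∨ P = 2 ∨ P + 1 = N ∨ P + 2 = N))

theorem IsNearDiff.mem_nineFourDist {N P : ℕ} {d : ℤ} (hN : 10 ≤ N) (hP : P < N)
    (h : IsNearDiff N P d) :
    d ∈ Strip.nineFourDist (Strip.colType 10 4 (shiftSix N P)) := by
  have h9 : 9 ≤ shiftSix N P ∨ ∃ t < 9, shiftSix N P = t := by
    rcases le_or_gt 9 (shiftSix N P) with h | h
    · exact Or.inl h
    · exact Or.inr ⟨_, h, rfl⟩
  rcases h9 with h9 | ⟨t, ht, h9⟩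
  · have h10 : Strip.nineFourDist (Strip.colType 10 4 (shiftSix N P)) = [-3, -1, 0, 1, 3] := by
      have : 9 ≤ Strip.colType 10 4 (shiftSix N P) := by
        unfold Strip.colType
        split_ifs <;> omega
      rw [Strip.nineFourDist, List.getD_eq_default _ _ (by simpa using this)]
    have hP3 : 3 ≤ P ∧ P + 7 ≤ N := by
      unfold shiftSix at h9
      split_ifs at h9 <;> omega
    rw [h10]
    simp only [List.mem_cons, List.not_mem_nil, or_false]
    unfold IsNearDiff at h
    omega
  · have hP' : P + 6 = t + N ∨ P + 6 = t := by
      unfold shiftSix at h9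
      split_ifs at h9 <;> omega
    rw [h9, Strip.colType, if_pos (by omega)]
    unfold IsNearDiff at h
    interval_cases t <;>
      simp only [Strip.nineFourDist, List.getD_cons_zero, List.getD_cons_succ, List.mem_cons,
        List.not_mem_nil, or_false] <;> omega

/-- The differences between near positions. -/
theorem IsNear.exists_diff {m P Q : ℕ} (hm : 4 ≤ m) (hP : P < 2 * m + 2) (hQ : Q < 2 * m + 2)
    (h : IsNear m P Q) :
    ∃ d : ℤ, IsNearDiff (2 * m + 2) P d ∧ IsNearDiff (2 * m + 2) Q (-d) ∧
      ((Q : ℤ) = P + d ∨ (Q : ℤ) + (2 * m + 2) = P + d ∨ (Q : ℤ) = P + d + (2 * m + 2)) := by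
  unfold IsNearDiff
  rcases h with h | h | h | h | h | h | h
  · exact ⟨1, by omega, by omega, by omega⟩
  · exact ⟨-1, by omega, by omega, by omega⟩
  · exact ⟨-2, by omega, by omega, by omega⟩
  · exact ⟨2, by omega, by omega, by omega⟩
  · exact ⟨2, by omega, by omega, by omega⟩
  · exact ⟨2, by omega, by omega, by omega⟩
  · exact ⟨3, by omega, by omega, by omega⟩

theorem opSolvable_four_of_odd (j : ℕ) : OPSolvable fun _ : Fin (4 + 2 * j + 1) => 4 := by
  obtain ⟨m, hm⟩ : ∃ m, m = 4 + 2 * j := ⟨_, rfl⟩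
  rw [← hm]
  have hinj : (fun q => shiftSix (10 + 4 * j) (vertexPos m q)).Injective := fun p q h =>
    vertexPos_injective m (by
      have := vertexPos_lt m p
      have := vertexPos_lt m q
      simp only [shiftSix] at h
      split_ifs at h <;> omega)
  have hlt : ∀ q, shiftSix (10 + 4 * j) (vertexPos m q) < 10 + 4 * j := fun q =>
    shiftSix_lt (by omega) (by have := vertexPos_lt m q; omega)
  refine OPSolvable.of_columns (L := 2) (bijective_natCast (by omega) hinj hlt)
    (({0, 1, 2, 2 * m} : Finset ℕ).image Nat.cast)
    (Strip.hasCycleLengths_nineFour j) (by simp [ZMod.card]; omega) ?_ ?_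
  · intro p q hpq x y hxy
    have hp := vertexPos_lt m p
    have hq := vertexPos_lt m q
    obtain ⟨d, hd, h⟩ : ∃ d : ℤ, IsNearDiff (2 * m + 2) (vertexPos m p) d ∧
        ((vertexPos m q : ℤ) = vertexPos m p + d ∨
          (vertexPos m q : ℤ) + (2 * m + 2) = vertexPos m p + d ∨
          (vertexPos m q : ℤ) = vertexPos m p + d + (2 * m + 2)) := by
      rcases hpq with rfl | ⟨c, hc, h⟩
      · exact ⟨0, Or.inr (Or.inl rfl), Or.inl (by simp)⟩
      · obtain ⟨l, hl, rfl⟩ := Finset.mem_image.1 hc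
        obtain ⟨P, Q, hPQ, h⟩ := vertexPos_near (by omega) (by simp at hl; omega) h
        obtain ⟨d, h1, h2, h3⟩ := h.exists_diff (by omega) (by omega) (by omega)
        rcases hPQ with ⟨rfl, rfl⟩ | ⟨rfl, rfl⟩
        · exact ⟨d, h1, h3⟩
        · exact ⟨-d, h2, by omega⟩
    have hN : 2 * m + 2 = 10 + 4 * j := by omega
    obtain ⟨k, hk⟩ := Strip.covers_nineFour.exists_map (j := j) (by simp)
      (x := (shiftSix (10 + 4 * j) (vertexPos m p) : ZMod (10 + 4 * j))) (d := d) (by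
        rw [ZMod.val_natCast_of_lt (hlt p)]
        rw [hN] at hd
        exact hd.mem_nineFourDist (by omega) (by omega))
      (e := x) (f := y) fun h0 => hxy (by
        apply vertexPos_injective m
        omega)
    have hd3 : -3 ≤ d ∧ d ≤ 3 := by
      unfold IsNearDiff at hd
      omega
    refine ⟨k, ?_⟩
    rw [hk, ← ZMod.natCast_eq_add_intCast (Q := shiftSix (10 + 4 * j) (vertexPos m q))]
    simp only [shiftSix]
    split_ifs <;> omega
  · rw [Finset.card_image_of_injOn]
    · rw [Finset.card_insert_of_notMem (by simp; omega), Finset.card_insert_of_notMem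
        (by simp; omega), Finset.card_pair (by omega), Fintype.card_fin]
      omega
    · intro u hu v hv h
      simp only [Finset.coe_insert, Finset.coe_singleton, Set.mem_insert_iff,
        Set.mem_singleton_iff] at hu hv
      simpa [ZMod.val_natCast_of_lt (show u < 2 * m + 1 by omega),
        ZMod.val_natCast_of_lt (show v < 2 * m + 1 by omega)] using congrArg ZMod.val h

theorem pairedHamiltonian_two_mul {k : ℕ} (hk : 5 ≤ k) : PairedHamiltonian (2 * k) := by
  induction k using Nat.strong_induction_on with
  | _ k ih =>
    by_cases h5 : k = 5
    · exact h5 ▸ pairedHamiltonian_ten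
    by_cases h6 : k = 6
    · exact h6 ▸ pairedHamiltonian_twelve
    by_cases h8 : k = 8
    · exact h8 ▸ pairedHamiltonian_sixteen
    rcases k.even_or_odd' with ⟨l, rfl | rfl⟩
    · exact (ih l (by omega) (by omega)).double (by omega) (even_two_mul l)
    · exact pairedHamiltonian_two_mul_odd (by omega) (odd_two_mul_add_one l)

namespace OPSolvable

theorem of_const {J J' : Type} [Fintype J] [Fintype J'] {s : ℕ} (h : OPSolvable fun _ : J => s)
    (hJ : Fintype.card J = Fintype.card J') : OPSolvable fun _ : J' => s :=
  h.reindex (Fintype.equivOfCardEq hJ) fun _ => rfl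

theorem single {s : ℕ} (hs : Even s) (h : s = 2 ∨ 8 ≤ s) : OPSolvable fun _ : Unit => s := by
  obtain ⟨k, rfl⟩ := hs
  rcases h with h | h
  · exact h ▸ opSolvable_two.of_const rfl
  · by_cases h8 : k + k = 8
    · exact h8 ▸ opSolvable_eight.of_const rfl
    · rw [← two_mul]
      exact (pairedHamiltonian_two_mul (by omega)).opSolvable

/-- Blowing up a solution with constant cycle lengths. -/
theorem replicate {J : Type} [Fintype J] [Nonempty J] {s : ℕ} (h : OPSolvable fun _ : J => 2 * s)
    (hs : 0 < s) (m : ℕ) {J' : Type} [Fintype J']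
    (hJ' : Fintype.card J' = (m + 1) * Fintype.card J) : OPSolvable fun _ : J' => 2 * s :=
  (OPSolvable.sigma (m := m) (L := Fintype.card J * s) (J := fun _ => J) (h := fun _ _ => s)
    (by positivity) (fun _ _ => hs) (by simp) fun _ => h).of_const (by simp [hJ'])

theorem const {s a : ℕ} (hs : Even s) (hs0 : 0 < s) (ha : 0 < a) (h4 : a * s ≠ 4)
    (h6 : a * s ≠ 6) : OPSolvable fun _ : Fin a => s := by
  obtain ⟨m, rfl⟩ := Nat.exists_eq_succ_of_ne_zero ha.ne'
  by_cases hs4 : s = 4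
  · subst hs4
    rcases (m + 1).even_or_odd' with ⟨b, hb | hb⟩
    · obtain ⟨c, rfl⟩ := Nat.exists_eq_succ_of_ne_zero (show b ≠ 0 by omega)
      exact opSolvable_four_four.replicate (s := 2) two_pos c (by simp; omega)
    · by_cases hb1 : b = 1
      · exact opSolvable_four_four_four.of_const (by simp; omega)
      · obtain ⟨c, rfl⟩ := Nat.exists_eq_add_of_le (show 2 ≤ b by omega)
        exact (opSolvable_four_of_odd c).of_const (by simp; omega)
  by_cases hs6 : s = 6
  · subst hs6
    exact (opSolvable_six (j := m) (by omega)).of_const rfl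
  obtain ⟨k, hk⟩ := hs.two_dvd
  subst hk
  exact (single hs (by omega)).replicate (by omega) m (by simp)

end OPSolvable

/-- The directed Oberwolfach problem with cycle lengths `M` is solvable. -/
def CycleTypeSolvable (M : Multiset ℕ) : Prop :=
  ∃ (J : Type) (_ : Fintype J) (s : J → ℕ), ∑ j, {s j} = M ∧ OPSolvable s

theorem OPSolvable.cycleTypeSolvable {J : Type} [Fintype J] {s : J → ℕ} (h : OPSolvable s) :
    CycleTypeSolvable (∑ j, {s j}) :=
  ⟨J, _, s, rfl, h⟩

namespace CycleTypeSolvable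

theorem replicate {s a : ℕ} (hs : Even s) (hs0 : 0 < s) (ha : 0 < a) (h4 : a * s ≠ 4)
    (h6 : a * s ≠ 6) : CycleTypeSolvable (Multiset.replicate a s) := by
  simpa [Multiset.nsmul_singleton] using
    (OPSolvable.const hs hs0 ha h4 h6).cycleTypeSolvable

theorem sum {m L : ℕ} (hL : 0 < L) {M : Fin (m + 1) → Multiset ℕ}
    (hop : ∀ t, CycleTypeSolvable (M t)) (hM : ∀ t, ∀ x ∈ M t, Even x ∧ 0 < x)
    (hsum : ∀ t, (M t).sum = 2 * L) : CycleTypeSolvable (∑ t, M t) := by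
  choose J hJ s hs hop using hop
  have hmem : ∀ t j, s t j ∈ M t := fun t j => by
    rw [← hs, Multiset.mem_sum]
    exact ⟨j, Finset.mem_univ _, Multiset.mem_singleton_self _⟩
  choose h hh using fun t j => (hM t _ (hmem t j)).1.two_dvd
  have hs' : ∀ t, s t = fun j => 2 * h t j := fun t => funext (hh t)
  have hsum' : ∀ t, ∑ j, h t j = L := fun t => by
    have h1 : (M t).sum = ∑ j, s t j := by
      rw [← hs, ← Multiset.coe_sumAddMonoidHom, map_sum]
      simp
    rw [hsum, hs', ← Finset.mul_sum] at h1
    omega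
  refine ⟨_, inferInstance, _, ?_,
    OPSolvable.sigma hL (h := h) (fun t j => ?_) hsum' fun t => hs' t ▸ hop t⟩
  · rw [Fintype.sum_sigma]
    exact Finset.sum_congr rfl fun t _ => by rw [← hs t, hs' t]
  · have := (hM t _ (hmem t j)).2
    have := hh t j
    omega

theorem hasOPSolution {m : List ℕ} (h : CycleTypeSolvable (m : Multiset ℕ))
    (hm : ∀ x ∈ m, 2 ≤ x) (hpos : 0 < m.sum) : HasOPSolution m := by
  obtain ⟨J, _, s, hs, h⟩ := h
  have hs' : (m : Multiset ℕ) = Finset.univ.val.map s := by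
    rw [← hs, Finset.sum_eq_multiset_sum, ← Multiset.sum_map_singleton (Finset.univ.val.map s),
      Multiset.map_map, Function.comp_def]
  refine h.hasOPSolution (fun j => hm _ ?_) m hs' hpos
  rw [← Multiset.mem_coe, hs']
  exact Multiset.mem_map_of_mem s (Finset.mem_univ_val j)

/-- Two constant cycle types of order four or six. -/
theorem replicate_add_replicate {s t a b N : ℕ} (hs : Even s) (ht : Even t) (hN : N = 4 ∨ N = 6)
    (hsa : a * s = N) (htb : b * t = N) :
    CycleTypeSolvable (Multiset.replicate a s + Multiset.replicate b t) := by
  have h422 := opSolvable_four_two_two.cycleTypeSolvable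
  have h6222 := opSolvable_six_two_two_two.cycleTypeSolvable
  have h44 := replicate (s := 4) (a := 2) (by decide) (by simp) (by simp) (by simp) (by simp)
  have h66 := replicate (s := 6) (a := 2) (by decide) (by simp) (by simp) (by simp) (by simp)
  have h24 := replicate (s := 2) (a := 4) (by decide) (by simp) (by simp) (by simp) (by simp)
  have h26 := replicate (s := 2) (a := 6) (by decide) (by simp) (by simp) (by simp) (by simp)
  have key : ∀ {s a N : ℕ}, Even s → N = 4 ∨ N = 6 → a * s = N →
      (s = 2 ∧ 2 * a = N) ∨ (s = N ∧ a = 1) := by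
    intro s a N hs hN h
    have hdvd : s ∣ N := ⟨a, by rw [← h, mul_comm]⟩
    have hle := Nat.le_of_dvd (by omega) hdvd
    obtain ⟨k, rfl⟩ := hs
    have : k ≤ 3 := by omega
    interval_cases k <;> omega
  simp only [Fin.sum_univ_succ, Finset.univ_eq_empty, Finset.sum_empty] at h422 h6222
  obtain ⟨rfl, h1⟩ | ⟨rfl, rfl⟩ := key hs hN hsa <;> obtain ⟨rfl, h2⟩ | ⟨rfl, rfl⟩ := key ht hN htb
  · obtain rfl : a = b := by omega
    rw [← Multiset.replicate_add]
    obtain rfl | rfl : a = 2 ∨ a = 3 := by omega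
    exacts [h24, h26]
  · obtain ⟨rfl, rfl⟩ | ⟨rfl, rfl⟩ : (a = 2 ∧ t = 4) ∨ (a = 3 ∧ t = 6) := by omega
    · convert h422 using 1; decide
    · convert h6222 using 1; decide
  · obtain ⟨rfl, rfl⟩ | ⟨rfl, rfl⟩ : (b = 2 ∧ s = 4) ∨ (b = 3 ∧ s = 6) := by omega
    · convert h422 using 1; decide
    · convert h6222 using 1; decide
  · rw [← Multiset.replicate_add]
    obtain rfl | rfl := hN
    exacts [h44, h66]

theorem sum_replicate {n N : ℕ} (hn : Even n) (hn0 : 0 < n) {a s : Fin n → ℕ} (ha : ∀ i, 0 < a i)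
    (hs : ∀ i, 0 < s i) (hse : ∀ i, Even (s i)) (h : ∀ i, a i * s i = N) :
    CycleTypeSolvable (∑ i, Multiset.replicate (a i) (s i)) := by
  have hN : Even N := h ⟨0, hn0⟩ ▸ (hse _).mul_left _
  have hN0 : 0 < N := h ⟨0, hn0⟩ ▸ Nat.mul_pos (ha _) (hs _)
  obtain ⟨L, rfl⟩ := hN.two_dvd
  by_cases hL : 2 * L = 4 ∨ 2 * L = 6
  · obtain ⟨k, rfl⟩ := hn.two_dvd
    obtain ⟨c, rfl⟩ := Nat.exists_eq_succ_of_ne_zero (show k ≠ 0 by omega)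
    rw [← ((finProdFinEquiv (m := c + 1) (n := 2)).trans (finCongr (mul_comm _ _))).sum_comp,
      Fintype.sum_prod_type]
    simp only [Fin.sum_univ_two]
    refine sum (L := 2 * L) (by omega)
      (fun t => replicate_add_replicate (hse _) (hse _) hL (h _) (h _)) (fun t x hx => ?_)
      fun t => by simp [h]; omega
    rcases Multiset.mem_add.1 hx with hx | hx <;> rw [Multiset.eq_of_mem_replicate hx]
    exacts [⟨hse _, hs _⟩, ⟨hse _, hs _⟩]
  · obtain ⟨m, rfl⟩ := Nat.exists_eq_succ_of_ne_zero hn0.ne'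
    refine sum (L := L) (by omega)
      (fun t => replicate (hse t) (hs t) (ha t) (by rw [h]; omega) (by rw [h]; omega))
      (fun t x hx => ?_) fun t => by simp [h]
    rw [Multiset.eq_of_mem_replicate hx]
    exact ⟨hse t, hs t⟩

end CycleTypeSolvable

/-- Corollary: let ℓ = 2^a with a ≥ 1, and for each i = 1,…,ℓ let aᵢ, sᵢ be positive
integers with sᵢ even. If aᵢ·sᵢ = aⱼ·sⱼ for all i, j, then
OP*(s₁^⟨a₁⟩, …, s_ℓ^⟨a_ℓ⟩) has a solution. -/
theorem stmt10 (a : ℕ) (ha : 0 < a) (as ss : Fin (2 ^ a) → ℕ)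
    (hapos : ∀ i, 0 < as i) (hspos : ∀ i, 0 < ss i) (hse : ∀ i, Even (ss i))
    (h : ∀ i j, as i * ss i = as j * ss j) :
    HasOPSolution (List.flatten (List.ofFn fun i => List.replicate (as i) (ss i))) := by
  have hpow : 0 < 2 ^ a := by positivity
  have hcoe : ((List.ofFn fun i => List.replicate (as i) (ss i)).flatten : Multiset ℕ) =
      ∑ i, Multiset.replicate (as i) (ss i) := by
    rw [← Multiset.coe_join, Multiset.join, Multiset.sum_coe, List.map_ofFn, List.sum_ofFn]
    rfl
  have hmem : ∀ x ∈ (List.ofFn fun i => List.replicate (as i) (ss i)).flatten,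
      ∃ i, x = ss i := by
    intro x hx
    obtain ⟨l, hl, hx⟩ := List.mem_flatten.1 hx
    obtain ⟨i, rfl⟩ := (List.mem_ofFn' _ _).1 hl
    exact ⟨i, List.eq_of_mem_replicate hx⟩
  refine CycleTypeSolvable.hasOPSolution ?_ (fun x hx => ?_) ?_
  · rw [hcoe]
    exact CycleTypeSolvable.sum_replicate (even_two.pow_of_ne_zero ha.ne') hpow hapos hspos hse
      fun i => h i ⟨0, hpow⟩
  · obtain ⟨i, rfl⟩ := hmem x hx
    obtain ⟨k, hk⟩ := hse i
    have := hspos i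
    omega
  · rw [← Multiset.sum_coe, hcoe, ← Multiset.coe_sumAddMonoidHom, map_sum]
    refine Finset.sum_pos (fun i _ => ?_) ⟨⟨0, hpow⟩, Finset.mem_univ _⟩
    simpa using ⟨hapos i, hspos i⟩
end

section
/- Let 1 ≤ ℓ < k and let m_1, …, m_k be integers with each m_i ≥ 2; set s = m_1 + … + m_ℓ and t = m_{ℓ+1} + … + m_k, and assume s < t. Suppose: (1) OP*(m_1, …, m_ℓ) has a solution; and (2) there exist a set S of nonzero residues modulo t and non-negative integers s_1, …, s_k, t_1, …, t_k such that (a) Circ(t; (Z_t \ {0}) \ S) admits a (C_{m_{ℓ+1}}, …, C_{m_k})-factorization, (b) s_1 + … + s_k = s, (c) m_i = 2s_i + t_i for each i = 1, …, k, and (d) Circ(t; S) admits an S-orthogonal (D_1, …, D_k)-subdigraph, i.e., pairwise vertex-disjoint subdigraphs D_1, …, D_k jointly containing exactly one arc of each difference in S, where D_i is a directed path with exactly t_i arcs if t_i < m_i (a single vertex when t_i = 0) and a directed cycle of length m_i if t_i = m_i. Then OP*(m_1, …, m_k) has a solution. -/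
/-- A (C_{m₁}, …, C_{m_k})-factorization of the directed circulant Circ(t; D):
a family of |D| permutations of Z_t, each with cycle type the multiset {m₁,…,m_k},
such that σ(i) − i ∈ D always, and for each vertex i and each difference d ∈ D there
is exactly one member σ with σ(i) = i + d. -/
def CirculantFactorization (t : ℕ) [NeZero t] (D : Finset (ZMod t)) (m : List ℕ) : Prop :=
  ∃ σ : Fin D.card → Equiv.Perm (ZMod t),
    (∀ j, (σ j).cycleType = (m : Multiset ℕ)) ∧
    (∀ j i, σ j i - i ∈ D) ∧
    (∀ i : ZMod t, ∀ d ∈ D, ∃! j, σ j i = i + d)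

/-- The arcs of the directed path visiting the entries of `l` in order. -/
def pathArcs {α : Type*} (l : List α) : List (α × α) := l.zip l.tail

/-- The arcs of the directed cycle visiting the entries of `l` in cyclic order. -/
def cycleArcs {α : Type*} (l : List α) : List (α × α) := l.zip (l.rotate 1)

theorem Equiv.Perm.cycleType_permCongr {α β : Type*} [Fintype α] [DecidableEq α] [Fintype β]
    [DecidableEq β] (e : α ≃ β) (g : Equiv.Perm α) :
    (e.permCongr g).cycleType = g.cycleType := by
  have h : e.permCongr g =
      g.extendDomain (p := fun _ : β => True)
        (e.trans (Equiv.subtypeUnivEquiv fun _ => trivial).symm) := by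
    ext x
    rw [Equiv.Perm.extendDomain_apply_subtype _ _ trivial]
    rfl
  rw [h, Equiv.Perm.cycleType_extendDomain]

theorem Equiv.Perm.cycleType_sumCongr {α β : Type*} [Fintype α] [DecidableEq α] [Fintype β]
    [DecidableEq β] (f : Equiv.Perm α) (g : Equiv.Perm β) :
    (Equiv.Perm.sumCongr f g).cycleType = f.cycleType + g.cycleType := by
  classical
  have hf : Equiv.Perm.sumCongr f (1 : Equiv.Perm β) =
      f.extendDomain (Equiv.ofInjective _ Sum.inl_injective) := by
    ext x
    rcases x with x | x
    · exact (Equiv.Perm.extendDomain_apply_image f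
        (Equiv.ofInjective (Sum.inl : α → α ⊕ β) Sum.inl_injective) x).symm
    · rw [Equiv.Perm.extendDomain_apply_not_subtype _ _ (by simp)]
      simp
  have hg : Equiv.Perm.sumCongr (1 : Equiv.Perm α) g =
      g.extendDomain (Equiv.ofInjective _ Sum.inr_injective) := by
    ext x
    rcases x with x | x
    · rw [Equiv.Perm.extendDomain_apply_not_subtype _ _ (by simp)]
      simp
    · exact (Equiv.Perm.extendDomain_apply_image g
        (Equiv.ofInjective (Sum.inr : β → α ⊕ β) Sum.inr_injective) x).symm
  have hmul : Equiv.Perm.sumCongr f g =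
      Equiv.Perm.sumCongr f 1 * Equiv.Perm.sumCongr 1 g := by
    rw [Equiv.Perm.sumCongr_mul, mul_one, one_mul]
  have hdisj : (Equiv.Perm.sumCongr f (1 : Equiv.Perm β)).Disjoint
      (Equiv.Perm.sumCongr (1 : Equiv.Perm α) g) := by
    rintro (x | x)
    · right; simp
    · left; simp
  rw [hmul, hdisj.cycleType_mul, hf, hg, Equiv.Perm.cycleType_extendDomain,
    Equiv.Perm.cycleType_extendDomain]

theorem HasOPSolution.of_fintype {m : List ℕ} {V I : Type*} [Fintype V] [DecidableEq V]
    [Fintype I] (hV : Fintype.card V = m.sum) (hI : Fintype.card I = m.sum - 1)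
    (σ : I → Equiv.Perm V) (hc : ∀ i, (σ i).cycleType = (m : Multiset ℕ))
    (hu : ∀ x y, x ≠ y → ∃! i, σ i x = y) : HasOPSolution m := by
  let e : V ≃ Fin m.sum := Fintype.equivFinOfCardEq hV
  let f : I ≃ Fin (m.sum - 1) := Fintype.equivFinOfCardEq hI
  refine ⟨fun i => e.permCongr (σ (f.symm i)), fun i => ?_, fun x y hxy => ?_⟩
  · rw [Equiv.Perm.cycleType_permCongr, hc]
  · obtain ⟨i, hi, hi'⟩ := hu (e.symm x) (e.symm y) (e.symm.injective.ne hxy)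
    refine ⟨f i, by simp [hi], fun j hj => ?_⟩
    rw [← hi' (f.symm j) (by simp [← hj]), f.apply_symm_apply]

/-- The cyclic permutation of each fibre of `Σ i, Fin (m i)`, transported along `φ`. -/
theorem exists_perm_cycleType_eq_ofFn {k : ℕ} (m : Fin k → ℕ) (h2 : ∀ i, 2 ≤ m i) {V : Type*}
    [Fintype V] [DecidableEq V] (φ : (Σ i, Fin (m i)) ≃ V) :
    ∃ F : Equiv.Perm V, F.cycleType = (List.ofFn m : Multiset ℕ) ∧
      ∀ i (p q : Fin (m i)), (q : ℕ) = (p + 1) % m i → F (φ ⟨i, p⟩) = φ ⟨i, q⟩ := by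
  let L : Fin k → List V := fun i => List.ofFn fun p => φ ⟨i, p⟩
  have hlen : ∀ i, (L i).length = m i := fun i => by simp [L]
  have hnd : ∀ i, (L i).Nodup := fun i => by
    rw [List.nodup_ofFn]
    intro p q hpq
    simpa using φ.injective hpq
  have hdisj : ∀ i j, i ≠ j → (L i).Disjoint (L j) := by
    intro i j hij x hx hy
    simp only [L, List.mem_ofFn] at hx hy
    obtain ⟨p, rfl⟩ := hx
    obtain ⟨q, hq⟩ := hy
    exact hij (congrArg Sigma.fst (φ.injective hq)).symm
  have hsupp : ∀ i, (L i).formPerm.support = (L i).toFinset := fun i =>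
    List.support_formPerm_of_nodup _ (hnd i) fun x hx => by
      have h := congrArg List.length hx
      have := h2 i
      rw [hlen] at h
      simp at h
      omega
  have hpw : (List.ofFn fun i => (L i).formPerm).Pairwise Equiv.Perm.Disjoint := by
    rw [List.pairwise_ofFn]
    intro i j hij
    rw [List.formPerm_disjoint_iff (hnd i) (hnd j) (by simp [hlen, h2]) (by simp [hlen, h2])]
    exact hdisj i j hij.ne
  refine ⟨(List.ofFn fun i => (L i).formPerm).prod, ?_, fun i p q hq => ?_⟩
  · rw [Equiv.Perm.cycleType_eq _ rfl _ hpw, List.map_ofFn]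
    · congr 2
      funext i
      simp [hsupp, List.toFinset_card_of_nodup (hnd i), hlen]
    · intro σ hσ
      obtain ⟨i, rfl⟩ := List.mem_ofFn.1 hσ
      exact List.isCycle_formPerm (hnd i) (by simp [hlen, h2])
  · have hp : (p : ℕ) < (L i).length := by simp [hlen]
    have hget : φ ⟨i, p⟩ = (L i)[(p : ℕ)] := by simp [L]
    rw [← Equiv.Perm.eq_on_support_mem_disjoint (f := (L i).formPerm)
      (List.mem_ofFn.2 ⟨i, rfl⟩) hpw _ (by rw [hsupp, hget]; simp), hget,
      List.formPerm_apply_getElem _ (hnd i)]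
    simp [L, ← hq]

/-- A base permutation of `ZMod t ⊕ Fin s`, developed by translation modulo `t`, completes a
circulant factorization on `ZMod t` paired with a solution on `Fin s`. -/
theorem hasOPSolution_append_of_base {t s : ℕ} [NeZero t] {m m₁ m₂ : List ℕ} (hm : m = m₁ ++ m₂)
    (hs : s = m₁.sum) (ht : t = m₂.sum) (hs0 : 0 < s)
    (hsol : HasOPSolution m₁) (S D : Finset (ZMod t)) (hD : ∀ d, d ∈ D ↔ d ≠ 0 ∧ d ∉ S)
    (hcard : D.card = s - 1) (hfact : CirculantFactorization t D m₂)
    (F : Equiv.Perm (ZMod t ⊕ Fin s)) (hF : F.cycleType = (m : Multiset ℕ))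
    (hFr : ∀ w, ∃ y, F (Sum.inr w) = Sum.inl y)
    (hFS : ∀ x y, F (Sum.inl x) = Sum.inl y → y - x ∈ S)
    (hFu : ∀ d ∈ S, ∃! x, F (Sum.inl x) = Sum.inl (x + d)) :
    HasOPSolution m := by
  subst hs
  obtain ⟨π, hπc, hπu⟩ := hsol
  obtain ⟨ρ, hρc, hρD, hρu⟩ := hfact
  let T : ZMod t → Equiv.Perm (ZMod t ⊕ Fin m₁.sum) := fun j =>
    (Equiv.sumCongr (Equiv.addRight j) (Equiv.refl _)).permCongr F
  have hT : ∀ j x, T j x = Sum.map (· + j) id (F (Sum.map (· - j) id x)) := by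
    rintro j (x | x) <;> simp [T, sub_eq_add_neg]
  let σ : ZMod t ⊕ Fin (m₁.sum - 1) → Equiv.Perm (ZMod t ⊕ Fin m₁.sum) :=
    Sum.elim T fun i => Equiv.Perm.sumCongr (ρ (Fin.cast hcard.symm i)) (π i)
  have key : ∀ (P : ZMod t ⊕ Fin (m₁.sum - 1) → Prop),
      ((∃! j, P (Sum.inl j)) ∧ (∀ i, ¬ P (Sum.inr i)) ∨
        (∀ j, ¬ P (Sum.inl j)) ∧ (∃! i, P (Sum.inr i))) → ∃! i, P i := by
    rintro P (⟨⟨j, hj, hu⟩, hn⟩ | ⟨hn, ⟨j, hj, hu⟩⟩)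
    · refine ⟨Sum.inl j, hj, ?_⟩
      rintro (i | i) hi
      · rw [hu i hi]
      · exact (hn i hi).elim
    · refine ⟨Sum.inr j, hj, ?_⟩
      rintro (i | i) hi
      · exact (hn i hi).elim
      · rw [hu i hi]
  refine HasOPSolution.of_fintype (V := ZMod t ⊕ Fin m₁.sum) (I := ZMod t ⊕ Fin (m₁.sum - 1))
    ?_ ?_ σ ?_ ?_
  · simp [ZMod.card, hm, ← ht, add_comm]
  · simp only [Fintype.card_sum, ZMod.card, Fintype.card_fin, hm, List.sum_append, ← ht]
    omega
  · rintro (j | i)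
    · simp only [σ, Sum.elim_inl, T]
      rw [Equiv.Perm.cycleType_permCongr, hF]
    · simp only [σ, Sum.elim_inr]
      rw [Equiv.Perm.cycleType_sumCongr, hρc, hπc, hm, add_comm]
      rfl
  · intro x y hxy
    apply key
    rcases x with x | x <;> rcases y with y | y
    · have hxy' : y - x ≠ 0 := fun h => hxy (by rw [sub_eq_zero.1 h])
      have hiff : ∀ j, σ (Sum.inl j) (Sum.inl x) = Sum.inl y ↔
          F (Sum.inl (x - j)) = Sum.inl ((x - j) + (y - x)) := by
        intro j
        simp only [σ, Sum.elim_inl, hT, Sum.map_inl]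
        rcases F (Sum.inl (x - j)) with z | z
        · simp only [Sum.map_inl, Sum.inl.injEq]
          constructor <;> intro h
          · rw [← h]; ring
          · rw [h]; ring
        · simp
      by_cases hS : y - x ∈ S
      · left
        obtain ⟨x₀, hx₀, hu⟩ := hFu _ hS
        refine ⟨⟨x - x₀, ?_, fun j hj => ?_⟩, fun i hi => ?_⟩
        · exact (hiff _).2 (by rw [sub_sub_cancel, hx₀])
        · rw [← hu _ ((hiff j).1 hj), sub_sub_cancel]
        · simp only [σ, Sum.elim_inr, Equiv.Perm.sumCongr_apply, Sum.map_inl, Sum.inl.injEq] at hi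
          have := hρD (Fin.cast hcard.symm i) x
          rw [hi, hD] at this
          exact this.2 hS
      · right
        refine ⟨fun j hj => ?_, ?_⟩
        · have := hFS _ _ ((hiff j).1 hj)
          rw [add_sub_cancel_left] at this
          exact hS this
        · obtain ⟨i, hi, hu⟩ := hρu x (y - x) ((hD _).2 ⟨hxy', hS⟩)
          rw [add_sub_cancel] at hi hu
          refine ⟨Fin.cast hcard i, by simpa [σ] using hi, fun i' hi' => ?_⟩
          rw [← hu (Fin.cast hcard.symm i') (by simpa [σ] using hi')]
          simp
    · left
      refine ⟨?_, by simp [σ]⟩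
      have hne : ∀ w, F.symm (Sum.inr y) ≠ Sum.inr w := by
        intro w hw
        obtain ⟨z, hz⟩ := hFr w
        rw [← hw, Equiv.apply_symm_apply] at hz
        simp at hz
      obtain ⟨z, hz⟩ : ∃ z, F.symm (Sum.inr y) = Sum.inl z := by
        rcases h : F.symm (Sum.inr y) with z | z
        · exact ⟨z, rfl⟩
        · exact (hne z h).elim
      have hiff : ∀ j, σ (Sum.inl j) (Sum.inl x) = Sum.inr y ↔ x - j = z := by
        intro j
        have h1 : σ (Sum.inl j) (Sum.inl x) = Sum.inr y ↔ F (Sum.inl (x - j)) = Sum.inr y := by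
          simp only [σ, Sum.elim_inl, hT, Sum.map_inl]
          rcases F (Sum.inl (x - j)) with z | z <;> simp
        rw [h1, ← Equiv.eq_symm_apply, hz, Sum.inl.injEq]
      refine ⟨x - z, by simp only [hiff]; ring, fun j hj => ?_⟩
      rw [← (hiff j).1 hj]; ring
    · left
      refine ⟨?_, by simp [σ]⟩
      obtain ⟨z, hz⟩ := hFr x
      have hiff : ∀ j, σ (Sum.inl j) (Sum.inr x) = Sum.inl y ↔ z + j = y := by
        intro j
        simp [σ, hT, hz]
      refine ⟨y - z, by simp only [hiff]; ring, fun j hj => ?_⟩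
      rw [← (hiff j).1 hj]; ring
    · right
      obtain ⟨z, hz⟩ := hFr x
      refine ⟨fun j => by simp [σ, hT, hz], ?_⟩
      simpa [σ] using hπu x y (fun h => hxy (by rw [h]))

theorem card_filter_odd_sub (a b : ℕ) :
    (Finset.univ.filter fun p : Fin (2 * a + b) => b < (p : ℕ) ∧ ((p : ℕ) - b) % 2 = 1).card
      = a := by
  rw [← Fintype.card_subtype]
  conv_rhs => rw [← Fintype.card_fin a]
  refine Fintype.card_congr
    { toFun := fun p => ⟨((p.1 : ℕ) - b) / 2, ?_⟩
      invFun := fun q => ⟨⟨b + 2 * q + 1, ?_⟩, ?_⟩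
      left_inv := fun p => ?_
      right_inv := fun q => ?_ }
  · have := p.1.2
    have := p.2
    omega
  · have := q.2
    omega
  · constructor
    · show b < b + 2 * (q : ℕ) + 1
      omega
    · show (b + 2 * (q : ℕ) + 1 - b) % 2 = 1
      omega
  · have := p.2
    ext
    show b + 2 * (((p.1 : ℕ) - b) / 2) + 1 = p.1
    omega
  · ext
    show (b + 2 * (q : ℕ) + 1 - b) / 2 = q
    omega

/-- Positions `(i, p)` with `p - tv i` positive and odd are sent to the new vertices `Fin s`, and
the remaining positions are sent to `G`, extending the prescribed vertices `v i p`. -/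
theorem exists_position_equiv {G : Type*} [Fintype G] [DecidableEq G] {k s : ℕ}
    (m sv tv : Fin k → ℕ) (hm : ∀ i, m i = 2 * sv i + tv i) (hsv : ∑ i, sv i = s)
    (hG : Fintype.card G + s = ∑ i, m i) (v : Fin k → ℕ → G)
    (hinj : ∀ i j p q, p ≤ tv i → p < m i → q ≤ tv j → q < m j → v i p = v j q → i = j ∧ p = q) :
    ∃ φ : (Σ i, Fin (m i)) ≃ G ⊕ Fin s,
      (∀ x : Σ i, Fin (m i), (x.2 : ℕ) ≤ tv x.1 → φ x = Sum.inl (v x.1 x.2)) ∧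
      (∀ x, (φ x).isRight ↔ tv x.1 < (x.2 : ℕ) ∧ ((x.2 : ℕ) - tv x.1) % 2 = 1) := by
  let W : (Σ i, Fin (m i)) → Prop := fun x => tv x.1 < (x.2 : ℕ) ∧ ((x.2 : ℕ) - tv x.1) % 2 = 1
  have hW : Fintype.card {x // W x} = s := by
    rw [Fintype.card_subtype, ← Finset.univ_sigma_univ, Finset.card_filter, Finset.sum_sigma,
      ← hsv]
    refine Finset.sum_congr rfl fun i _ => ?_
    rw [← Finset.card_filter]
    have := card_filter_odd_sub (sv i) (tv i)
    rw [← hm] at this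
    exact this
  have hZ : Fintype.card {x // ¬ W x} = Fintype.card G := by
    rw [Fintype.card_subtype_compl, hW, Fintype.card_sigma]
    simp only [Fintype.card_fin]
    omega
  obtain ⟨g, hg⟩ := Finset.exists_equiv_extend_of_card_eq (t := (Finset.univ : Finset G))
    (by rw [hZ, Finset.card_univ])
    (s := Finset.univ.filter fun x : {x // ¬ W x} => (x.1.2 : ℕ) ≤ tv x.1.1)
    (f := fun x => v x.1.1 x.1.2) (Finset.subset_univ _) (by
      rintro ⟨⟨i, p⟩, hx⟩ hp ⟨⟨j, q⟩, hy⟩ hq h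
      simp only [Finset.coe_filter, Finset.mem_univ, true_and, Set.mem_ofPred_eq] at hp hq h
      obtain ⟨rfl, hpq⟩ := hinj i j p q hp p.2 hq q.2 h
      obtain rfl := Fin.ext hpq
      rfl)
  let g' : {x // ¬ W x} ≃ G := g.trans (Equiv.subtypeUnivEquiv Finset.mem_univ)
  let f : {x // W x} ≃ Fin s := Fintype.equivFinOfCardEq hW
  let φ : (Σ i, Fin (m i)) ≃ G ⊕ Fin s :=
    (Equiv.sumCompl W).symm.trans ((Equiv.sumComm _ _).trans (Equiv.sumCongr g' f))
  have hl : ∀ x (h : ¬ W x), φ x = Sum.inl (g' ⟨x, h⟩) := by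
    intro x h
    simp [φ, Equiv.sumCompl_symm_apply_of_neg h]
  have hr : ∀ x (h : W x), φ x = Sum.inr (f ⟨x, h⟩) := by
    intro x h
    simp [φ, Equiv.sumCompl_symm_apply_of_pos h]
  refine ⟨φ, fun x hx => ?_, fun x => ?_⟩
  · have hx' : ¬ W x := fun h => by
      have := h.1
      omega
    rw [hl x hx']
    exact congrArg Sum.inl (hg ⟨x, hx'⟩ (by simpa using hx))
  · by_cases h : W x
    · rw [hr x h]
      exact iff_of_true rfl h
    · rw [hl x h]
      exact iff_of_false (by simp) h

/-- An orthogonal family of paths and cycles extends, by inserting new vertices alternately, to a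
base permutation on `ZMod t ⊕ Fin s` with the prescribed cycle type. -/
theorem exists_base_perm {t k s : ℕ} [NeZero t] (S : Finset (ZMod t)) (m sv tv : Fin k → ℕ)
    (h2 : ∀ i, 2 ≤ m i) (hm : ∀ i, m i = 2 * sv i + tv i) (hsv : ∑ i, sv i = s)
    (hG : t + s = ∑ i, m i) (v : Fin k → ℕ → ZMod t)
    (hinj : ∀ i j p q, p ≤ tv i → p < m i → q ≤ tv j → q < m j → v i p = v j q → i = j ∧ p = q)
    (hvS : ∀ i p, p < tv i → v i ((p + 1) % m i) - v i p ∈ S)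
    (hvu : ∀ d ∈ S, ∃! x : Σ i, Fin (tv i), v x.1 ((x.2 + 1) % m x.1) - v x.1 x.2 = d) :
    ∃ F : Equiv.Perm (ZMod t ⊕ Fin s), F.cycleType = (List.ofFn m : Multiset ℕ) ∧
      (∀ w, ∃ y, F (Sum.inr w) = Sum.inl y) ∧
      (∀ x y, F (Sum.inl x) = Sum.inl y → y - x ∈ S) ∧
      (∀ d ∈ S, ∃! x, F (Sum.inl x) = Sum.inl (x + d)) := by
  obtain ⟨φ, hφv, hφr⟩ := exists_position_equiv m sv tv hm hsv (by rw [ZMod.card, hG]) v hinj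
  obtain ⟨F, hFc, hF⟩ := exists_perm_cycleType_eq_ofFn m h2 φ
  have hpos : ∀ i, 0 < m i := fun i => by have := h2 i; omega
  have htm : ∀ i, tv i ≤ m i := fun i => by have := hm i; omega
  have hmod : ∀ i p, p < m i →
      (p + 1) % m i = p + 1 ∧ p + 1 < m i ∨ (p + 1) % m i = 0 ∧ p + 1 = m i := by
    intro i p hp
    rcases Nat.lt_or_ge (p + 1) (m i) with h | h
    · exact Or.inl ⟨Nat.mod_eq_of_lt h, h⟩
    · have h' : p + 1 = m i := by omega
      exact Or.inr ⟨by rw [h', Nat.mod_self], h'⟩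
  have harc : ∀ i p, p < tv i →
      F (Sum.inl (v i p)) = Sum.inl (v i ((p + 1) % m i)) := by
    intro i p hp
    have hpm : p < m i := hp.trans_le (htm i)
    have h := hF i ⟨p, hpm⟩ ⟨(p + 1) % m i, Nat.mod_lt _ (hpos i)⟩ rfl
    rwa [hφv ⟨i, ⟨p, hpm⟩⟩ hp.le, hφv ⟨i, ⟨(p + 1) % m i, _⟩⟩ (by
      show (p + 1) % m i ≤ tv i
      rcases hmod i p hpm with h | h <;> omega)] at h
  have hconv : ∀ x y, F (Sum.inl x) = Sum.inl y →
      ∃ z : Σ i, Fin (tv i), x = v z.1 z.2 ∧ y = v z.1 ((z.2 + 1) % m z.1) := by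
    intro x y hxy
    obtain ⟨⟨i, p⟩, hip⟩ := φ.surjective (Sum.inl x)
    have h := hF i p ⟨(p + 1) % m i, Nat.mod_lt _ (hpos i)⟩ rfl
    rw [hip, hxy] at h
    have h1 : ¬ (tv i < (p : ℕ) ∧ ((p : ℕ) - tv i) % 2 = 1) := by
      rw [← hφr ⟨i, p⟩, hip]
      simp
    have h3 : ¬ (tv i < (p + 1) % m i ∧ ((p + 1) % m i - tv i) % 2 = 1) := by
      have := hφr ⟨i, ⟨(p + 1) % m i, Nat.mod_lt _ (hpos i)⟩⟩
      rw [← this, ← h]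
      simp
    have hp : (p : ℕ) < tv i := by
      have := p.2
      have := hm i
      rcases hmod i p p.2 with h | h <;> omega
    refine ⟨⟨i, ⟨p, hp⟩⟩, ?_, ?_⟩
    · rw [hφv ⟨i, p⟩ hp.le] at hip
      exact (Sum.inl.inj hip).symm
    · have hxv : x = v i p := by
        rw [hφv ⟨i, p⟩ hp.le] at hip
        exact (Sum.inl.inj hip).symm
      rw [hxv, harc i p hp] at hxy
      exact (Sum.inl.inj hxy).symm
  refine ⟨F, hFc, fun w => ?_, fun x y hxy => ?_, fun d hd => ?_⟩
  · obtain ⟨⟨i, p⟩, hip⟩ := φ.surjective (Sum.inr w)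
    have h := hF i p ⟨(p + 1) % m i, Nat.mod_lt _ (hpos i)⟩ rfl
    rw [hip] at h
    have h1 : tv i < (p : ℕ) ∧ ((p : ℕ) - tv i) % 2 = 1 := by
      rw [← hφr ⟨i, p⟩, hip]
      simp
    have h3 := hφr ⟨i, ⟨(p + 1) % m i, Nat.mod_lt _ (hpos i)⟩⟩
    rw [← h] at h3
    rcases hw : F (Sum.inr w) with y | y
    · exact ⟨y, rfl⟩
    · rw [hw] at h3
      have h4 := h3.1 rfl
      have h5 : tv i < (p + 1) % m i ∧ ((p + 1) % m i - tv i) % 2 = 1 := h4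
      rcases hmod i p p.2 with h | h <;> omega
  · obtain ⟨z, rfl, rfl⟩ := hconv x y hxy
    exact hvS _ _ z.2.2
  · obtain ⟨z, hz, hu⟩ := hvu d hd
    refine ⟨v z.1 z.2, ?_, fun y hy => ?_⟩
    · show F (Sum.inl (v z.1 z.2)) = _
      rw [harc _ _ z.2.2, ← hz, add_sub_cancel]
    · obtain ⟨z', rfl, hz'⟩ := hconv _ _ hy
      rw [hu z' (by show _ - _ = d; rw [← hz', add_sub_cancel_left])]

theorem countP_flatten_ofFn {α : Type*} {k : ℕ} (n : Fin k → ℕ) (a : ∀ i, Fin (n i) → α)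
    (P : α → Prop) [DecidablePred P] :
    (List.ofFn fun i => List.ofFn (a i)).flatten.countP (fun x => P x) =
      (Finset.univ.filter fun x : Σ i, Fin (n i) => P (a x.1 x.2)).card := by
  have h : ∀ (n : ℕ) (a : Fin n → α),
      (List.ofFn a).countP (fun x => P x) = ∑ i, if P (a i) then 1 else 0 := by
    intro n
    induction n with
    | zero => simp
    | succ n ih =>
      intro a
      rw [List.ofFn_succ, List.countP_cons, ih, Fin.sum_univ_succ, add_comm]
      simp
  rw [List.countP_flatten, List.map_ofFn, List.sum_ofFn, Finset.card_filter,
    ← Finset.univ_sigma_univ, Finset.sum_sigma]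
  exact Finset.sum_congr rfl fun i _ => h _ _

theorem pathArcs_eq_ofFn {α : Type*} (l : List α) (n M : ℕ) (hl : l.length = n + 1) (hM : n < M)
    (x : α) : pathArcs l = List.ofFn fun p : Fin n => (l.getD p x, l.getD ((p + 1) % M) x) := by
  apply List.ext_getElem
  · simp [pathArcs, hl]
  · intro i h1 h2
    have hi : i < n := by simpa using h2
    simp only [pathArcs, List.getElem_zip, List.getElem_tail, List.getElem_ofFn]
    rw [Nat.mod_eq_of_lt (by omega), List.getD_eq_getElem _ _ (by omega),
      List.getD_eq_getElem _ _ (by omega)]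

theorem cycleArcs_eq_ofFn {α : Type*} (l : List α) (n : ℕ) (hl : l.length = n) (x : α) :
    cycleArcs l = List.ofFn fun p : Fin n => (l.getD p x, l.getD ((p + 1) % n) x) := by
  apply List.ext_getElem
  · simp [cycleArcs, hl]
  · intro i h1 h2
    have hi : i < n := by simpa using h2
    simp only [cycleArcs, List.getElem_zip, List.getElem_rotate, List.getElem_ofFn, hl]
    rw [List.getD_eq_getElem _ _ (by omega), List.getD_eq_getElem _ _ (by
      rw [hl]; exact Nat.mod_lt _ (by omega))]

/-- Proposition (general recursive construction): with s = m₁+…+m_ℓ < t = m_{ℓ+1}+…+m_k,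
if OP*(m₁,…,m_ℓ) has a solution, and there are S ⊆ Z_t \ {0} and non-negative integers
sᵢ, tᵢ with Circ(t; (Z_t \ {0}) \ S) admitting a (C_{m_{ℓ+1}},…,C_{m_k})-factorization,
Σ sᵢ = s, mᵢ = 2sᵢ + tᵢ, and Circ(t; S) admitting an S-orthogonal (D₁,…,D_k)-subdigraph
where Dᵢ is a tᵢ-arc directed path if tᵢ < mᵢ and a directed mᵢ-cycle if tᵢ = mᵢ,
then OP*(m₁,…,m_k) has a solution. -/
theorem stmt11 (ℓ k : ℕ) (hℓ : 1 ≤ ℓ) (hk : ℓ < k) (m : Fin k → ℕ)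
    (h2 : ∀ i, 2 ≤ m i)
    (s t : ℕ)
    (hs : s = ((List.ofFn m).take ℓ).sum)
    (ht : t = ((List.ofFn m).drop ℓ).sum)
    (hst : s < t) [NeZero t]
    (hsol : HasOPSolution ((List.ofFn m).take ℓ))
    (S : Finset (ZMod t)) (hS0 : (0 : ZMod t) ∉ S)
    (sv tv : Fin k → ℕ)
    (hfact : CirculantFactorization t (Finset.univ \ insert 0 S) ((List.ofFn m).drop ℓ))
    (hsv : ∑ i, sv i = s)
    (hm : ∀ i, m i = 2 * sv i + tv i)
    (horth : ∃ vs : Fin k → List (ZMod t),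
      (∀ i, (vs i).Nodup) ∧
      (∀ i j, i ≠ j → ∀ x ∈ vs i, x ∉ vs j) ∧
      (∀ i, tv i < m i → (vs i).length = tv i + 1) ∧
      (∀ i, tv i = m i → (vs i).length = m i) ∧
      (∀ a ∈ (List.ofFn fun i =>
          if tv i = m i then cycleArcs (vs i) else pathArcs (vs i)).flatten,
        a.2 - a.1 ∈ S) ∧
      (∀ d ∈ S,
        (((List.ofFn fun i =>
            if tv i = m i then cycleArcs (vs i) else pathArcs (vs i)).flatten).filter
          (fun a => a.2 - a.1 = d)).length = 1)) :
    HasOPSolution (List.ofFn m) := by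
  obtain ⟨vs, hnd, hdisj, hlen₁, hlen₂, hmem, hcount⟩ := horth
  have htm : ∀ i, tv i ≤ m i := fun i => by have := hm i; omega
  let v : Fin k → ℕ → ZMod t := fun i p => (vs i).getD p 0
  have harcs : (fun i => if tv i = m i then cycleArcs (vs i) else pathArcs (vs i)) =
      fun i => List.ofFn fun p : Fin (tv i) => (v i p, v i ((p + 1) % m i)) := by
    funext i
    split_ifs with h
    · have := cycleArcs_eq_ofFn (vs i) (tv i) (by rw [hlen₂ i h, h]) 0
      rw [this, ← h]
    · have h' : tv i < m i := lt_of_le_of_ne (htm i) h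
      exact pathArcs_eq_ofFn (vs i) (tv i) (m i) (hlen₁ i h') h' 0
  rw [harcs] at hmem
  simp only [harcs, ← List.countP_eq_length_filter] at hcount
  have hvS : ∀ i p, p < tv i → v i ((p + 1) % m i) - v i p ∈ S := by
    intro i p hp
    refine hmem (v i p, v i ((p + 1) % m i)) (List.mem_flatten.2 ⟨_, List.mem_ofFn.2 ⟨i, rfl⟩, ?_⟩)
    exact List.mem_ofFn.2 ⟨⟨p, hp⟩, rfl⟩
  have hvu : ∀ d ∈ S, ∃! x : Σ i, Fin (tv i), v x.1 ((x.2 + 1) % m x.1) - v x.1 x.2 = d := by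
    intro d hd
    have h := hcount d hd
    rw [countP_flatten_ofFn tv (fun i p => (v i p, v i ((p + 1) % m i)))
      (fun a => a.2 - a.1 = d), Finset.card_eq_one] at h
    obtain ⟨x, hx⟩ := h
    simp only [Finset.ext_iff, Finset.mem_filter, Finset.mem_univ, true_and,
      Finset.mem_singleton] at hx
    exact ⟨x, (hx x).2 rfl, fun y hy => (hx y).1 hy⟩
  have hlen : ∀ i p, p ≤ tv i → p < m i → p < (vs i).length := by
    intro i p hp hp'
    rcases (htm i).lt_or_eq with h | h
    · rw [hlen₁ i h]; omega
    · rw [hlen₂ i h]; omega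
  have hinj : ∀ i j p q, p ≤ tv i → p < m i → q ≤ tv j → q < m j → v i p = v j q →
      i = j ∧ p = q := by
    intro i j p q hp hp' hq hq' h
    have h₁ := hlen i p hp hp'
    have h₂ := hlen j q hq hq'
    simp only [v, List.getD_eq_getElem _ _ h₁, List.getD_eq_getElem _ _ h₂] at h
    by_cases hij : i = j
    · subst hij
      exact ⟨rfl, ((hnd i).getElem_inj_iff).1 h⟩
    · exact (hdisj i j hij _ (List.getElem_mem h₁) (h ▸ List.getElem_mem h₂)).elim
  have hsum : t + s = ∑ i, m i := by
    rw [← List.sum_ofFn, ← List.take_append_drop ℓ (List.ofFn m), List.sum_append, ← hs, ← ht,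
      add_comm]
  have hScard : S.card = ∑ i, tv i := by
    have h : Fintype.card (Σ i, Fin (tv i)) = S.card := by
      rw [← Fintype.card_coe]
      refine Fintype.card_of_bijective
        (f := fun x => (⟨v x.1 ((x.2 + 1) % m x.1) - v x.1 x.2, hvS _ _ x.2.2⟩ : S)) ⟨?_, ?_⟩
      · intro x y hxy
        exact (hvu _ (hvS _ _ y.2.2)).unique (congrArg Subtype.val hxy) rfl
      · rintro ⟨d, hd⟩
        obtain ⟨x, hx, -⟩ := hvu d hd
        exact ⟨x, Subtype.ext hx⟩
    rw [← h, Fintype.card_sigma]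
    simp
  have hs0 : 0 < s := by
    have h : m ⟨0, by omega⟩ ∈ (List.ofFn m).take ℓ := by
      rw [List.mem_take_iff_getElem]
      exact ⟨0, by simp; omega, by simp⟩
    have := List.single_le_sum (fun _ _ => Nat.zero_le _) _ h
    have := h2 ⟨0, by omega⟩
    omega
  have hcard : (Finset.univ \ insert 0 S).card = s - 1 := by
    rw [Finset.card_sdiff_of_subset (Finset.subset_univ _), Finset.card_insert_of_notMem hS0,
      Finset.card_univ, ZMod.card]
    have h : ∑ i, m i = 2 * ∑ i, sv i + ∑ i, tv i := by
      rw [Finset.mul_sum, ← Finset.sum_add_distrib]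
      exact Finset.sum_congr rfl fun i _ => hm i
    omega
  obtain ⟨F, hF, hFr, hFS, hFu⟩ :=
    exists_base_perm S m sv tv h2 hm hsv hsum v hinj hvS hvu
  exact hasOPSolution_append_of_base (List.take_append_drop ℓ (List.ofFn m)).symm hs ht hs0 hsol
    S _ (by simp) hcard hfact F hF hFr hFS hFu
end

section
/- Each of the following directed Oberwolfach problems has a solution: OP*(4, 5); OP*(4, 6); OP*(2, 2, 2, 4); OP*(4, 8); OP*(2, 4, 6); OP*(2^⟨b⟩, 3, 3) for every integer b with 1 ≤ b ≤ 5; and OP*(2^⟨b⟩, 6) for every integer b with 2 ≤ b ≤ 4. -/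
open Equiv Equiv.Perm

/-- The arcs of the directed cycle visiting the entries of `l` in order. -/
def List.cyclicArcs {α : Type*} (l : List α) : List (α × α) :=
  l.zip (l.rotate 1)

theorem List.formPerm_apply_of_mem_cyclicArcs {α : Type*} [DecidableEq α] {l : List α}
    (hl : l.Nodup) {x y : α} (h : (x, y) ∈ l.cyclicArcs) : l.formPerm x = y := by
  obtain ⟨i, hi, h⟩ := List.mem_iff_getElem.1 h
  simp only [List.cyclicArcs, List.length_zip, List.length_rotate, min_self] at hi
  simp only [List.cyclicArcs, List.getElem_zip, List.getElem_rotate, Prod.mk.injEq] at h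
  rw [← h.1, ← h.2, List.formPerm_apply_getElem l hl i hi]

section ProdFormPerm

variable {α : Type*} [DecidableEq α] {C : List (List α)}

theorem List.pairwise_disjoint_map_formPerm (h2 : ∀ l ∈ C, 2 ≤ l.length)
    (hC : C.flatten.Nodup) : (C.map List.formPerm).Pairwise Perm.Disjoint := by
  obtain ⟨hnd, hdisj⟩ := List.nodup_flatten.1 hC
  rw [List.pairwise_map]
  exact hdisj.imp_of_mem fun {a b} ha hb hab =>
    (List.formPerm_disjoint_iff (hnd a ha) (hnd b hb) (h2 a ha) (h2 b hb)).2 hab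

variable [Fintype α]

theorem List.support_formPerm_of_two_le {l : List α} (hl : l.Nodup) (h2 : 2 ≤ l.length) :
    l.formPerm.support = l.toFinset :=
  List.support_formPerm_of_nodup l hl fun x hx => by simp [hx] at h2

theorem List.cycleType_prod_map_formPerm (h2 : ∀ l ∈ C, 2 ≤ l.length)
    (hC : C.flatten.Nodup) :
    (C.map List.formPerm).prod.cycleType = (C.map List.length : Multiset ℕ) := by
  have hnd := (List.nodup_flatten.1 hC).1
  rw [cycleType_eq (C.map List.formPerm) rfl _ (List.pairwise_disjoint_map_formPerm h2 hC),
    List.map_map]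
  · congr 1
    refine List.map_congr_left fun l hl => ?_
    simp [List.support_formPerm_of_two_le (hnd l hl) (h2 l hl),
      List.toFinset_card_of_nodup (hnd l hl)]
  · simp only [List.mem_map]
    rintro _ ⟨l, hl, rfl⟩
    exact List.isCycle_formPerm (hnd l hl) (h2 l hl)

theorem List.prod_map_formPerm_apply (h2 : ∀ l ∈ C, 2 ≤ l.length) (hC : C.flatten.Nodup)
    {x y : α} (h : (x, y) ∈ C.flatMap List.cyclicArcs) :
    (C.map List.formPerm).prod x = y := by
  obtain ⟨l, hl, hxy⟩ := List.mem_flatMap.1 h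
  have hnd := (List.nodup_flatten.1 hC).1 l hl
  rw [← eq_on_support_mem_disjoint (List.mem_map_of_mem hl)
    (List.pairwise_disjoint_map_formPerm h2 hC) x,
    List.formPerm_apply_of_mem_cyclicArcs hnd hxy]
  rw [List.support_formPerm_of_two_le hnd (h2 l hl), List.mem_toFinset]
  exact (List.of_mem_zip hxy).1

end ProdFormPerm

/-- `n - 1` spanning families of disjoint cycles that together contain every arc form a solution:
counting shows that no arc is repeated. -/
theorem HasOPSolution.of_cycles {m : List ℕ} {n : ℕ} (hn : m.sum = n) (hm : ∀ k ∈ m, 2 ≤ k)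
    (C : Fin (n - 1) → List (List (Fin n))) (hlen : ∀ i, (C i).map List.length = m)
    (hnd : ∀ i, (C i).flatten.Nodup)
    (harc : ∀ x y, x ≠ y → ∃ i, (x, y) ∈ (C i).flatMap List.cyclicArcs) :
    HasOPSolution m := by
  have h2 : ∀ i, ∀ l ∈ C i, 2 ≤ l.length := fun i l hl =>
    hm _ (by rw [← hlen i]; exact List.mem_map_of_mem hl)
  subst hn
  refine ⟨fun i => ((C i).map List.formPerm).prod, fun i => ?_, fun x y hxy => ?_⟩
  · rw [List.cycleType_prod_map_formPerm (h2 i) (hnd i), hlen i]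
  · have hex : ∀ z, x ≠ z → ∃ i, ((C i).map List.formPerm).prod x = z := fun z hz =>
      (harc x z hz).imp fun i hi => List.prod_map_formPerm_apply (h2 i) (hnd i) hi
    have hsub : Finset.univ.erase x ⊆
        Finset.univ.image fun i => ((C i).map List.formPerm).prod x := fun z hz => by
      simpa using hex z (Finset.ne_of_mem_erase hz).symm
    have hinj : Function.Injective fun i => ((C i).map List.formPerm).prod x := by
      rw [← Set.injOn_univ, ← Finset.coe_univ]
      refine Finset.card_image_iff.1 (Finset.card_image_le.antisymm ?_)
      simpa using Finset.card_le_card hsub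
    obtain ⟨i, hi⟩ := hex y hxy
    exact ⟨i, hi, fun j hj => hinj (hj.trans hi.symm)⟩

/-- Translation by `i` modulo `n - 1` on the elements of `Fin n` other than the last one,
which is fixed. -/
def Fin.rotateFixingLast {n : ℕ} [NeZero n] (i : Fin (n - 1)) (v : Fin n) : Fin n :=
  if (v : ℕ) = n - 1 then v else Fin.ofNat n ((v + i) % (n - 1))

/-- The rotations of a family of cycles through all translations that fix the last point. -/
def Fin.rotations {n : ℕ} [NeZero n] (S : List (List (Fin n))) (i : Fin (n - 1)) :
    List (List (Fin n)) :=
  S.map (List.map (Fin.rotateFixingLast i))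

theorem hasOPSolution_four_five : HasOPSolution [4, 5] :=
  HasOPSolution.of_cycles (n := 9) rfl (by decide)
    (Fin.rotations [[2, 5, 7, 3], [8, 0, 1, 6, 4]])
    (by decide +kernel) (by decide +kernel) (by decide +kernel)

theorem hasOPSolution_four_six : HasOPSolution [4, 6] :=
  HasOPSolution.of_cycles (n := 10) rfl (by decide)
    ![[[0, 1, 2, 3], [4, 5, 6, 7, 8, 9]],
      [[5, 9, 7, 1], [3, 6, 4, 0, 2, 8]],
      [[5, 7, 6, 8], [1, 9, 0, 3, 4, 2]],
      [[0, 4, 8, 2], [6, 9, 3, 7, 5, 1]],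
      [[3, 2, 6, 1], [9, 8, 7, 0, 5, 4]],
      [[6, 3, 1, 0], [9, 5, 8, 4, 7, 2]],
      [[5, 3, 9, 2], [0, 7, 4, 1, 8, 6]],
      [[7, 9, 6, 2], [8, 1, 4, 3, 5, 0]],
      [[5, 2, 4, 6], [7, 3, 8, 0, 9, 1]]]
    (by decide +kernel) (by decide +kernel) (by decide +kernel)

theorem hasOPSolution_two_two_two_four : HasOPSolution [2, 2, 2, 4] :=
  HasOPSolution.of_cycles (n := 10) rfl (by decide)
    (Fin.rotations [[9, 0], [3, 7], [6, 8], [1, 2, 5, 4]])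
    (by decide +kernel) (by decide +kernel) (by decide +kernel)

theorem hasOPSolution_four_eight : HasOPSolution [4, 8] :=
  HasOPSolution.of_cycles (n := 12) rfl (by decide)
    ![[[0, 1, 2, 3], [4, 5, 6, 7, 8, 9, 10, 11]],
      [[0, 2, 1, 4], [3, 5, 7, 6, 8, 10, 9, 11]],
      [[0, 3, 1, 5], [2, 4, 6, 9, 7, 10, 8, 11]],
      [[0, 4, 1, 6], [2, 5, 3, 11, 10, 7, 9, 8]],
      [[0, 5, 1, 10], [2, 6, 3, 4, 8, 7, 11, 9]],
      [[0, 6, 1, 7], [2, 8, 3, 9, 4, 11, 5, 10]],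
      [[0, 7, 1, 11], [2, 9, 3, 8, 4, 10, 6, 5]],
      [[0, 8, 1, 9], [2, 10, 3, 6, 11, 7, 5, 4]],
      [[10, 4, 7, 3], [2, 0, 9, 5, 11, 1, 8, 6]],
      [[10, 5, 8, 0], [3, 7, 2, 11, 6, 4, 9, 1]],
      [[2, 7, 4, 3], [6, 10, 1, 0, 11, 8, 5, 9]]]
    (by decide +kernel) (by decide +kernel) (by decide +kernel)

theorem hasOPSolution_two_four_six : HasOPSolution [2, 4, 6] :=
  HasOPSolution.of_cycles (n := 12) rfl (by decide)
    (Fin.rotations [[11, 0], [3, 7, 10, 8], [1, 2, 4, 9, 6, 5]])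
    (by decide +kernel) (by decide +kernel) (by decide +kernel)

theorem hasOPSolution_replicate_two_append_three_three (b : ℕ) (h₁ : 1 ≤ b) (h₂ : b ≤ 5) :
    HasOPSolution (List.replicate b 2 ++ [3, 3]) := by
  interval_cases b
  · exact HasOPSolution.of_cycles (n := 8) rfl (by decide)
      (Fin.rotations [[7, 0], [1, 2, 4], [3, 6, 5]])
      (by decide +kernel) (by decide +kernel) (by decide +kernel)
  · exact HasOPSolution.of_cycles (n := 10) rfl (by decide)
      (Fin.rotations [[9, 0], [3, 7], [1, 2, 4], [5, 8, 6]])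
      (by decide +kernel) (by decide +kernel) (by decide +kernel)
  · exact HasOPSolution.of_cycles (n := 12) rfl (by decide)
      (Fin.rotations [[11, 0], [3, 9], [6, 10], [1, 2, 4], [5, 8, 7]])
      (by decide +kernel) (by decide +kernel) (by decide +kernel)
  · exact HasOPSolution.of_cycles (n := 14) rfl (by decide)
      (Fin.rotations [[13, 0], [3, 11], [5, 9], [6, 12], [1, 2, 4], [7, 10, 8]])
      (by decide +kernel) (by decide +kernel) (by decide +kernel)
  · exact HasOPSolution.of_cycles (n := 16) rfl (by decide)
      (Fin.rotations [[15, 0], [3, 13], [5, 11], [6, 14], [8, 12], [1, 2, 4], [7, 10, 9]])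
      (by decide +kernel) (by decide +kernel) (by decide +kernel)

theorem hasOPSolution_replicate_two_append_six (b : ℕ) (h₁ : 2 ≤ b) (h₂ : b ≤ 4) :
    HasOPSolution (List.replicate b 2 ++ [6]) := by
  interval_cases b
  · exact HasOPSolution.of_cycles (n := 10) rfl (by decide)
      (Fin.rotations [[9, 0], [3, 6], [1, 2, 4, 8, 7, 5]])
      (by decide +kernel) (by decide +kernel) (by decide +kernel)
  · exact HasOPSolution.of_cycles (n := 12) rfl (by decide)
      (Fin.rotations [[11, 0], [5, 9], [7, 10], [1, 2, 4, 3, 8, 6]])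
      (by decide +kernel) (by decide +kernel) (by decide +kernel)
  · exact HasOPSolution.of_cycles (n := 14) rfl (by decide)
      (Fin.rotations [[13, 0], [3, 10], [6, 11], [9, 12], [1, 2, 4, 8, 7, 5]])
      (by decide +kernel) (by decide +kernel) (by decide +kernel)

/-- Lemma (special cases): OP*(4,5), OP*(4,6), OP*(2,2,2,4), OP*(4,8), OP*(2,4,6),
OP*(2^⟨b⟩,3,3) for 1 ≤ b ≤ 5, and OP*(2^⟨b⟩,6) for 2 ≤ b ≤ 4 all have solutions. -/
theorem stmt13 :
    HasOPSolution [4, 5] ∧ HasOPSolution [4, 6] ∧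
    HasOPSolution [2, 2, 2, 4] ∧ HasOPSolution [4, 8] ∧
    HasOPSolution [2, 4, 6] ∧
    (∀ b : ℕ, 1 ≤ b → b ≤ 5 → HasOPSolution (List.replicate b 2 ++ [3, 3])) ∧
    (∀ b : ℕ, 2 ≤ b → b ≤ 4 → HasOPSolution (List.replicate b 2 ++ [6])) := by
  exact ⟨hasOPSolution_four_five, hasOPSolution_four_six, hasOPSolution_two_two_two_four,
    hasOPSolution_four_eight, hasOPSolution_two_four_six,
    hasOPSolution_replicate_two_append_three_three, hasOPSolution_replicate_two_append_six⟩
end
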